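/- There exist a sequence of finite connected simple graphs G_n = (V_n, E_n) with |V_n| → ∞ and uniformly bounded degrees, a sequence of symmetric edge weights W_n = (w_n(e) : e ∈ E_n), and a sequence of positive reals δ_n → 0, such that 1 ≤ w_n(e) ≤ 1 + δ_n for every e ∈ E_n and the average total variation mixing times satisfy mix_avg(G_n) ≤ δ_n · mix_avg(G_n, W_n). In particular, the average total variation mixing time is not robust under vanishingly small perturbations of the edge weights. -/

import Mathlib

open Finset Filter
open scoped Classical

/-- Transition matrix of the lazy weighted random walk on a graph:
`P(x,x) = 1/2` and `P(x,y) = w(x,y)/(2 ∑_{z ∼ x} w(x,z))` for `y` adjacent to `x`. -/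
noncomputable def lazyGraphP {V : Type*} [Fintype V] (G : SimpleGraph V) (w : V → V → ℝ) :
    Matrix V V ℝ :=
  fun x y => if y = x then 1 / 2
    else if G.Adj x y then w x y / (2 * ∑ z, if G.Adj x z then w x z else 0) else 0

/-- Stationary distribution of the weighted walk:
`π(x) = (∑_{z ∼ x} w(x,z)) / (∑_v ∑_{z ∼ v} w(v,z))`. -/
noncomputable def graphPi {V : Type*} [Fintype V] (G : SimpleGraph V) (w : V → V → ℝ) :
    V → ℝ :=
  fun x => (∑ z, if G.Adj x z then w x z else 0) /
    (∑ v, ∑ z, if G.Adj v z then w v z else 0)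

/-- Average total variation mixing time of the lazy weighted walk on `(G,w)`:
the first time `t` with `∑_x π(x)·‖Pᵗ(x,·) − π‖_TV ≤ 1/4`. -/
noncomputable def graphMixAvg {V : Type*} [Fintype V] [DecidableEq V] (G : SimpleGraph V)
    (w : V → V → ℝ) : ℕ :=
  sInf {t : ℕ |
    ∑ x, graphPi G w x * ((∑ y, |((lazyGraphP G w) ^ t) x y - graphPi G w y|) / 2) ≤ 1 / 4}

open Finset Filter
open scoped Classical

section chain
variable {X : Type*} [Fintype X] [DecidableEq X]

/-- Symmetric stochastic matrices. -/
structure Sto (P : Matrix X X ℝ) : Prop where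
  nonneg : ∀ x y, 0 ≤ P x y
  symm : ∀ x y, P x y = P y x
  row : ∀ x, ∑ y, P x y = 1

/-- Action of a matrix on functions. -/
noncomputable def ap (P : Matrix X X ℝ) (f : X → ℝ) (x : X) : ℝ := ∑ y, P x y * f y

/-- `ℓ¹` norm. -/
noncomputable def l1 (f : X → ℝ) : ℝ := ∑ x, |f x|

/-- point mass -/
noncomputable def dlt (x : X) (y : X) : ℝ := if y = x then 1 else 0

lemma l1_nonneg (f : X → ℝ) : 0 ≤ l1 f := Finset.sum_nonneg fun _ _ => abs_nonneg _

lemma l1_add (f g : X → ℝ) : l1 (fun x => f x + g x) ≤ l1 f + l1 g := by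
  unfold l1; rw [← Finset.sum_add_distrib]; exact Finset.sum_le_sum fun _ _ => abs_add_le _ _

lemma l1_smul (c : ℝ) (f : X → ℝ) : l1 (fun x => c * f x) = |c| * l1 f := by
  unfold l1; rw [Finset.mul_sum]; exact Finset.sum_congr rfl fun _ _ => abs_mul _ _

lemma l1_sum {ι : Type*} (s : Finset ι) (f : ι → X → ℝ) :
    l1 (fun x => ∑ i ∈ s, f i x) ≤ ∑ i ∈ s, l1 (f i) := by
  unfold l1; rw [Finset.sum_comm]
  exact Finset.sum_le_sum fun _ _ => Finset.abs_sum_le_sum_abs _ _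

lemma l1_sub_le (f g h : X → ℝ) :
    l1 (fun x => f x - h x) ≤ l1 (fun x => f x - g x) + l1 (fun x => g x - h x) := by
  have := l1_add (fun x => f x - g x) (fun x => g x - h x)
  simpa using this

lemma ap_mul (P Q : Matrix X X ℝ) (f : X → ℝ) : ap (P * Q) f = ap P (ap Q f) := by
  funext x
  simp only [ap, Matrix.mul_apply, Finset.sum_mul, Finset.mul_sum]
  rw [Finset.sum_comm]
  exact Finset.sum_congr rfl fun _ _ => Finset.sum_congr rfl fun _ _ => by ring

lemma ap_one (f : X → ℝ) : ap (1 : Matrix X X ℝ) f = f := by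
  funext x; simp [ap, Matrix.one_apply]

lemma ap_pow_succ (P : Matrix X X ℝ) (t : ℕ) (f : X → ℝ) :
    ap (P ^ (t+1)) f = ap P (ap (P ^ t) f) := by rw [pow_succ', ap_mul]

lemma ap_pow_add (P : Matrix X X ℝ) (s t : ℕ) (f : X → ℝ) :
    ap (P ^ (s+t)) f = ap (P ^ s) (ap (P ^ t) f) := by rw [pow_add, ap_mul]

lemma ap_add (P : Matrix X X ℝ) (f g : X → ℝ) :
    ap P (fun x => f x + g x) = fun x => ap P f x + ap P g x := by
  funext x; simp [ap, mul_add, Finset.sum_add_distrib]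

lemma ap_sub (P : Matrix X X ℝ) (f g : X → ℝ) :
    ap P (fun x => f x - g x) = fun x => ap P f x - ap P g x := by
  funext x; simp [ap, mul_sub, Finset.sum_sub_distrib]

lemma ap_smul (P : Matrix X X ℝ) (c : ℝ) (f : X → ℝ) :
    ap P (fun x => c * f x) = fun x => c * ap P f x := by
  funext x; simp only [ap, Finset.mul_sum]
  exact Finset.sum_congr rfl fun _ _ => by ring

lemma ap_sum {ι : Type*} (P : Matrix X X ℝ) (s : Finset ι) (f : ι → X → ℝ) :
    ap P (fun x => ∑ i ∈ s, f i x) = fun x => ∑ i ∈ s, ap P (f i) x := by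
  funext x; simp only [ap, Finset.mul_sum]
  rw [Finset.sum_comm]

lemma ap_dlt (P : Matrix X X ℝ) (x y : X) : ap P (dlt x) y = P y x := by
  simp [ap, dlt]

namespace Sto
variable {P : Matrix X X ℝ}

lemma col (h : Sto P) (y : X) : ∑ x, P x y = 1 := by
  rw [← h.row y]; exact Finset.sum_congr rfl fun _ _ => h.symm _ _

lemma one : Sto (1 : Matrix X X ℝ) where
  nonneg x y := by rw [Matrix.one_apply]; split_ifs <;> norm_num
  symm x y := by simp [Matrix.one_apply, eq_comm]
  row x := by simp [Matrix.one_apply]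

lemma transpose (h : Sto P) : P.transpose = P := by
  ext x y; exact h.symm _ _

lemma pow (h : Sto P) (t : ℕ) : Sto (P ^ t) where
  nonneg := by
    induction t with
    | zero => simpa using (one (X := X)).nonneg
    | succ t ih =>
      intro x y; rw [pow_succ', Matrix.mul_apply]
      exact Finset.sum_nonneg fun _ _ => mul_nonneg (h.nonneg _ _) (ih _ _)
  symm x y := by
    have : (P ^ t).transpose = P ^ t := by rw [Matrix.transpose_pow, h.transpose]
    conv_lhs => rw [← this]
    rfl
  row := by
    induction t with
    | zero => simpa using (one (X := X)).row
    | succ t ih =>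
      intro x; simp only [pow_succ', Matrix.mul_apply]
      rw [Finset.sum_comm]
      simp only [← Finset.mul_sum, ih, mul_one, h.row]

lemma ap_const (h : Sto P) (c : ℝ) : ap P (fun _ => c) = fun _ => c := by
  funext x; simp [ap, ← Finset.sum_mul, h.row]

lemma sum_ap (h : Sto P) (f : X → ℝ) : ∑ x, ap P f x = ∑ x, f x := by
  simp only [ap]; rw [Finset.sum_comm]
  simp only [← Finset.sum_mul, h.col, one_mul]

lemma l1_ap (h : Sto P) (f : X → ℝ) : l1 (ap P f) ≤ l1 f := by
  have : l1 f = ∑ x, ap P (fun y => |f y|) x := (h.sum_ap _).symm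
  rw [this]
  refine Finset.sum_le_sum fun x _ => ?_
  refine (Finset.abs_sum_le_sum_abs _ _).trans (le_of_eq ?_)
  exact Finset.sum_congr rfl fun y _ => by rw [abs_mul, abs_of_nonneg (h.nonneg _ _)]

lemma ap_mono (h : Sto P) {f g : X → ℝ} (hfg : ∀ x, f x ≤ g x) (x : X) : ap P f x ≤ ap P g x :=
  Finset.sum_le_sum fun y _ => mul_le_mul_of_nonneg_left (hfg y) (h.nonneg _ _)

lemma ap_inner (h : Sto P) (f g : X → ℝ) : ∑ x, ap P f x * g x = ∑ x, f x * ap P g x := by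
  simp only [ap, Finset.sum_mul, Finset.mul_sum]
  rw [Finset.sum_comm]
  exact Finset.sum_congr rfl fun x _ => Finset.sum_congr rfl fun y _ => by rw [h.symm y x]; ring

lemma ap_sq (h : Sto P) (f : X → ℝ) (x : X) : (ap P f x)^2 ≤ ap P (fun y => f y ^ 2) x := by
  have h0 : 0 ≤ ap P (fun y => (f y - ap P f x)^2) x :=
    Finset.sum_nonneg fun y _ => mul_nonneg (h.nonneg _ _) (sq_nonneg _)
  have : ap P (fun y => (f y - ap P f x)^2) x = ap P (fun y => f y ^ 2) x - (ap P f x)^2 := by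
    have h1 : ∀ c : ℝ, ap P (fun y => (f y - c)^2) x
        = ap P (fun y => f y ^ 2) x - 2 * c * ap P f x + c^2 := by
      intro c
      have h2 := congrFun (h.ap_const (c^2)) x
      simp only [ap] at *
      rw [← h2, Finset.mul_sum, ← Finset.sum_sub_distrib, ← Finset.sum_add_distrib]
      exact Finset.sum_congr rfl fun y _ => by ring
    rw [h1]; ring
  linarith

lemma norm_ap (h : Sto P) (f : X → ℝ) : ∑ x, (ap P f x)^2 ≤ ∑ x, f x ^ 2 := by
  rw [← h.sum_ap (fun y => f y ^ 2)]
  exact Finset.sum_le_sum fun x _ => h.ap_sq f x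

end Sto

/-- `ℓ¹` distance to uniform from `x` at time `t`. -/
noncomputable def dd (P : Matrix X X ℝ) (t : ℕ) (x : X) : ℝ :=
  ∑ y, |(P ^ t) x y - 1 / (Fintype.card X : ℝ)|

/-- averaged `ℓ¹` distance -/
noncomputable def phi (P : Matrix X X ℝ) (t : ℕ) : ℝ :=
  (∑ x, dd P t x) / (Fintype.card X : ℝ)

variable {P : Matrix X X ℝ}

lemma dd_eq (h : Sto P) (t : ℕ) (x : X) :
    dd P t x = l1 (fun y => ap (P^t) (dlt x) y - 1 / (Fintype.card X : ℝ)) := by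
  unfold dd l1
  exact Finset.sum_congr rfl fun y _ => by simp only [ap_dlt]; rw [(h.pow t).symm]

lemma dd_eq' (h : Sto P) (t : ℕ) (x : X) :
    dd P t x = l1 (ap (P^t) (fun y => dlt x y - 1 / (Fintype.card X : ℝ))) := by
  rw [dd_eq h, ap_sub, (h.pow t).ap_const]

lemma card_pos_of (x : X) : (0:ℝ) < Fintype.card X := by
  have : 0 < Fintype.card X := Fintype.card_pos_iff.mpr ⟨x⟩
  exact_mod_cast this

lemma sum_unif (x : X) : ∑ _y : X, 1 / (Fintype.card X : ℝ) = 1 := by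
  have := card_pos_of x
  simp [Finset.sum_const, Finset.card_univ]; field_simp

lemma dd_le_two (h : Sto P) (t : ℕ) (x : X) : dd P t x ≤ 2 := by
  unfold dd
  calc _ ≤ ∑ y, ((P^t) x y + 1 / (Fintype.card X : ℝ)) := by
        refine Finset.sum_le_sum fun y _ => ?_
        refine (abs_sub _ _).trans ?_
        rw [abs_of_nonneg ((h.pow t).nonneg _ _), abs_of_nonneg (by positivity)]
    _ = 2 := by rw [Finset.sum_add_distrib, (h.pow t).row, sum_unif x]; norm_num

lemma dd_nonneg (t : ℕ) (x : X) : 0 ≤ dd P t x :=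
  Finset.sum_nonneg fun _ _ => abs_nonneg _

lemma dd_anti (h : Sto P) (x : X) : Antitone (fun t => dd P t x) := by
  refine antitone_nat_of_succ_le fun t => ?_
  rw [dd_eq' h, dd_eq' h, ap_pow_succ]; exact h.l1_ap _

lemma phi_anti (h : Sto P) : Antitone (phi P) := by
  intro s t hst
  unfold phi
  gcongr with x _
  exact dd_anti h x hst

lemma phi_nonneg (t : ℕ) : 0 ≤ phi P t :=
  div_nonneg (Finset.sum_nonneg fun _ _ => dd_nonneg _ _) (by positivity)

lemma dd_succ_le (h : Sto P) (t : ℕ) (x : X) : dd P (t+1) x ≤ ∑ y, P x y * dd P t y := by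
  unfold dd
  have h1 : ∀ y, (P^(t+1)) x y - 1 / (Fintype.card X : ℝ)
      = ∑ z, P x z * ((P^t) z y - 1 / (Fintype.card X : ℝ)) := by
    intro y
    simp only [mul_sub, Finset.sum_sub_distrib, ← Finset.sum_mul, h.row, pow_succ',
      Matrix.mul_apply, one_mul]
  simp only [h1, Finset.mul_sum]
  rw [Finset.sum_comm]
  refine Finset.sum_le_sum fun y _ => (Finset.abs_sum_le_sum_abs _ _).trans (le_of_eq ?_)
  exact Finset.sum_congr rfl fun z _ => by rw [abs_mul, abs_of_nonneg (h.nonneg _ _)]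

/-- Survival probability in `S`. -/
noncomputable def surv (P : Matrix X X ℝ) (S : X → Prop) : ℕ → X → ℝ
  | 0, x => if S x then 1 else 0
  | t+1, x => if S x then ∑ y, P x y * surv P S t y else 0

variable {S : X → Prop}

lemma surv_off {t : ℕ} {x : X} (hx : ¬ S x) : surv P S t x = 0 := by
  cases t <;> simp [surv, hx]

lemma surv_nonneg (h : Sto P) (t : ℕ) (x : X) : 0 ≤ surv P S t x := by
  induction t generalizing x with
  | zero => simp only [surv]; split_ifs <;> norm_num
  | succ t ih =>
    simp only [surv]; split_ifs
    · exact Finset.sum_nonneg fun _ _ => mul_nonneg (h.nonneg _ _) (ih _)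
    · exact le_rfl

lemma surv_le_one (h : Sto P) (t : ℕ) (x : X) : surv P S t x ≤ 1 := by
  induction t generalizing x with
  | zero => simp only [surv]; split_ifs <;> norm_num
  | succ t ih =>
    simp only [surv]; split_ifs
    · calc _ ≤ ∑ y, P x y * 1 := Finset.sum_le_sum fun y _ =>
            mul_le_mul_of_nonneg_left (ih y) (h.nonneg _ _)
        _ = 1 := by simp [h.row]
    · norm_num

lemma surv_shift (h : Sto P) (a b : ℕ) :
    ∑ x, surv P S (a+1) x * surv P S b x = ∑ x, surv P S a x * surv P S (b+1) x := by
  have h1 : ∀ a b : ℕ, ∑ x, surv P S (a+1) x * surv P S b x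
      = ∑ x, ∑ y, P x y * surv P S a y * surv P S b x := by
    intro a b
    refine Finset.sum_congr rfl fun x _ => ?_
    by_cases hx : S x
    · simp only [surv, hx, if_true]; rw [Finset.sum_mul]
    · simp [surv_off hx]
  rw [h1]
  have h2 : ∑ x, surv P S a x * surv P S (b+1) x = ∑ x, surv P S (b+1) x * surv P S a x :=
    Finset.sum_congr rfl fun x _ => by ring
  rw [h2, h1, Finset.sum_comm]
  exact Finset.sum_congr rfl fun x _ => Finset.sum_congr rfl fun y _ => by rw [h.symm y x]; ring

lemma surv_sq (h : Sto P) (t : ℕ) : ∑ x, surv P S (2*t) x = ∑ x, surv P S t x ^ 2 := by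
  have h1 : ∀ a b : ℕ, ∑ x, surv P S (a+b) x * surv P S 0 x = ∑ x, surv P S a x * surv P S b x := by
    intro a b
    induction b generalizing a with
    | zero => rfl
    | succ b ih => rw [← surv_shift h, ← ih (a+1)]; ring_nf
  have h2 : ∑ x, surv P S (2*t) x = ∑ x, surv P S (t+t) x * surv P S 0 x := by
    refine Finset.sum_congr rfl fun x _ => ?_
    rw [two_mul]
    by_cases hx : S x
    · simp [surv, hx]
    · simp [surv_off hx]
  rw [h2, h1]
  exact Finset.sum_congr rfl fun x _ => by ring

/-- exit lemma -/
lemma exit_lemma (h : Sto P) (F : X → ℝ) (ε : ℝ) (h0 : ∀ x, 0 ≤ F x) (h1 : ∀ x, ¬ S x → 1 ≤ F x)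
    (hε : 0 ≤ ε)
    (h2 : ∀ x, S x → ap P F x ≤ F x + ε) (t : ℕ) (x : X) : 1 - surv P S t x ≤ F x + t * ε := by
  induction t generalizing x with
  | zero =>
    by_cases hx : S x
    · simp [surv, hx, h0]
    · simp [surv, hx, h1]
  | succ t ih =>
    by_cases hx : S x
    · simp only [surv, hx, if_true]
      have h3 : 1 - ∑ y, P x y * surv P S t y = ∑ y, P x y * (1 - surv P S t y) := by
        simp only [mul_sub, Finset.sum_sub_distrib, mul_one, h.row]
      rw [h3]
      calc _ ≤ ∑ y, P x y * (F y + t * ε) := Finset.sum_le_sum fun y _ =>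
            mul_le_mul_of_nonneg_left (ih y) (h.nonneg _ _)
        _ = ap P F x + t * ε := by
            simp only [mul_add, Finset.sum_add_distrib, ← Finset.sum_mul, h.row, ap, one_mul]
        _ ≤ _ := by push_cast; linarith [h2 x hx]
    · simp only [surv, hx, if_false]
      have := h1 x hx
      have : 0 ≤ ((t+1 : ℕ):ℝ) * ε := by positivity
      linarith

lemma surv_le_prob (h : Sto P) (t : ℕ) (x : X) :
    surv P S t x ≤ ∑ y, (P^t) x y * (if S y then 1 else 0) := by
  induction t generalizing x with
  | zero =>
    simp only [surv, pow_zero, Matrix.one_apply, ite_mul, one_mul, zero_mul, Finset.sum_ite_eq,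
      Finset.mem_univ, if_true, le_refl]
  | succ t ih =>
    have hr : ∑ y, (P^(t+1)) x y * (if S y then (1:ℝ) else 0)
        = ∑ z, P x z * ∑ y, (P^t) z y * (if S y then (1:ℝ) else 0) := by
      simp only [pow_succ', Matrix.mul_apply, Finset.sum_mul, Finset.mul_sum]
      rw [Finset.sum_comm]
      exact Finset.sum_congr rfl fun _ _ => Finset.sum_congr rfl fun _ _ => by ring
    rw [hr]
    by_cases hx : S x
    · simp only [surv, hx, if_true]
      exact Finset.sum_le_sum fun y _ => mul_le_mul_of_nonneg_left (ih y) (h.nonneg _ _)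
    · rw [surv_off hx]
      refine Finset.sum_nonneg fun z _ => mul_nonneg (h.nonneg _ _) (Finset.sum_nonneg fun y _ =>
        mul_nonneg ((h.pow t).nonneg _ _) (by split_ifs <;> norm_num))

lemma surv_upper (h : Sto P) (v Ψ : X → ℝ) (l : ℝ) (hl : l ≤ 1) (hv0 : ∀ x, 0 ≤ v x)
    (hΨ0 : ∀ x, 0 ≤ Ψ x)
    (h0 : ∀ x, S x → v x < 1 → 1 ≤ Ψ x)
    (h1 : ∀ x, S x → v x < 1 → ap P v x ≤ v x)
    (h2 : ∀ x, S x → v x < 1 → ap P Ψ x ≤ (1 - l) * Ψ x) (t : ℕ) (x : X) :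
    surv P S t x ≤ v x + (1 - l)^t * Ψ x := by
  have hl' : 0 ≤ 1 - l := by linarith
  induction t generalizing x with
  | zero =>
    by_cases hx : S x
    · by_cases hv : v x < 1
      · have := h0 x hx hv; have := hv0 x; simp [surv, hx]; linarith
      · have := hΨ0 x; simp [surv, hx]; linarith
    · have := hΨ0 x; have := hv0 x; simp [surv, hx]; linarith
  | succ t ih =>
    have hp : 0 ≤ (1 - l)^(t+1) * Ψ x := mul_nonneg (by positivity) (hΨ0 x)
    by_cases hx : S x
    · by_cases hv : v x < 1
      · simp only [surv, hx, if_true]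
        calc _ ≤ ∑ y, P x y * (v y + (1-l)^t * Ψ y) := Finset.sum_le_sum fun y _ =>
              mul_le_mul_of_nonneg_left (ih y) (h.nonneg _ _)
          _ = ap P v x + (1-l)^t * ap P Ψ x := by
              simp only [mul_add, Finset.sum_add_distrib, ap, Finset.mul_sum]
              congr 1
              exact Finset.sum_congr rfl fun _ _ => by ring
          _ ≤ v x + (1-l)^t * ((1-l) * Ψ x) := add_le_add (h1 x hx hv)
              (mul_le_mul_of_nonneg_left (h2 x hx hv) (by positivity))
          _ = _ := by ring
      · have := surv_le_one (S := S) h (t+1) x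
        linarith
    · rw [surv_off hx]; linarith [hv0 x]

/-- The regeneration bound. -/
lemma regen (h : Sto P) (A C : X → Prop) (hCA : ∀ x, C x → A x) (ε0 ρ : ℝ) (hε0 : 0 ≤ ε0)
    (t s0 : ℕ) [Nonempty X]
    (hρ : ρ = (∑ x, if A x then (0:ℝ) else 1) / Fintype.card X) (hρ2 : ρ ≤ 1/2)
    (hC : ∀ x, C x → l1 (fun y => (P^s0) x y - (if A y then 1 else 0) / (∑ x, if A x then (1:ℝ) else 0))
      ≤ ε0) :
    phi P (2*(t+s0)) ≤ 6 * ((∑ x, surv P (fun x => ¬ C x) t x) / Fintype.card X) + 2 * ε0 + 8 * ρ^2 := by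
  set n : ℝ := (Fintype.card X : ℝ) with hn
  obtain ⟨x0⟩ := (inferInstance : Nonempty X)
  have hnpos : 0 < n := card_pos_of x0
  set a : ℝ := ∑ x, if A x then (1:ℝ) else 0 with ha
  set r : ℝ := ∑ x, if A x then (0:ℝ) else 1 with hr
  have har : a + r = n := by
    rw [ha, hr, ← Finset.sum_add_distrib, hn]
    have : ∀ x, ((if A x then (1:ℝ) else 0) + if A x then (0:ℝ) else 1) = 1 := by
      intro x; split_ifs <;> norm_num
    simp [this]
  have hr0 : 0 ≤ r := Finset.sum_nonneg fun x _ => by split_ifs <;> norm_num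
  have hρ0 : 0 ≤ ρ := by rw [hρ]; positivity
  have hrn : r = ρ * n := by rw [hρ]; field_simp
  have ha2 : n / 2 ≤ a := by nlinarith
  have hapos : 0 < a := by linarith
  set pA : X → ℝ := fun y => (if A y then 1 else 0) / a with hpA
  set e : ℕ → ℝ := fun s => l1 (fun y => ap (P^s) pA y - 1/n) with he
  set u : X → ℝ := surv P (fun x => ¬ C x) t with hu
  have hdist : ∀ (s : ℕ) x, C x → dd P (s0+s) x ≤ ε0 + e s := by
    intro s x hx
    rw [dd_eq h, add_comm s0 s, ap_pow_add]
    refine (l1_sub_le _ (ap (P^s) pA) _).trans ?_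
    refine add_le_add ?_ le_rfl
    have := (h.pow s).l1_ap (fun y => ap (P^s0) (dlt x) y - pA y)
    rw [ap_sub] at this
    refine this.trans ?_
    refine le_trans (le_of_eq ?_) (hC x hx)
    unfold l1
    exact Finset.sum_congr rfl fun y _ => by simp only [ap_dlt, hpA]; rw [(h.pow s0).symm]
  have he0 : ∀ s, 0 ≤ e s := fun s => l1_nonneg _
  have key : ∀ (s t : ℕ) x, dd P (t+(s0+s)) x ≤ 2 * surv P (fun x => ¬ C x) t x + (ε0 + e s) := by
    intro s t
    induction t with
    | zero =>
      intro x
      by_cases hx : C x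
      · simp only [surv, hx, zero_add]; simpa using hdist s x hx
      · simp only [surv, hx, zero_add]
        have := dd_le_two h (s0+s) x
        have := he0 s
        simp; linarith
    | succ t ih =>
      intro x
      by_cases hx : C x
      · have h1 := dd_anti h x (show s0 + s ≤ t+1+(s0+s) by omega)
        have h2 := hdist s x hx
        have h3 := surv_nonneg (S := fun x => ¬ C x) h (t+1) x
        simp only at h1
        linarith
      · have h1 := dd_succ_le h (t+(s0+s)) x
        rw [show t+1+(s0+s) = t+(s0+s)+1 by ring]
        refine h1.trans ?_
        calc _ ≤ ∑ y, P x y * (2 * surv P (fun x => ¬ C x) t y + (ε0 + e s)) :=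
              Finset.sum_le_sum fun y _ => mul_le_mul_of_nonneg_left (ih y) (h.nonneg _ _)
          _ = 2 * (∑ y, P x y * surv P (fun x => ¬ C x) t y) + (ε0 + e s) := by
              simp only [mul_add, Finset.sum_add_distrib, ← Finset.sum_mul, h.row, Finset.mul_sum,
                one_mul]
              congr 1
              exact Finset.sum_congr rfl fun _ _ => by ring
          _ = _ := by simp only [surv, hx, not_false_eq_true, if_true]
  have hebd : ∀ s, e s ≤ (2/n) * ∑ x, (if A x then (0:ℝ) else 1) * dd P s x := by
    intro s
    have h1 : ∀ y, ap (P^s) pA y - 1/n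
        = (-(1/a)) * ∑ x, (if A x then (0:ℝ) else 1) * (ap (P^s) (dlt x) y - 1/n) := by
      intro y
      have h2 : pA = fun y => 1/n + (-(1/a)) * ∑ x, ((if A x then (0:ℝ) else 1) * (dlt x y - 1/n)) := by
        funext y
        have h3 : ∑ x, ((if A x then (0:ℝ) else 1) * (dlt x y - 1/n))
            = (if A y then (0:ℝ) else 1) - r / n := by
          simp only [mul_sub, Finset.sum_sub_distrib, ← Finset.sum_mul, dlt]
          simp [← hr]; ring
        rw [h3, hpA]
        simp only
        split_ifs
        · field_simp; linarith
        · field_simp; linarith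
      rw [h2, ap_add, (h.pow s).ap_const, ap_smul, ap_sum]
      simp only [ap_smul, add_sub_cancel_left]
      congr 1
      refine Finset.sum_congr rfl fun x _ => ?_
      rw [ap_sub, (h.pow s).ap_const]
    have h4 : e s ≤ (1/a) * ∑ x, (if A x then (0:ℝ) else 1) * dd P s x := by
      rw [he]; simp only [h1]
      rw [l1_smul, abs_neg, abs_of_pos (by positivity)]
      refine mul_le_mul_of_nonneg_left ?_ (by positivity)
      refine (l1_sum _ _).trans (Finset.sum_le_sum fun x _ => ?_)
      rw [l1_smul, dd_eq h, abs_of_nonneg (by split_ifs <;> norm_num)]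
    refine h4.trans (mul_le_mul_of_nonneg_right ?_ (Finset.sum_nonneg fun x _ =>
      mul_nonneg (by split_ifs <;> norm_num) (dd_nonneg _ _)))
    rw [div_le_div_iff₀ hapos hnpos]; linarith
  set ub := (∑ x, u x) / n with hub
  have hub' : ∑ x, u x = ub * n := by rw [hub]; field_simp
  have hu0 : ∀ x, 0 ≤ u x := fun x => surv_nonneg h t x
  have he1 : e 0 ≤ 4 * ρ := by
    refine (hebd 0).trans ?_
    have : ∑ x, (if A x then (0:ℝ) else 1) * dd P 0 x ≤ r * 2 := by
      rw [hr, Finset.sum_mul]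
      refine Finset.sum_le_sum fun x _ => mul_le_mul_of_nonneg_left (dd_le_two h _ _)
        (by split_ifs <;> norm_num)
    calc _ ≤ 2/n * (r*2) := mul_le_mul_of_nonneg_left this (by positivity)
      _ = _ := by rw [hrn]; field_simp; ring
  have he2 : e (t+s0) ≤ 4 * ub + ε0 + 8 * ρ^2 := by
    refine (hebd _).trans ?_
    have : ∑ x, (if A x then (0:ℝ) else 1) * dd P (t+s0) x ≤ 2 * (ub * n) + r * (ε0 + e 0) := by
      rw [← hub', hr, Finset.sum_mul, Finset.mul_sum, ← Finset.sum_add_distrib]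
      refine Finset.sum_le_sum fun x _ => ?_
      have h1 := key 0 t x
      rw [add_zero] at h1
      split_ifs
      · have := hu0 x; simp; linarith
      · simp only [one_mul]; exact h1
    calc _ ≤ 2/n * (2 * (ub * n) + r * (ε0 + e 0)) :=
          mul_le_mul_of_nonneg_left this (by positivity)
      _ = 4 * ub + 2 * ρ * (ε0 + e 0) := by rw [hrn]; field_simp; ring
      _ ≤ _ := by nlinarith
  have hfin : phi P (2*(t+s0)) ≤ 2 * ub + (ε0 + e (t+s0)) := by
    unfold phi
    rw [div_le_iff₀ hnpos]
    calc _ ≤ ∑ x, (2 * u x + (ε0 + e (t+s0))) := by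
          refine Finset.sum_le_sum fun x _ => ?_
          have := key (t+s0) t x
          rw [show 2*(t+s0) = t+(s0+(t+s0)) by ring]
          exact this
      _ = _ := by
          rw [Finset.sum_add_distrib, ← Finset.mul_sum, hub']
          simp [← hn]; ring
  linarith

lemma lazy_sq (h : Sto P) (M : Matrix X X ℝ) (hM : Sto M) (hPM : ∀ f x, ap P f x = (f x + ap M f x)/2)
    (f : X → ℝ) : ∑ x, (ap P f x)^2 ≤ ∑ x, f x * ap P f x := by
  have h1 := hM.norm_ap f
  simp only [hPM]
  have : ∑ x, (f x * ((f x + ap M f x)/2) - ((f x + ap M f x)/2)^2)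
      = (∑ x, f x ^ 2 - ∑ x, (ap M f x)^2)/4 := by
    rw [← Finset.sum_sub_distrib, Finset.sum_div]
    exact Finset.sum_congr rfl fun _ _ => by ring
  rw [Finset.sum_sub_distrib] at this
  linarith

lemma gap_dd (h : Sto P) (M : Matrix X X ℝ) (hM : Sto M)
    (hPM : ∀ f x, ap P f x = (f x + ap M f x)/2) (g : ℝ) (hg : g ≤ 1)
    (hgap : ∀ f : X → ℝ, ∑ x, f x = 0 → g * ∑ x, f x ^ 2 ≤ ∑ x, f x ^ 2 - ∑ x, f x * ap P f x)
    (t : ℕ) (x : X) : (dd P t x)^2 ≤ Fintype.card X * (1 - g)^t := by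
  have hn := card_pos_of x
  have hx := sum_unif x
  set n : ℝ := (Fintype.card X : ℝ) with hndef
  set f0 : X → ℝ := fun y => dlt x y - 1/n with hf0
  have hs0 : ∑ y, f0 y = 0 := by
    rw [hf0, Finset.sum_sub_distrib, hx]; simp [dlt]
  have hn0 : ∑ y, f0 y ^ 2 ≤ 1 := by
    have : ∀ y, f0 y ^ 2 = dlt x y - 2/n * dlt x y + 1/n * (1/n) := by
      intro y; simp only [hf0, dlt]; split_ifs <;> ring
    simp only [this, Finset.sum_add_distrib, Finset.sum_sub_distrib, ← Finset.mul_sum, hx]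
    simp [dlt]
    have : 2/n = n⁻¹ + n⁻¹ := by ring
    have : 0 < n⁻¹ := by positivity
    linarith
  have hstep : ∀ t, ∑ y, ap (P^t) f0 y = 0 ∧ ∑ y, (ap (P^t) f0 y)^2 ≤ (1-g)^t := by
    intro t
    induction t with
    | zero => simpa [ap_one] using ⟨hs0, hn0⟩
    | succ t ih =>
      rw [ap_pow_succ]
      refine ⟨by rw [h.sum_ap]; exact ih.1, ?_⟩
      have h1 := lazy_sq h M hM hPM (ap (P^t) f0)
      have h2 := hgap _ ih.1
      rw [pow_succ']
      have : (1-g) * ∑ y, (ap (P^t) f0 y)^2 ≤ (1-g) * (1-g)^t :=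
        mul_le_mul_of_nonneg_left ih.2 (by linarith)
      linarith
  rw [dd_eq' h]
  unfold l1
  have h3 := (hstep t).2
  calc _ ≤ (Finset.univ.card : ℝ) * ∑ y, |ap (P^t) f0 y|^2 := sq_sum_le_card_mul_sum_sq
    _ ≤ n * (1-g)^t := by
        simp only [sq_abs, Finset.card_univ]
        exact mul_le_mul_of_nonneg_left h3 hn.le

end chain

open Finset Filter
open scoped Classical

section slots
variable {X : Type*} [Fintype X] [DecidableEq X] {ι : Type*} [Fintype ι]

/-- Random walk along involutions (slots) `s i` with rates `c * w i`. -/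
noncomputable def slotP (s : ι → X → X) (w : ι → ℝ) (c : ℝ) : Matrix X X ℝ :=
  fun x y => dlt x y + c * ∑ i, w i * (dlt (s i x) y - dlt x y)

lemma dlt_nonneg (x y : X) : 0 ≤ dlt x y := by unfold dlt; split_ifs <;> norm_num

lemma sum_dlt_mul (x : X) (f : X → ℝ) : ∑ y, dlt x y * f y = f x := by
  simp [dlt]

lemma sum_dlt (x : X) : ∑ y, dlt x y = 1 := by
  simp [dlt]

lemma dlt_comm (x y : X) : dlt x y = dlt y x := by
  simp [dlt, eq_comm]

lemma ap_slotP (s : ι → X → X) (w : ι → ℝ) (c : ℝ) (f : X → ℝ) (x : X) :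
    ap (slotP s w c) f x = f x + c * ∑ i, w i * (f (s i x) - f x) := by
  unfold ap slotP
  simp only [add_mul, Finset.sum_add_distrib, sum_dlt_mul]
  congr 1
  simp only [mul_assoc, ← Finset.mul_sum, Finset.sum_mul]
  rw [Finset.sum_comm]
  congr 1
  refine Finset.sum_congr rfl fun i _ => ?_
  simp only [← Finset.mul_sum, sub_mul, Finset.sum_sub_distrib, sum_dlt_mul]

lemma mat_ext_ap {P Q : Matrix X X ℝ} (h : ∀ f x, ap P f x = ap Q f x) : P = Q := by
  ext x y
  have := h (dlt y) x
  rwa [ap_dlt, ap_dlt] at this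

lemma slotP_sto (s : ι → X → X) (w : ι → ℝ) (c : ℝ) (hs : ∀ i x, s i (s i x) = x)
    (hw : ∀ i, 0 ≤ w i) (hc : 0 ≤ c) (hcw : c * ∑ i, w i ≤ 1) : Sto (slotP s w c) where
  nonneg x y := by
    have : slotP s w c x y = (1 - c * ∑ i, w i) * dlt x y + c * ∑ i, w i * dlt (s i x) y := by
      unfold slotP
      simp only [mul_sub, Finset.sum_sub_distrib, Finset.mul_sum, Finset.sum_mul, sub_mul]
      simp only [mul_assoc]; ring
    rw [this]
    exact add_nonneg (mul_nonneg (by linarith) (dlt_nonneg _ _)) (mul_nonneg hc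
      (Finset.sum_nonneg fun i _ => mul_nonneg (hw i) (dlt_nonneg _ _)))
  symm x y := by
    unfold slotP
    rw [dlt_comm x y]
    congr 2
    refine Finset.sum_congr rfl fun i _ => ?_
    congr 2
    unfold dlt
    congr 1
    apply propext
    constructor
    · intro h; rw [h, hs]
    · intro h; rw [h, hs]
  row x := by
    have := ap_slotP s w c (fun _ => 1) x
    simpa [ap] using this

lemma slotP_lazy (s : ι → X → X) (w : ι → ℝ) (c : ℝ) (f : X → ℝ) (x : X) :
    ap (slotP s w c) f x = (f x + ap (slotP s w (2*c)) f x)/2 := by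
  rw [ap_slotP, ap_slotP]; ring

/-- Sum of squares of the differences along slots. -/
noncomputable def en (s : ι → X → X) (f : X → ℝ) : ℝ := ∑ i, ∑ x, (f (s i x) - f x)^2

lemma en_nonneg (s : ι → X → X) (f : X → ℝ) : 0 ≤ en s f :=
  Finset.sum_nonneg fun _ _ => Finset.sum_nonneg fun _ _ => sq_nonneg _

lemma sum_invol (s : X → X) (hs : ∀ x, s (s x) = x) (f : X → ℝ) : ∑ x, f (s x) = ∑ x, f x :=
  Equiv.sum_comp (Function.Involutive.toPerm s hs) f

lemma dirichlet (s : ι → X → X) (w : ι → ℝ) (c : ℝ) (hs : ∀ i x, s i (s i x) = x) (f : X → ℝ) :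
    ∑ x, f x ^ 2 - ∑ x, f x * ap (slotP s w c) f x
      = c/2 * ∑ i, w i * ∑ x, (f (s i x) - f x)^2 := by
  have h1 : ∀ i, ∑ x, (f (s i x) - f x)^2 = -2 * ∑ x, f x * (f (s i x) - f x) := by
    intro i
    have : ∑ x, (f (s i x) - f x)^2 = ∑ x, (f (s i x)^2 - f x ^2) - 2 * ∑ x, f x * (f (s i x) - f x) := by
      rw [Finset.mul_sum, ← Finset.sum_sub_distrib]
      exact Finset.sum_congr rfl fun _ _ => by ring
    rw [this, Finset.sum_sub_distrib, sum_invol (s i) (hs i) (fun x => f x ^ 2)]; ring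
  simp only [h1, ap_slotP]
  rw [← Finset.sum_sub_distrib]
  have : ∀ x, f x ^2 - f x * (f x + c * ∑ i, w i * (f (s i x) - f x))
      = -c * ∑ i, w i * (f x * (f (s i x) - f x)) := by
    intro x
    rw [mul_add, Finset.mul_sum, Finset.mul_sum, Finset.mul_sum]
    have : ∑ i, f x * (c * (w i * (f (s i x) - f x))) = - ∑ i, -c * (w i * (f x * (f (s i x) - f x))) := by
      rw [← Finset.sum_neg_distrib]; exact Finset.sum_congr rfl fun _ _ => by ring
    rw [this]; ring
  simp only [this]
  rw [← Finset.mul_sum, Finset.sum_comm]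
  simp only [Finset.mul_sum]
  refine Finset.sum_congr rfl fun i _ => Finset.sum_congr rfl fun x _ => by ring

lemma foldr_diff (s : ι → X → X) (f : X → ℝ) (r : X) (l : List ι) :
    |f (l.foldr s r) - f r| ≤ l.length * Real.sqrt (en s f) := by
  induction l with
  | nil => simp
  | cons i l ih =>
    simp only [List.foldr_cons, List.length_cons]
    have h1 : |f (s i (l.foldr s r)) - f (l.foldr s r)| ≤ Real.sqrt (en s f) := by
      apply Real.abs_le_sqrt
      unfold en
      refine le_trans ?_ (Finset.single_le_sum (f := fun i => ∑ x, (f (s i x) - f x)^2)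
        (fun _ _ => Finset.sum_nonneg fun _ _ => sq_nonneg _) (Finset.mem_univ i))
      exact Finset.single_le_sum (f := fun x => (f (s i x) - f x)^2)
        (fun _ _ => sq_nonneg _) (Finset.mem_univ _)
    have h2 := abs_sub_le (f (s i (l.foldr s r))) (f (l.foldr s r)) (f r)
    push_cast
    linarith

/-- all points within distance `m` of `r`: pairwise differences are controlled. -/
lemma radius_pair (s : ι → X → X) (m : ℕ) (r : X) (hr : ∀ x, ∃ l : List ι, l.length ≤ m ∧ l.foldr s r = x)
    (f : X → ℝ) (x y : X) : (f x - f y)^2 ≤ 4 * m^2 * en s f := by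
  have h : ∀ x, |f x - f r| ≤ m * Real.sqrt (en s f) := by
    intro x
    obtain ⟨l, hl, rfl⟩ := hr x
    refine (foldr_diff s f r l).trans ?_
    have : (l.length : ℝ) ≤ m := by exact_mod_cast hl
    exact mul_le_mul_of_nonneg_right this (Real.sqrt_nonneg _)
  have h1 : |f x - f y| ≤ 2 * m * Real.sqrt (en s f) := by
    have h2 := abs_sub_le (f x) (f r) (f y)
    have h3 := h x
    have h4 := h y
    rw [abs_sub_comm] at h4
    linarith
  rw [← sq_abs]
  have h5 : |f x - f y|^2 ≤ (2 * m * Real.sqrt (en s f))^2 :=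
    pow_le_pow_left₀ (abs_nonneg _) h1 2
  rw [mul_pow, Real.sq_sqrt (en_nonneg s f)] at h5
  linarith

lemma sum_pairs (f : X → ℝ) (hf : ∑ x, f x = 0) :
    ∑ x, ∑ y, (f x - f y)^2 = 2 * Fintype.card X * ∑ x, f x ^ 2 := by
  have : ∀ x y, (f x - f y)^2 = f x ^2 + f y ^ 2 - 2 * f x * f y := fun x y => by ring
  simp only [this, Finset.sum_sub_distrib, Finset.sum_add_distrib, ← Finset.mul_sum, hf]
  simp [← Finset.mul_sum]; ring

lemma radius_poincare [Nonempty X] (s : ι → X → X) (m : ℕ) (r : X)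
    (hr : ∀ x, ∃ l : List ι, l.length ≤ m ∧ l.foldr s r = x)
    (f : X → ℝ) (hf : ∑ x, f x = 0) : ∑ x, f x ^ 2 ≤ 2 * Fintype.card X * m^2 * en s f := by
  have h1 := sum_pairs f hf
  have hn := card_pos_of r
  have h2 : ∑ x, ∑ y, (f x - f y)^2 ≤ ∑ _x : X, ∑ _y : X, 4 * m^2 * en s f :=
    Finset.sum_le_sum fun x _ => Finset.sum_le_sum fun y _ => radius_pair s m r hr f x y
  simp only [Finset.sum_const, Finset.card_univ, nsmul_eq_mul] at h2
  rw [h1] at h2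
  have h3 : (2 * (Fintype.card X:ℝ)) * ∑ x, f x ^ 2 ≤ (2 * (Fintype.card X:ℝ)) * (2 * Fintype.card X * m^2 * en s f) := by
    linarith
  exact le_of_mul_le_mul_left h3 (by positivity)

end slots

/-- Binary tree of depth `K` in heap numbering. -/
abbrev TT (K : ℕ) : Type := {n : ℕ // n ∈ Finset.Ico 1 (2^(K+1))}

/-- level -/
def tl {K : ℕ} (z : TT K) : ℕ := Nat.log 2 z.1

/-- root -/
def troot (K : ℕ) : TT K := ⟨1, by simp⟩

/-- slot moves on numbers -/
def tsn (K par b n : ℕ) : ℕ :=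
  if (Nat.log 2 n + 1) % 2 = par then (if 2*n+b < 2^(K+1) then 2*n+b else n)
  else (if n % 2 = b ∧ 2 ≤ n then n/2 else n)

lemma log_child (n b : ℕ) (hn : 1 ≤ n) (hb : b < 2) : Nat.log 2 (2*n+b) = Nat.log 2 n + 1 := by
  rw [Nat.log_eq_iff (by left; omega)]
  have h1 := Nat.pow_log_le_self 2 (show n ≠ 0 by omega)
  have h2 := Nat.lt_pow_succ_log_self (b := 2) (by norm_num) n
  rw [Nat.succ_eq_add_one] at h2
  constructor
  · rw [pow_succ]; omega
  · rw [pow_succ]; omega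

lemma log_half (n : ℕ) (hn : 2 ≤ n) : Nat.log 2 n = Nat.log 2 (n/2) + 1 := by
  have := log_child (n/2) (n%2) (by omega) (by omega)
  rwa [Nat.div_add_mod] at this

lemma tsn_mem (K par b n : ℕ) (hn : n ∈ Finset.Ico 1 (2^(K+1))) :
    tsn K par b n ∈ Finset.Ico 1 (2^(K+1)) := by
  simp only [Finset.mem_Ico] at *
  unfold tsn
  split_ifs <;> omega

lemma tsn_invol (K par b n : ℕ) (hp : par < 2) (hb : b < 2) (hn : n ∈ Finset.Ico 1 (2^(K+1))) :
    tsn K par b (tsn K par b n) = n := by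
  simp only [Finset.mem_Ico] at hn
  by_cases h1 : (Nat.log 2 n + 1) % 2 = par
  · by_cases h2 : 2*n+b < 2^(K+1)
    · have e : tsn K par b n = 2*n+b := by simp [tsn, h1, h2]
      rw [e]
      unfold tsn
      rw [log_child n b hn.1 hb, if_neg (by omega), if_pos (by omega)]
      omega
    · have e : tsn K par b n = n := by simp [tsn, h1, h2]
      rw [e, e]
  · by_cases h2 : n % 2 = b ∧ 2 ≤ n
    · have e : tsn K par b n = n/2 := by simp only [tsn, h1, h2, if_false]; simp
      rw [e]
      have := log_half n h2.2
      unfold tsn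
      rw [if_pos (by omega), if_pos (by omega)]
      omega
    · have e : tsn K par b n = n := by simp only [tsn, h1, if_false, h2]
      rw [e, e]

/-- slot moves on the tree -/
def ts {K : ℕ} (i : Fin 2 × Fin 2) (z : TT K) : TT K := ⟨tsn K i.1 i.2 z.1, tsn_mem _ _ _ _ z.2⟩

lemma ts_invol {K : ℕ} (i : Fin 2 × Fin 2) (z : TT K) : ts i (ts i z) = z :=
  Subtype.ext (tsn_invol K i.1 i.2 z.1 i.1.2 i.2.2 z.2)

lemma tl_le {K : ℕ} (z : TT K) : tl z ≤ K := by
  have h := Finset.mem_Ico.1 z.2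
  have := Nat.log_lt_of_lt_pow (by omega) h.2
  unfold tl; omega

lemma tl_eq_zero {K : ℕ} (z : TT K) : tl z = 0 ↔ z = troot K := by
  have h := Finset.mem_Ico.1 z.2
  unfold tl troot
  rw [Nat.log_eq_zero_iff]
  constructor
  · rintro (h1 | h1)
    · exact Subtype.ext (by simp; omega)
    · omega
  · rintro rfl; left; norm_num

lemma tl_root (K : ℕ) : tl (troot K) = 0 := by simp [tl_eq_zero]

lemma tl_lt_iff (K n b : ℕ) (h1 : 1 ≤ n) (hb : b < 2) : 2*n+b < 2^(K+1) ↔ Nat.log 2 n < K := by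
  rw [Nat.log_lt_iff_lt_pow (by norm_num) (by omega), pow_succ]; omega

lemma tsn_sum (K n : ℕ) (hn' : 1 ≤ n) (f : ℕ → ℝ) :
    ∑ i : Fin 2 × Fin 2, (f (Nat.log 2 (tsn K i.1 i.2 n)) - f (Nat.log 2 n))
      = (if Nat.log 2 n < K then 2 * (f (Nat.log 2 n + 1) - f (Nat.log 2 n)) else 0)
        + (if 1 ≤ Nat.log 2 n then f (Nat.log 2 n - 1) - f (Nat.log 2 n) else 0) := by
  simp only [Fintype.sum_prod_type, Fin.sum_univ_two, tsn]
  simp only [Fin.isValue, Fin.val_zero, Fin.val_one]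
  have hc0 := tl_lt_iff K n 0 hn' (by norm_num)
  have hc1 := tl_lt_iff K n 1 hn' (by norm_num)
  have hl0 := log_child n 0 hn' (by norm_num)
  have hl1 := log_child n 1 hn' (by norm_num)
  have hp : 1 ≤ Nat.log 2 n ↔ 2 ≤ n := by
    rw [Nat.le_log_iff_pow_le (by norm_num) (by omega), pow_one]
  have e01 : (0:ℕ) ≠ 1 := by norm_num
  have h4 : 2*n+0 < 2^(K+1) ↔ 2*n+1 < 2^(K+1) := hc0.trans hc1.symm
  have hl0' : Nat.log 2 (2*n) = Nat.log 2 n + 1 := hl0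
  simp only [hp, ← hc1]
  rcases Nat.mod_two_eq_zero_or_one (Nat.log 2 n + 1) with h | h <;>
  rcases Nat.mod_two_eq_zero_or_one n with h' | h' <;>
  by_cases h2 : 2 ≤ n <;>
  by_cases h3 : 2*n+1 < 2^(K+1)
  all_goals
    simp only [h, h', h2, h3, h4, e01, e01.symm, if_true, if_false, true_and, and_true, and_false, hl0, hl1,
      false_and]
    try have h5 := log_half n h2
    try rw [show Nat.log 2 (n/2) = Nat.log 2 n - 1 by omega]
    ring

/-- the level process -/
lemma tl_sum {K : ℕ} (z : TT K) (f : ℕ → ℝ) :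
    ∑ i, (f (tl (ts i z)) - f (tl z))
      = (if tl z < K then 2 * (f (tl z + 1) - f (tl z)) else 0)
        + (if 1 ≤ tl z then f (tl z - 1) - f (tl z) else 0) :=
  tsn_sum K z.1 (Finset.mem_Ico.1 z.2).1 f

lemma tree_radius {K : ℕ} (z : TT K) : ∃ l : List (Fin 2 × Fin 2), l.length ≤ K ∧ l.foldr ts (troot K) = z := by
  suffices h : ∀ m, ∀ z : TT K, tl z = m → ∃ l : List (Fin 2 × Fin 2), l.length = m ∧ l.foldr ts (troot K) = z by
    obtain ⟨l, h1, h2⟩ := h _ z rfl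
    exact ⟨l, by rw [h1]; exact tl_le z, h2⟩
  intro m
  induction m with
  | zero => intro z hz; exact ⟨[], rfl, by rw [tl_eq_zero] at hz; simp [hz]⟩
  | succ m ih =>
    intro z hz
    have hz1 : 2 ≤ z.1 := by
      have h := Finset.mem_Ico.1 z.2
      by_contra hcon
      have : z = troot K := Subtype.ext (by simp [troot]; omega)
      rw [(tl_eq_zero z).2 this] at hz; omega
    set i : Fin 2 × Fin 2 := (⟨(Nat.log 2 z.1) % 2, Nat.mod_lt _ (by norm_num)⟩, ⟨z.1 % 2, Nat.mod_lt _ (by norm_num)⟩) with hi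
    have h1 : (ts i z).1 = z.1/2 := by
      simp only [ts, tsn, hi]
      rw [if_neg (show ¬ (Nat.log 2 z.1 + 1) % 2 = Nat.log 2 z.1 % 2 by omega), if_pos ⟨trivial, hz1⟩]
    have h2 : tl (ts i z) = m := by
      have := log_half z.1 hz1
      unfold tl at hz ⊢
      rw [h1]; omega
    obtain ⟨l, hl, hl2⟩ := ih _ h2
    refine ⟨i :: l, by simp [hl], ?_⟩
    rw [List.foldr_cons, hl2, ts_invol]

lemma card_TT (K : ℕ) : Fintype.card (TT K) = 2^(K+1) - 1 := by
  simp [TT]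

lemma sum_TT (K : ℕ) (f : ℕ → ℝ) : ∑ z : TT K, f (tl z) = ∑ l ∈ Finset.range (K+1), 2^l * f l := by
  have h1 : ∑ z : TT K, f (tl z) = ∑ n ∈ Finset.Ico 1 (2^(K+1)), f (Nat.log 2 n) := by
    rw [← Finset.sum_coe_sort (Finset.Ico 1 (2^(K+1)))]
    rfl
  rw [h1]
  clear h1
  induction K with
  | zero => simp
  | succ K ih =>
    rw [Finset.sum_range_succ, ← ih, ← Finset.sum_Ico_consecutive _ (Nat.one_le_two_pow (n := K+1))
      (Nat.pow_le_pow_right (by norm_num) (by omega : K+1 ≤ K+1+1))]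
    congr 1
    have : ∀ n ∈ Finset.Ico (2^(K+1)) (2^(K+1+1)), f (Nat.log 2 n) = f (K+1) := by
      intro n hn
      rw [Finset.mem_Ico] at hn
      congr 1
      exact (Nat.log_eq_iff (by left; omega)).2 hn
    rw [Finset.sum_congr rfl this]
    simp [pow_succ]; left
    have : (2:ℕ)^K*2*2 - 2^K*2 = 2^K*2 := by omega
    have h2 : (2:ℝ)^K*2*2 - 2^K*2 = 2^K*2 := by ring
    first | exact h2 | (exact_mod_cast congrArg (Nat.cast (R := ℝ)) this)

/-- product of two trees: spectral gap -/
def sPr {K : ℕ} : (Fin 2 × Fin 2) ⊕ (Fin 2 × Fin 2) → TT K × TT K → TT K × TT K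
  | Sum.inl i, x => (ts i x.1, x.2)
  | Sum.inr i, x => (x.1, ts i x.2)

lemma sPr_invol {K : ℕ} (i) (x : TT K × TT K) : sPr i (sPr i x) = x := by
  cases i <;> simp [sPr, ts_invol]

lemma tree_pairs {K : ℕ} (f : TT K → ℝ) : ∑ x, ∑ y, (f x - f y)^2 ≤ (Fintype.card (TT K):ℝ)^2 * (4 * K^2 * en ts f) := by
  have h2 : ∑ x, ∑ y, (f x - f y)^2 ≤ ∑ _x : TT K, ∑ _y : TT K, 4 * (K:ℝ)^2 * en ts f :=
    Finset.sum_le_sum fun x _ => Finset.sum_le_sum fun y _ =>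
      radius_pair ts K (troot K) tree_radius f x y
  simp only [Finset.sum_const, Finset.card_univ, nsmul_eq_mul] at h2
  linarith

lemma en_prod {K : ℕ} (f : TT K × TT K → ℝ) :
    en sPr f = ∑ v : TT K, en ts (fun u => f (u, v)) + ∑ u : TT K, en ts (fun v => f (u, v)) := by
  unfold en
  rw [Fintype.sum_sum_type, Finset.sum_comm (s := (univ : Finset (TT K))),
    Finset.sum_comm (s := (univ : Finset (TT K)))]
  congr 1
  · refine Finset.sum_congr rfl fun i _ => ?_
    rw [Fintype.sum_prod_type, Finset.sum_comm]
    rfl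
  · refine Finset.sum_congr rfl fun i _ => ?_
    rw [Fintype.sum_prod_type]
    rfl

lemma prod_poincare {K : ℕ} (f : TT K × TT K → ℝ) (hf : ∑ x, f x = 0) :
    ∑ x, f x ^ 2 ≤ 4 * Fintype.card (TT K) * K^2 * en sPr f := by
  have hn : (0:ℝ) < Fintype.card (TT K) := card_pos_of (troot K)
  have h1 := sum_pairs f hf
  rw [Fintype.card_prod] at h1
  push_cast at h1
  set n : ℝ := (Fintype.card (TT K):ℝ) with hnn
  have h2 : ∑ x, ∑ y, (f x - f y)^2 ≤ 8 * n^3 * K^2 * en sPr f := by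
    have e1 : ∑ x, ∑ y, (f x - f y)^2 ≤ ∑ x, ∑ y, (2 * (f x - f (y.1, x.2))^2 + 2 * (f (y.1, x.2) - f y)^2) := by
      refine Finset.sum_le_sum fun x _ => Finset.sum_le_sum fun y _ => ?_
      nlinarith [sq_nonneg ((f x - f (y.1, x.2)) - (f (y.1, x.2) - f y))]
    refine e1.trans ?_
    simp only [Finset.sum_add_distrib, ← Finset.mul_sum, Fintype.sum_prod_type]
    have e2 : ∑ u : TT K, ∑ v : TT K, ∑ u' : TT K, ∑ v' : TT K, (f (u, v) - f (u', v))^2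
        ≤ n * ∑ v : TT K, n^2 * (4 * K^2 * en ts (fun u => f (u, v))) := by
      simp only [Finset.sum_const, Finset.card_univ, nsmul_eq_mul, ← hnn]
      simp only [← Finset.mul_sum (a := n)]
      rw [Finset.sum_comm]
      refine mul_le_mul_of_nonneg_left ?_ hn.le
      refine Finset.sum_le_sum fun v _ => ?_
      exact tree_pairs (fun u => f (u, v))
    have e3 : ∑ u : TT K, ∑ v : TT K, ∑ u' : TT K, ∑ v' : TT K, (f (u', v) - f (u', v'))^2
        ≤ n * ∑ u : TT K, n^2 * (4 * K^2 * en ts (fun v => f (u, v))) := by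
      rw [Finset.sum_const, Finset.card_univ, nsmul_eq_mul, ← hnn]
      refine mul_le_mul_of_nonneg_left ?_ hn.le
      rw [Finset.sum_comm]
      refine Finset.sum_le_sum fun v _ => ?_
      exact tree_pairs (fun u => f (v, u))
    have e4 := en_prod f
    rw [e4]
    simp only [← Finset.mul_sum] at e2 e3
    linarith
  rw [h1] at h2
  have h3 : (2 * n^2) * ∑ x, f x ^ 2 ≤ (2 * n^2) * (4 * n * K^2 * en sPr f) := by
    linarith
  exact le_of_mul_le_mul_left h3 (by positivity)

lemma prod_mix {K : ℕ} (hK : 1 ≤ K) (t : ℕ) (x : TT K × TT K) :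
    (dd (slotP (sPr (K := K)) (fun _ => 1) (1/24)) t x)^2
      ≤ (Fintype.card (TT K):ℝ)^2 * (1 - 1/(192 * Fintype.card (TT K) * K^2))^t := by
  have hn : (1:ℝ) ≤ Fintype.card (TT K) := by
    have : 0 < Fintype.card (TT K) := Fintype.card_pos_iff.2 ⟨troot K⟩
    exact_mod_cast this
  have hK' : (1:ℝ) ≤ K := by exact_mod_cast hK
  have h := gap_dd (P := slotP (sPr (K := K)) (fun _ => 1) (1/24))
    (slotP_sto _ _ _ sPr_invol (fun _ => by norm_num) (by norm_num) (by simp; norm_num))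
    (slotP (sPr (K := K)) (fun _ => 1) (2*(1/24)))
    (slotP_sto _ _ _ sPr_invol (fun _ => by norm_num) (by norm_num) (by simp; norm_num))
    (slotP_lazy _ _ _) (1/(192 * Fintype.card (TT K) * K^2)) (by
      rw [div_le_one (by positivity)]
      nlinarith [mul_pos (by linarith : (0:ℝ) < Fintype.card (TT K)) (by linarith : (0:ℝ) < K)]) ?_ t x
  · rw [Fintype.card_prod] at h; push_cast at h; rw [sq (Fintype.card (TT K):ℝ)]; exact h
  · intro f hf
    rw [dirichlet _ _ _ sPr_invol]
    have := prod_poincare f hf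
    simp only [one_mul]
    rw [← en, one_div, inv_mul_le_iff₀ (by positivity)]
    refine this.trans (le_of_eq ?_)
    ring

open Finset Filter
open scoped Classical

/-- four slots of a tree -/
abbrev I4 : Type := Fin 2 × Fin 2
/-- slots of the base chain -/
abbrev IH : Type := (I4 ⊕ I4) ⊕ I4

/-- The base space: pairs of tree vertices with pendant trees. -/
abbrev HH (K : ℕ) (p : ℕ → ℕ → ℕ) : Type :=
  Σ x : TT K × TT K, TT (p (tl x.1) (tl x.2))

/-- slots of the base chain -/
def hs {K : ℕ} {p : ℕ → ℕ → ℕ} : IH → HH K p → HH K p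
  | Sum.inl j, x => if x.2.1 = 1 then ⟨sPr j x.1, troot _⟩ else x
  | Sum.inr i, x => ⟨x.1, ts i x.2⟩

lemma eq_troot {K : ℕ} (z : TT K) : z.1 = 1 ↔ z = troot K :=
  ⟨fun h => Subtype.ext h, fun h => by rw [h]; rfl⟩

/-- root states -/
def isR {K : ℕ} {p : ℕ → ℕ → ℕ} (x : HH K p) : Prop := x.2.1 = 1

/-- embed pairs as root states -/
def rt {K : ℕ} (p : ℕ → ℕ → ℕ) (x : TT K × TT K) : HH K p := ⟨x, troot _⟩

lemma isR_rt {K : ℕ} (p : ℕ → ℕ → ℕ) (x : TT K × TT K) : isR (rt p x) := rfl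

lemma isR_iff {K : ℕ} {p : ℕ → ℕ → ℕ} (x : HH K p) : isR x ↔ rt p x.1 = x := by
  constructor
  · intro h
    obtain ⟨x, z⟩ := x
    have hz := (eq_troot z).1 h
    simp only [rt]; rw [hz]
  · intro h; rw [← h]; exact isR_rt _ _

lemma hs_rt {K : ℕ} {p : ℕ → ℕ → ℕ} (j : I4 ⊕ I4) (x : TT K × TT K) :
    hs (Sum.inl j) (rt p x) = rt p (sPr j x) :=
  if_pos (c := (rt p x).2.1 = 1) (e := rt p x) rfl

lemma hs_nr {K : ℕ} {p : ℕ → ℕ → ℕ} (j : I4 ⊕ I4) (x : HH K p) (hx : ¬ isR x) :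
    hs (Sum.inl j) x = x :=
  if_neg (c := x.2.1 = 1) hx

lemma hs_invol {K : ℕ} {p : ℕ → ℕ → ℕ} (i : IH) (x : HH K p) : hs i (hs i x) = x := by
  rcases i with j | i
  · by_cases h : isR x
    · rw [← (isR_iff x).1 h, hs_rt, hs_rt, sPr_invol]
    · rw [hs_nr j x h, hs_nr j x h]
  · simp [hs, ts_invol]

lemma pow_succ_apply {X : Type*} [Fintype X] [DecidableEq X] (P : Matrix X X ℝ) (t : ℕ) (x y : X) :
    (P^(t+1)) x y = ∑ z, P x z * (P^t) z y := by
  rw [pow_succ', Matrix.mul_apply]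

/-- slot weights -/
def wH (η : ℝ) : IH → ℝ
  | Sum.inl (Sum.inl _) => 1 - η
  | Sum.inl (Sum.inr _) => 1 + η
  | Sum.inr _ => 1

lemma sum_wH (η : ℝ) : ∑ i, wH η i = 12 := by
  simp [wH]; ring

/-- base chain -/
noncomputable def PH (K : ℕ) (p : ℕ → ℕ → ℕ) (η : ℝ) : Matrix (HH K p) (HH K p) ℝ :=
  slotP hs (wH η) (1/24)

lemma wH_nonneg {η : ℝ} (h0 : 0 ≤ η) (h1 : η ≤ 1) (i : IH) : 0 ≤ wH η i := by
  rcases i with (i | i) | i <;> simp only [wH] <;> linarith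

lemma PH_sto (K : ℕ) (p : ℕ → ℕ → ℕ) {η : ℝ} (h0 : 0 ≤ η) (h1 : η ≤ 1) : Sto (PH K p η) :=
  slotP_sto _ _ _ hs_invol (wH_nonneg h0 h1) (by norm_num) (by rw [sum_wH]; norm_num)

/-- level generator of one tree -/
noncomputable def Dg (K : ℕ) (f : ℕ → ℝ) (l : ℕ) : ℝ :=
  (if l < K then 2 * (f (l + 1) - f l) else 0) + (if 1 ≤ l then f (l - 1) - f l else 0)

/-- level generator of the base chain -/
noncomputable def opH (K : ℕ) (p : ℕ → ℕ → ℕ) (η : ℝ) (F : ℕ → ℕ → ℕ → ℝ) (l m j : ℕ) : ℝ :=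
  (if j = 0 then (1 - η) * Dg K (fun a => F a m 0) l + (1 + η) * Dg K (fun a => F l a 0) m else 0)
    + Dg (p l m) (fun a => F l m a) j

/-- function of levels -/
def lv {K : ℕ} {p : ℕ → ℕ → ℕ} (F : ℕ → ℕ → ℕ → ℝ) (x : HH K p) : ℝ :=
  F (tl x.1.1) (tl x.1.2) (tl x.2)

lemma ap_PH {K : ℕ} {p : ℕ → ℕ → ℕ} {η : ℝ} (F : ℕ → ℕ → ℕ → ℝ) (x : HH K p) :
    ap (PH K p η) (lv F) x = lv F x + (1/24) * opH K p η F (tl x.1.1) (tl x.1.2) (tl x.2) := by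
  unfold PH
  rw [ap_slotP]
  congr 2
  rw [Fintype.sum_sum_type, Fintype.sum_sum_type]
  unfold opH
  congr 1
  · by_cases h : isR x
    · rw [← (isR_iff x).1 h]
      obtain ⟨u, v⟩ := x.1
      have hz0 : ∀ x : TT K × TT K, tl (rt p x).2 = 0 := fun x => tl_root _
      simp only [hz0, if_true, wH, ← Finset.mul_sum, hs_rt]
      congr 1
      · congr 1
        refine Eq.trans ?_ (tl_sum u (fun a => F a (tl v) 0))
        refine Finset.sum_congr rfl fun i _ => ?_
        simp only [lv, hz0]; rfl
      · congr 1
        refine Eq.trans ?_ (tl_sum v (fun a => F (tl u) a 0))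
        refine Finset.sum_congr rfl fun i _ => ?_
        simp only [lv, hz0]; rfl
    · have hz0 : tl x.2 ≠ 0 := fun h' => h ((eq_troot _).2 ((tl_eq_zero _).1 h'))
      simp [hs_nr _ _ h, hz0]
  · refine Eq.trans ?_ (tl_sum x.2 (fun a => F (tl x.1.1) (tl x.1.2) a))
    refine Finset.sum_congr rfl fun i _ => ?_
    simp only [hs, wH, one_mul, lv]

/-- sums of level functions over the base space -/
lemma sum_HH {K : ℕ} {p : ℕ → ℕ → ℕ} (F : ℕ → ℕ → ℕ → ℝ) :
    ∑ x : HH K p, lv F x = ∑ l ∈ range (K+1), 2^l * ∑ m ∈ range (K+1), 2^m *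
      ∑ j ∈ range (p l m + 1), 2^j * F l m j := by
  rw [Fintype.sum_sigma, Fintype.sum_prod_type]
  simp only [lv]
  have h1 : ∀ u v : TT K, ∑ z : TT (p (tl u) (tl v)), F (tl u) (tl v) (tl z)
      = ∑ j ∈ range (p (tl u) (tl v) + 1), 2^j * F (tl u) (tl v) j := fun u v => sum_TT _ _
  simp only [h1]
  have h2 : ∀ u : TT K, ∑ v : TT K, ∑ j ∈ range (p (tl u) (tl v) + 1), 2^j * F (tl u) (tl v) j
    = ∑ m ∈ range (K+1), 2^m * ∑ j ∈ range (p (tl u) m + 1), 2^j * F (tl u) m j :=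
      fun u => sum_TT K (fun m => ∑ j ∈ range (p (tl u) m + 1), 2^j * F (tl u) m j)
  simp only [h2]
  exact sum_TT K (fun l => ∑ m ∈ range (K+1), 2^m * ∑ j ∈ range (p l m + 1), 2^j * F l m j)

lemma sum_isR {K : ℕ} {p : ℕ → ℕ → ℕ} (f : HH K p → ℝ) :
    ∑ x, (if isR x then f x else 0) = ∑ x, f (rt p x) := by
  rw [Fintype.sum_sigma]
  refine Finset.sum_congr rfl fun x _ => ?_
  have : ∀ z : TT (p (tl x.1) (tl x.2)), (if isR (⟨x, z⟩ : HH K p) then f ⟨x, z⟩ else 0)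
      = if z = troot _ then f ⟨x, z⟩ else 0 := fun z => if_congr (eq_troot z) rfl rfl
  simp only [this]
  simp [rt]

/-- chain killed in pendants -/
noncomputable def QH (K : ℕ) (p : ℕ → ℕ → ℕ) (η : ℝ) : Matrix (TT K × TT K) (TT K × TT K) ℝ :=
  fun x y => PH K p η (rt p x) (rt p y)

lemma QH_pow_nonneg {K : ℕ} {p : ℕ → ℕ → ℕ} {η : ℝ} (h0 : 0 ≤ η) (h1 : η ≤ 1) (t : ℕ) (x y) :
    0 ≤ (QH K p η ^ t) x y := by
  induction t generalizing x with
  | zero => rw [pow_zero, Matrix.one_apply]; split_ifs <;> norm_num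
  | succ t ih =>
    rw [pow_succ_apply]
    exact Finset.sum_nonneg fun z _ => mul_nonneg ((PH_sto K p h0 h1).nonneg _ _) (ih z)

lemma QH_le_PH {K : ℕ} {p : ℕ → ℕ → ℕ} {η : ℝ} (h0 : 0 ≤ η) (h1 : η ≤ 1) (t : ℕ) (x y) :
    (QH K p η ^ t) x y ≤ (PH K p η ^ t) (rt p x) (rt p y) := by
  have hS := PH_sto K p h0 h1
  induction t generalizing x with
  | zero =>
    simp only [pow_zero, Matrix.one_apply]
    by_cases h : x = y
    · simp [h]
    · simp only [h, if_false]; split_ifs <;> norm_num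
  | succ t ih =>
    rw [pow_succ_apply, pow_succ_apply]
    have h2 := sum_isR (fun z => PH K p η (rt p x) z * (PH K p η ^ t) z (rt p y))
    calc _ ≤ ∑ z, PH K p η (rt p x) (rt p z) * (PH K p η ^ t) (rt p z) (rt p y) :=
          Finset.sum_le_sum fun z _ => mul_le_mul_of_nonneg_left (ih z) (hS.nonneg _ _)
      _ = _ := h2.symm
      _ ≤ _ := Finset.sum_le_sum fun z _ => by
          have := mul_nonneg (hS.nonneg (rt p x) z) ((hS.pow t).nonneg z (rt p y))
          split_ifs
          · exact le_rfl
          · exact this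

lemma surv_QH {K : ℕ} {p : ℕ → ℕ → ℕ} {η : ℝ} (t : ℕ) (x) :
    surv (PH K p η) isR t (rt p x) = ∑ y, (QH K p η ^ t) x y := by
  induction t generalizing x with
  | zero => simp [surv, isR_rt, Matrix.one_apply]
  | succ t ih =>
    simp only [surv, isR_rt, if_true, pow_succ', Matrix.mul_apply]
    rw [Finset.sum_comm]
    simp only [← Finset.mul_sum, ← ih]
    refine Eq.trans ?_ (sum_isR (fun y => PH K p η (rt p x) y * surv (PH K p η) isR t y))
    refine Finset.sum_congr rfl fun y _ => ?_
    split_ifs with h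
    · rfl
    · rw [surv_off h, mul_zero]

/-- plain chain -/
noncomputable def P0 (K : ℕ) : Matrix (TT K × TT K) (TT K × TT K) ℝ :=
  slotP sPr (fun _ => 1) (1/24)

lemma P0_sto (K : ℕ) : Sto (P0 K) :=
  slotP_sto _ _ _ sPr_invol (fun _ => by norm_num) (by norm_num) (by simp; norm_num)

lemma dlt_rt {K : ℕ} (p : ℕ → ℕ → ℕ) (x y : TT K × TT K) : dlt (rt p x) (rt p y) = dlt x y := by
  unfold dlt
  congr 1
  apply propext
  constructor
  · intro h; exact congrArg Sigma.fst h
  · intro h; rw [h]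

lemma QH_le_P0 {K : ℕ} {p : ℕ → ℕ → ℕ} (x y) : QH K p 0 x y ≤ P0 K x y := by
  unfold QH PH P0 slotP
  rw [dlt_rt, Fintype.sum_sum_type]
  have h1 : ∀ j, wH 0 (Sum.inl j) = 1 := by intro j; rcases j with j | j <;> simp [wH]
  simp only [h1, hs_rt, dlt_rt]
  have h3 : ∑ i : I4, wH 0 (Sum.inr i) * (dlt (hs (Sum.inr i) (rt p x)) (rt p y) - dlt x y) ≤ 0 := by
    refine Finset.sum_nonpos fun i _ => ?_
    simp only [wH, one_mul, sub_nonpos]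
    unfold dlt
    split_ifs with h4 h5
    · exact le_rfl
    · exact absurd (congrArg Sigma.fst h4) h5
    · norm_num
    · exact le_rfl
  linarith

lemma QH_le_P0_pow {K : ℕ} {p : ℕ → ℕ → ℕ} (t : ℕ) (x y) : (QH K p 0 ^ t) x y ≤ (P0 K ^ t) x y := by
  induction t generalizing x with
  | zero => simp
  | succ t ih =>
    rw [pow_succ_apply, pow_succ_apply]
    exact Finset.sum_le_sum fun z _ => mul_le_mul (QH_le_P0 _ _) (ih z)
      (QH_pow_nonneg le_rfl (by norm_num) _ _ _) ((P0_sto K).nonneg _ _)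

lemma sum_one_isR {K : ℕ} {p : ℕ → ℕ → ℕ} :
    ∑ x : HH K p, (if isR x then (1:ℝ) else 0) = Fintype.card (TT K × TT K) := by
  rw [sum_isR (fun _ => (1:ℝ))]; simp

/-- comparison with plain chain started from a root state -/
lemma root_compare {K : ℕ} {p : ℕ → ℕ → ℕ} (t : ℕ) (x : TT K × TT K) :
    l1 (fun y => (PH K p 0 ^ t) (rt p x) y
      - (if isR y then 1 else 0) / (∑ x : HH K p, if isR x then (1:ℝ) else 0))
    ≤ 2 * (1 - surv (PH K p 0) isR t (rt p x)) + dd (P0 K) t x := by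
  have hS := PH_sto K p (η := 0) le_rfl (by norm_num)
  rw [sum_one_isR]
  set n : ℝ := (Fintype.card (TT K × TT K) : ℝ) with hn
  set q : HH K p → ℝ := fun y => if isR y then (QH K p 0 ^ t) x y.1 else 0 with hq
  have hqle : ∀ y, q y ≤ (PH K p 0 ^ t) (rt p x) y := by
    intro y
    simp only [hq]
    split_ifs with h
    · have := QH_le_PH (K := K) (p := p) (η := 0) le_rfl (by norm_num) t x y.1
      rw [(isR_iff y).1 h] at this; exact this
    · exact (hS.pow t).nonneg _ _
  have hqs : ∑ y, q y = surv (PH K p 0) isR t (rt p x) := by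
    rw [surv_QH, hq, sum_isR (fun y => (QH K p 0 ^ t) x y.1)]; rfl
  have h1 : l1 (fun y => (PH K p 0 ^ t) (rt p x) y - q y) = 1 - surv (PH K p 0) isR t (rt p x) := by
    unfold l1
    rw [← hqs, ← (hS.pow t).row (rt p x), ← Finset.sum_sub_distrib]
    exact Finset.sum_congr rfl fun y _ => abs_of_nonneg (sub_nonneg.2 (hqle y))
  have h2 : l1 (fun y => q y - (if isR y then 1 else 0) / n)
      = ∑ y, |(QH K p 0 ^ t) x y - 1 / n| := by
    unfold l1
    refine Eq.trans ?_ (sum_isR (fun z : HH K p => |(QH K p 0 ^ t) x z.1 - 1/n|))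
    refine Finset.sum_congr rfl fun y _ => ?_
    simp only [hq]
    split_ifs <;> simp
  have h3 : ∑ y, |(QH K p 0 ^ t) x y - 1 / n| ≤ (1 - surv (PH K p 0) isR t (rt p x)) + dd (P0 K) t x := by
    have h6 : 1 - surv (PH K p 0) isR t (rt p x) = ∑ y, ((P0 K ^ t) x y - (QH K p 0 ^ t) x y) := by
      rw [surv_QH, Finset.sum_sub_distrib, ((P0_sto K).pow t).row x]
    rw [h6]
    unfold dd
    rw [← Finset.sum_add_distrib]
    refine Finset.sum_le_sum fun y _ => ?_
    have h4 := QH_le_P0_pow (p := p) t x y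
    have h5 := abs_sub_le ((QH K p 0 ^ t) x y) ((P0 K ^ t) x y) (1/n)
    rw [abs_sub_comm ((QH K p 0 ^ t) x y) ((P0 K ^ t) x y), abs_of_nonneg (sub_nonneg.2 h4)] at h5
    exact h5
  have := l1_sub_le (fun y => (PH K p 0 ^ t) (rt p x) y) q (fun y => (if isR y then 1 else 0) / n)
  linarith

open Finset Filter
open scoped Classical

/-- drift parameters -/
noncomputable def ca (η : ℝ) : ℝ := η/10 * (1 + η/2)
noncomputable def cb (η : ℝ) : ℝ := η/10 * (1 - η/2)

/-- the cone -/
def cone (k : ℕ) (η : ℝ) (l m : ℕ) : Prop := (1 + ca η)^l ≤ (1 + cb η)^m ∧ l + m < k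

/-- pendant depth -/
noncomputable def pf (P i0 k : ℕ) (η : ℝ) (l m : ℕ) : ℕ :=
  if cone k η l m then P - Nat.log 2 (l + m + i0) else 0

lemma Dg_add (K : ℕ) (f g : ℕ → ℝ) (l : ℕ) :
    Dg K (fun n => f n + g n) l = Dg K f l + Dg K g l := by
  unfold Dg; split_ifs <;> ring

lemma Dg_smul (K : ℕ) (c : ℝ) (f : ℕ → ℝ) (l : ℕ) :
    Dg K (fun n => c * f n) l = c * Dg K f l := by
  unfold Dg; split_ifs <;> ring

lemma Dg_geo (K : ℕ) (x : ℝ) (hx : x ≠ 0) (l : ℕ) (hl : l < K) :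
    Dg K (fun n => x^n) l = x^l * (2*(x-1) + (1/x-1)) - (if l = 0 then (1/x-1) else 0) := by
  unfold Dg
  rw [if_pos hl]
  rcases l with _ | l
  · simp
  · simp only [Nat.le_add_left, if_true, Nat.add_sub_cancel, Nat.add_eq_zero_iff, one_ne_zero, and_false, if_false]
    simp only [pow_succ]; field_simp; ring

lemma Dg_half (K l : ℕ) (hl : l < K) :
    Dg K (fun n => (1/2:ℝ)^n) l = if l = 0 then -1 else 0 := by
  rw [Dg_geo K _ (by norm_num) l hl]
  split_ifs <;> norm_num

lemma Dg_half_le (K l : ℕ) (hl : l < K) : Dg K (fun n => (1/2:ℝ)^n) l ≤ 0 := by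
  rw [Dg_half K l hl]; split_ifs <;> norm_num

lemma ca_pos {η : ℝ} (h0 : 0 < η) : 0 < ca η := by unfold ca; positivity
lemma cb_pos {η : ℝ} (h0 : 0 < η) (h1 : η ≤ 1/10) : 0 < cb η := by
  unfold cb; apply mul_pos <;> linarith
lemma cb_le_ca {η : ℝ} (h0 : 0 < η) : cb η ≤ ca η := by
  unfold ca cb; nlinarith

/-- the function Φ -/
noncomputable def Ph (η : ℝ) (l m : ℕ) : ℝ :=
  (1/(1+ca η))^l * (1+cb η)^m + (1+cb η)^l * (1/(1+ca η))^m

lemma TAB {η : ℝ} (h0 : 0 < η) (h1 : η ≤ 1/10) :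
    (2*(1/(1+ca η)-1) + ((1+ca η)-1)) + (2*((1+cb η)-1) + (1/(1+cb η)-1)) ≤ -(η^2/20) := by
  have ha := ca_pos h0
  have hb := cb_pos h0 h1
  have e1 : 1/(1+ca η) ≤ 1 - ca η + (ca η)^2 := by
    rw [div_le_iff₀ (by linarith)]; nlinarith [pow_pos ha 3]
  have e2 : 1/(1+cb η) ≤ 1 - cb η + (cb η)^2 := by
    rw [div_le_iff₀ (by linarith)]; nlinarith [pow_pos hb 3]
  have e3 : ca η - cb η = η^2/10 := by unfold ca cb; ring
  have e4 : 2 * (ca η)^2 + (cb η)^2 ≤ η^2/25 := by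
    have : ca η ≤ η/10 * (21/20) := by unfold ca; nlinarith
    have h3 : cb η ≤ η/10 := by unfold cb; nlinarith
    nlinarith [mul_self_nonneg η]
  nlinarith [sq_nonneg η]

lemma Ph_pos {η : ℝ} (h0 : 0 < η) (h1 : η ≤ 1/10) (l m : ℕ) : 0 < Ph η l m := by
  have ha := ca_pos h0
  have hb := cb_pos h0 h1
  unfold Ph; positivity

lemma Ph_cone {η : ℝ} (h0 : 0 < η) (h1 : η ≤ 1/10) (k l m : ℕ) (hc : cone k η l m) : 1 ≤ Ph η l m := by
  have ha := ca_pos h0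
  have hb := cb_pos h0 h1
  unfold Ph
  have h3 : 1 ≤ (1/(1+ca η))^l * (1+cb η)^m := by
    rw [one_div, inv_pow, inv_mul_eq_div, one_le_div (by positivity)]; exact hc.1
  have : 0 < (1+cb η)^l * (1/(1+ca η))^m := by positivity
  linarith

lemma Ph_op {η : ℝ} (h0 : 0 < η) (h1 : η ≤ 1/10) (K l m : ℕ) (hl : l < K) (hm : m < K) :
    Dg K (fun a => Ph η a m) l + Dg K (fun a => Ph η l a) m ≤ -(η^2/20) * Ph η l m := by
  have ha := ca_pos h0
  have hb := cb_pos h0 h1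
  have hab := cb_le_ca h0
  have hT := TAB h0 h1
  have hp := Ph_pos h0 h1 l m
  set A := 1/(1+ca η) with hA
  set B := 1+cb η with hB
  have hA0 : 0 < A := by positivity
  have hB1 : 1 ≤ B := by linarith
  have hA1 : A ≤ 1 := by rw [hA, div_le_one (by linarith)]; linarith
  have hAi : 1/A - 1 = ca η := by rw [hA]; field_simp; ring
  have hBi : -(cb η) ≤ 1/B - 1 := by
    have : 1 - cb η ≤ 1/B := by
      rw [le_div_iff₀ (by linarith), hB]; nlinarith
    linarith
  have e1 : Dg K (fun a => Ph η a m) l = B^m * Dg K (fun n => A^n) l + A^m * Dg K (fun n => B^n) l := by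
    rw [← Dg_smul, ← Dg_smul, ← Dg_add]; congr 1; funext a; unfold Ph; rw [← hA, ← hB]; ring
  have e2 : Dg K (fun a => Ph η l a) m = A^l * Dg K (fun n => B^n) m + B^l * Dg K (fun n => A^n) m := by
    rw [← Dg_smul, ← Dg_smul, ← Dg_add]; congr 1
  have hcorr : ∀ m : ℕ, 0 ≤ B^m * (1/A-1) + A^m * (1/B-1) := by
    intro m
    have h3 : A^m ≤ 1 := pow_le_one₀ hA0.le hA1
    have h4 : 1 ≤ B^m := one_le_pow₀ hB1
    have h5 : 0 < A^m := by positivity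
    rw [hAi]
    have : A^m * (-(cb η)) ≤ A^m * (1/B-1) := mul_le_mul_of_nonneg_left hBi h5.le
    nlinarith
  rw [e1, e2, Dg_geo K A hA0.ne' l hl, Dg_geo K A hA0.ne' m hm, Dg_geo K B (by linarith) l hl,
    Dg_geo K B (by linarith) m hm]
  have hPh : Ph η l m = A^l * B^m + B^l * A^m := rfl
  have hmain : B^m * (A^l * (2*(A-1) + (1/A-1))) + A^m * (B^l * (2*(B-1) + (1/B-1)))
      + (A^l * (B^m * (2*(B-1) + (1/B-1))) + B^l * (A^m * (2*(A-1) + (1/A-1))))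
      ≤ -(η^2/20) * Ph η l m := by
    have : B^m * (A^l * (2*(A-1) + (1/A-1))) + A^m * (B^l * (2*(B-1) + (1/B-1)))
      + (A^l * (B^m * (2*(B-1) + (1/B-1))) + B^l * (A^m * (2*(A-1) + (1/A-1))))
      = ((2*(A-1) + (1/A-1)) + (2*(B-1) + (1/B-1))) * Ph η l m := by rw [hPh]; ring
    rw [this]
    refine mul_le_mul_of_nonneg_right ?_ hp.le
    rw [hAi]
    have : (1 + ca η) - 1 = ca η := by ring
    rw [this] at hT
    exact hT
  have c1 := hcorr m
  have c2 := hcorr l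
  split_ifs <;> nlinarith

/-- gauge in the pendant -/
noncomputable def gz (p j : ℕ) : ℝ := 1 - (1/2)^j - j * (1/2)^(p+1)

lemma gz_zero (p : ℕ) : gz p 0 = 0 := by simp [gz]

lemma gz_le (p j : ℕ) : gz p j ≤ 1 := by
  unfold gz
  have h1 : (0:ℝ) < (1/2)^j := by positivity
  have h2 : (0:ℝ) ≤ j * (1/2)^(p+1) := by positivity
  linarith

lemma gz_ge (p j : ℕ) (hj : j ≤ p) : -1 ≤ gz p j := by
  unfold gz
  have h1 : (1/2:ℝ)^j ≤ 1 := pow_le_one₀ (by norm_num) (by norm_num)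
  have h2 : (j:ℝ) * (1/2)^(p+1) ≤ 1 := by
    have h3 : (j:ℝ) < 2^(p+1) := by
      have : j < 2^(p+1) := lt_of_le_of_lt hj ((Nat.lt_two_pow_self).trans_le (Nat.pow_le_pow_right (by norm_num) (by omega)))
      exact_mod_cast this
    rw [one_div, inv_pow, ← div_eq_mul_inv, div_le_one (by positivity)]; exact h3.le
  linarith

lemma Dg_gz (p j : ℕ) (h1 : 1 ≤ j) (hj : j ≤ p) : Dg p (gz p) j = -(1/2)^(p+1) := by
  obtain ⟨j, rfl⟩ : ∃ i, j = i + 1 := ⟨j - 1, by omega⟩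
  unfold Dg
  rw [if_pos h1, Nat.add_sub_cancel]
  rcases hj.lt_or_eq with h | h
  · rw [if_pos h]; unfold gz; push_cast; simp only [pow_succ]; ring
  · rw [if_neg (by omega)]
    unfold gz
    rw [← h]; push_cast; simp only [pow_succ]; ring

lemma Dg_congr (K : ℕ) {f g : ℕ → ℝ} (h : ∀ n, f n = g n) (l : ℕ) : Dg K f l = Dg K g l := by
  rw [funext h]

/-- the supersolution for the unweighted chain -/
noncomputable def Psi (p : ℕ → ℕ → ℕ) (K0 : ℕ) (η : ℝ) (l m j : ℕ) : ℝ :=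
  (3 - ((l:ℝ)+m)/K0) + Ph η l m * (1 + η^2/80 * gz (p l m) j)

lemma Dg_lin (K K0 l : ℕ) (c : ℝ) (hl : l < K) :
    Dg K (fun a => c - (a:ℝ)/K0) l ≤ -(1/K0) := by
  unfold Dg
  rw [if_pos hl]
  have h0 : (0:ℝ) ≤ 1/K0 := by positivity
  rcases l with _ | l
  · have e : (2:ℝ) * (c - ((0+1:ℕ):ℝ)/K0 - (c - ((0:ℕ):ℝ)/K0)) = -(2 * (1/K0)) := by push_cast; ring
    rw [if_neg (by omega), e]
    linarith
  · rw [if_pos (by omega), Nat.add_sub_cancel]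
    push_cast
    apply le_of_eq; ring

lemma Psi_op {η : ℝ} (h0 : 0 < η) (h1 : η ≤ 1/10) (K K0 P i0 k r l m j : ℕ) (lam : ℝ)
    (hlm : l + m < K0) (hK : K0 ≤ K) (hj : j ≤ pf P i0 k η l m) (hr : 2^r < l + m + i0) (hrP : r ≤ P)
    (hqP : cone k η l m → Nat.log 2 (l+m+i0) ≤ P)
    (hlam : lam = η^2/80 * 2^r / 2^P / 256) (hlam2 : 36 * lam * K0 ≤ 1) :
    opH K (pf P i0 k η) 0 (Psi (pf P i0 k η) K0 η) l m j ≤ - 24 * lam * Psi (pf P i0 k η) K0 η l m j := by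
  set p := pf P i0 k η with hp
  have hPh := Ph_pos h0 h1 l m
  have hK0 : (0:ℝ) < K0 := by
    have : 0 < K0 := by omega
    exact_mod_cast this
  have hlam0 : 0 < lam := by rw [hlam]; positivity
  have hlamk : lam ≤ η^2/80/256 := by
    rw [hlam]
    have : (2:ℝ)^r / 2^P ≤ 1 := by
      rw [div_le_one (by positivity)]; exact pow_le_pow_right₀ (by norm_num) hrP
    have h5 : (0:ℝ) < η^2/80/256 := by positivity
    calc η^2/80 * 2^r / 2^P / 256 = η^2/80/256 * (2^r/2^P) := by ring
      _ ≤ η^2/80/256 * 1 := mul_le_mul_of_nonneg_left this h5.le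
      _ = _ := by ring
  have hs : (0:ℝ) ≤ ((l:ℝ)+m)/K0 := by positivity
  unfold opH
  by_cases hj0 : j = 0
  · subst hj0
    simp only [if_true, sub_zero, add_zero, one_mul]
    have e1 : Dg K (fun a => Psi p K0 η a m 0) l ≤ -(1/K0) + Dg K (fun a => Ph η a m) l := by
      have : Dg K (fun a => Psi p K0 η a m 0) l = Dg K (fun a => (3 - m/K0) - (a:ℝ)/K0) l + Dg K (fun a => Ph η a m) l := by
        rw [← Dg_add]; refine Dg_congr K (fun n => ?_) l
        simp only [Psi, gz_zero]; ring
      rw [this]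
      linarith [Dg_lin K K0 l (3 - m/K0) (by omega)]
    have e2 : Dg K (fun a => Psi p K0 η l a 0) m ≤ -(1/K0) + Dg K (fun a => Ph η l a) m := by
      have : Dg K (fun a => Psi p K0 η l a 0) m = Dg K (fun a => (3 - l/K0) - (a:ℝ)/K0) m + Dg K (fun a => Ph η l a) m := by
        rw [← Dg_add]; refine Dg_congr K (fun n => ?_) m
        simp only [Psi, gz_zero]; ring
      rw [this]
      linarith [Dg_lin K K0 m (3 - l/K0) (by omega)]
    have e3 := Ph_op h0 h1 K l m (by omega) (by omega)
    have e4 : Dg (p l m) (fun a => Psi p K0 η l m a) 0 ≤ η^2/80 * Ph η l m := by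
      unfold Dg
      have hη : 0 < η^2/80 * Ph η l m := by positivity
      simp only [zero_add, Nat.lt_iff_add_one_le]
      split_ifs with h2 h3
      · omega
      · simp only [Psi, gz_zero]
        have : gz (p l m) 1 ≤ 1/2 := by
          unfold gz
          have : (0:ℝ) < (1/2)^(p l m + 1) := by positivity
          norm_num at *
        nlinarith
      · omega
      · simp; exact hη.le
    have e5 : Psi p K0 η l m 0 ≤ 3 + Ph η l m := by
      simp only [Psi, gz_zero]; linarith
    have e6 : 24 * lam * Psi p K0 η l m 0 ≤ 24 * lam * (3 + Ph η l m) :=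
      mul_le_mul_of_nonneg_left e5 (by positivity)
    have e7 : 36 * lam ≤ 1/K0 := by rw [le_div_iff₀ hK0]; exact hlam2
    nlinarith
  · have hj1 : 1 ≤ j := by omega
    have hc : cone k η l m := by
      by_contra hc
      rw [hp] at hj
      simp only [pf, hc, if_false] at hj; omega
    have hPh1 := Ph_cone h0 h1 k l m hc
    rw [if_neg hj0, zero_add]
    have e1 : Dg (p l m) (fun a => Psi p K0 η l m a) j = (Ph η l m * (η^2/80)) * Dg (p l m) (gz (p l m)) j := by
      unfold Dg Psi
      split_ifs <;> ring
    rw [e1, Dg_gz _ _ hj1 hj]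
    have e5 : Psi p K0 η l m j ≤ 5 * Ph η l m := by
      simp only [Psi]
      have := gz_le (p l m) j
      have h6 : η^2/80 * gz (p l m) j ≤ 1 := by
        have : η^2/80 ≤ 1 := by nlinarith
        nlinarith [sq_nonneg η]
      nlinarith
    have hpv : p l m = P - Nat.log 2 (l+m+i0) := by simp [hp, pf, hc]
    have hrq : r ≤ Nat.log 2 (l+m+i0) := Nat.le_log_of_pow_le (by norm_num) hr.le
    have e6 : (2:ℝ)^r / 2^P ≤ (1/2)^(p l m) := by
      rw [div_le_iff₀ (by positivity), one_div, inv_pow, inv_mul_eq_div, le_div_iff₀ (by positivity), ← pow_add]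
      exact pow_le_pow_right₀ (by norm_num) (by have := hqP hc; omega)
    have e7 : 24 * lam * Psi p K0 η l m j ≤ 24 * lam * (5 * Ph η l m) :=
      mul_le_mul_of_nonneg_left e5 (by positivity)
    have e8 : lam = η^2/80/256 * (2^r / 2^P) := by rw [hlam]; ring
    have e9 : lam ≤ η^2/80/256 * (1/2)^(p l m) := by
      rw [e8]; exact mul_le_mul_of_nonneg_left e6 (by positivity)
    rw [pow_succ (1/2:ℝ) (p l m)]
    have e10 : 120 * lam ≤ η^2/80 * (1/2)^(p l m) * (1/2) := by
      have : (0:ℝ) < η^2/80 * (1/2)^(p l m) := by positivity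
      nlinarith
    have e11 := mul_le_mul_of_nonneg_right e10 hPh.le
    have e12 : Ph η l m * (η^2/80) * (-((1/2)^(p l m) * (1/2))) = -(η^2/80 * (1/2)^(p l m) * (1/2) * Ph η l m) := by ring
    rw [e12]
    linarith

lemma Psi_nonneg {η : ℝ} (h0 : 0 < η) (h1 : η ≤ 1/10) (p : ℕ → ℕ → ℕ) (K0 l m j : ℕ) (hj : j ≤ p l m)
    (hK0 : 0 < K0) (hs : l + m ≤ 3 * K0) : 0 ≤ Psi p K0 η l m j := by
  have hPh := Ph_pos h0 h1 l m
  have hK0' : (0:ℝ) < K0 := by exact_mod_cast hK0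
  have h2 : ((l:ℝ)+m)/K0 ≤ 3 := by rw [div_le_iff₀ hK0']; exact_mod_cast hs
  have h3 := gz_ge (p l m) j hj
  have h4 : 0 ≤ 1 + η^2/80 * gz (p l m) j := by nlinarith
  unfold Psi
  have := mul_nonneg hPh.le h4
  linarith

lemma Psi_ge_one {η : ℝ} (h0 : 0 < η) (h1 : η ≤ 1/10) (p : ℕ → ℕ → ℕ) (K0 l m j : ℕ) (hj : j ≤ p l m)
    (hs : l + m < K0) : 1 ≤ Psi p K0 η l m j := by
  have hPh := Ph_pos h0 h1 l m
  have hK0' : (0:ℝ) < K0 := by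
    have : 0 < K0 := by omega
    exact_mod_cast this
  have h2 : ((l:ℝ)+m)/K0 ≤ 1 := by rw [div_le_iff₀ hK0', one_mul]; exact_mod_cast hs.le
  have h3 := gz_ge (p l m) j hj
  have h4 : 0 ≤ 1 + η^2/80 * gz (p l m) j := by nlinarith
  unfold Psi
  have := mul_nonneg hPh.le h4
  linarith

/-- crude upper bound: `Ψ ≤ 3 + 4·2^s`. -/
lemma Psi_le {η : ℝ} (h0 : 0 < η) (h1 : η ≤ 1/10) (p : ℕ → ℕ → ℕ) (K0 l m j : ℕ) :
    Psi p K0 η l m j ≤ 3 + 4 * 2^(l+m) := by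
  have ha := ca_pos h0
  have hb := cb_pos h0 h1
  have hPh := Ph_pos h0 h1 l m
  have hs : (0:ℝ) ≤ ((l:ℝ)+m)/K0 := by positivity
  have h3 := gz_le (p l m) j
  have h4 : 1 + η^2/80 * gz (p l m) j ≤ 2 := by
    have : η^2/80 ≤ 1 := by nlinarith
    nlinarith [sq_nonneg η]
  have hb2 : 1 + cb η ≤ 2 := by unfold cb; nlinarith
  have hA1 : 1/(1+ca η) ≤ 1 := by rw [div_le_one (by linarith)]; linarith
  have hx : ∀ n : ℕ, (1/(1+ca η))^n ≤ 1 := fun n => pow_le_one₀ (by positivity) hA1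
  have hy : ∀ n : ℕ, (1+cb η)^n ≤ 2^n := fun n => pow_le_pow_left₀ (by linarith) hb2 n
  have h5 : Ph η l m ≤ 2 * 2^(l+m) := by
    have e1 : (1/(1+ca η))^l * (1+cb η)^m ≤ 1 * 2^m := mul_le_mul (hx l) (hy m) (by positivity) (by norm_num)
    have e2 : (1+cb η)^l * (1/(1+ca η))^m ≤ 2^l * 1 := mul_le_mul (hy l) (hx m) (by positivity) (by positivity)
    have e3 : (2:ℝ)^m ≤ 2^(l+m) := pow_le_pow_right₀ (by norm_num) (by omega)
    have e4 : (2:ℝ)^l ≤ 2^(l+m) := pow_le_pow_right₀ (by norm_num) (by omega)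
    unfold Ph; linarith
  unfold Psi
  have : Ph η l m * (1 + η^2/80 * gz (p l m) j) ≤ Ph η l m * 2 := mul_le_mul_of_nonneg_left h4 hPh.le
  linarith

/-- the function v -/
noncomputable def vv (r i0 : ℕ) (l m _j : ℕ) : ℝ := 2^(2^r) * (1/2)^i0 * ((1/2)^l * (1/2)^m)

lemma vv_lt_one (r i0 l m j : ℕ) : vv r i0 l m j < 1 ↔ 2^r < l + m + i0 := by
  have : vv r i0 l m j = 2^(2^r) / 2^(l+m+i0) := by
    unfold vv; simp only [one_div, inv_pow, pow_add]; field_simp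
  rw [this, div_lt_one (by positivity)]
  exact pow_lt_pow_iff_right₀ (by norm_num)

lemma vv_op (K r i0 l m j : ℕ) (p : ℕ → ℕ → ℕ) (hl : l < K) (hm : m < K) :
    opH K p 0 (vv r i0) l m j ≤ 0 := by
  unfold opH
  have e0 : Dg (p l m) (fun a => vv r i0 l m a) j = 0 := by unfold Dg vv; simp
  rw [e0, add_zero]
  split_ifs
  · have e1 : Dg K (fun a => vv r i0 a m 0) l = (2^(2^r) * (1/2)^i0 * (1/2)^m) * Dg K (fun n => (1/2:ℝ)^n) l := by
      rw [← Dg_smul]; refine Dg_congr K (fun n => ?_) l; unfold vv; ring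
    have e2 : Dg K (fun a => vv r i0 l a 0) m = (2^(2^r) * (1/2)^i0 * (1/2)^l) * Dg K (fun n => (1/2:ℝ)^n) m := by
      rw [← Dg_smul]; refine Dg_congr K (fun n => ?_) m; unfold vv; ring
    rw [e1, e2]
    have e3 := Dg_half_le K l hl
    have e4 := Dg_half_le K m hm
    have : (2^(2^r) * (1/2:ℝ)^i0 * (1/2)^m) * Dg K (fun n => (1/2:ℝ)^n) l ≤ 0 :=
      mul_nonpos_of_nonneg_of_nonpos (by positivity) e3
    have : (2^(2^r) * (1/2:ℝ)^i0 * (1/2)^l) * Dg K (fun n => (1/2:ℝ)^n) m ≤ 0 :=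
      mul_nonpos_of_nonneg_of_nonpos (by positivity) e4
    linarith
  · exact le_rfl

open Finset Filter
open scoped Classical

lemma surv_congr {X : Type*} [Fintype X] [DecidableEq X] (P : Matrix X X ℝ) {S S' : X → Prop}
    (h : ∀ x, S x ↔ S' x) (t : ℕ) (x : X) : surv P S t x = surv P S' t x := by
  have : S = S' := funext fun x => propext (h x)
  subst this; rfl

/-- good set: root states of high level -/
def CH {K : ℕ} {p : ℕ → ℕ → ℕ} (K0 : ℕ) (x : HH K p) : Prop := isR x ∧ K0 ≤ tl x.1.1 + tl x.1.2

lemma isR_iff_tl {K : ℕ} {p : ℕ → ℕ → ℕ} (x : HH K p) : isR x ↔ tl x.2 = 0 := by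
  unfold isR; rw [tl_eq_zero, eq_troot]

lemma pf_le (P i0 k : ℕ) (η : ℝ) (l m : ℕ) : pf P i0 k η l m ≤ P := by
  unfold pf; split_ifs <;> omega

lemma pf_pos (P i0 k : ℕ) (η : ℝ) (l m : ℕ) (h : 0 < pf P i0 k η l m) : l + m < k := by
  unfold pf at h; split_ifs at h with h1
  · exact h1.2
  · omega

lemma CH_iff {K P i0 k K0 : ℕ} {η : ℝ} (hk : k ≤ K0) (x : HH K (pf P i0 k η)) :
    ¬ CH K0 x ↔ tl x.1.1 + tl x.1.2 < K0 := by
  unfold CH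
  constructor
  · intro h
    by_contra h2
    refine h ⟨?_, by omega⟩
    rw [isR_iff_tl]
    have h3 := tl_le x.2
    have h4 := pf_pos P i0 k η (tl x.1.1) (tl x.1.2)
    omega
  · intro h h2; omega

lemma surv_H_bound {η : ℝ} (h0 : 0 < η) (h1 : η ≤ 1/10) (K K0 P i0 k t : ℕ) (hkK : k ≤ K0) (hK : K0 ≤ K)
    (hK2 : 2 * K ≤ 3 * K0) (hi0 : 4 ≤ i0) (hP : K0 + i0 ≤ P) (hlam2 : η^2 * K0 * (K0+i0) ≤ 2^P)
    (ht : 491520 / η^2 * 2^P ≤ t) (x : HH K (pf P i0 k η)) :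
    surv (PH K (pf P i0 k η) 0) (fun x => ¬ CH K0 x) t x ^ 2 ≤ 4 * (3/8)^(tl x.1.1 + tl x.1.2 + i0) := by
  have hpos : ∀ n : ℕ, (0:ℝ) < (3/8)^n := fun n => by positivity
  by_cases hx : tl x.1.1 + tl x.1.2 < K0
  swap
  · rw [surv_off]
    · have := hpos (tl x.1.1 + tl x.1.2 + i0); nlinarith
    · rwa [CH_iff hkK]
  set n := tl x.1.1 + tl x.1.2 + i0 with hn
  have hn4 : 4 ≤ n := by omega
  obtain ⟨r, hr1, hr2⟩ : ∃ r, 4 * 2^r ≤ n ∧ n < 8 * 2^r := by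
    refine ⟨Nat.log 2 (n/4), ?_, ?_⟩
    · have := Nat.pow_log_le_self 2 (x := n/4) (by omega)
      omega
    · have := Nat.lt_pow_succ_log_self (b := 2) (by norm_num) (n/4)
      rw [pow_succ] at this
      omega
  have hrP : r ≤ P := by
    have h5 : r < 2^r := Nat.lt_two_pow_self
    omega
  set lam : ℝ := η^2/80 * 2^r / 2^P / 256 with hlam
  have hlam0 : 0 < lam := by rw [hlam]; positivity
  have hK0 : 0 < K0 := by omega
  have hnr : (n:ℝ) ≤ 8 * 2^r := by exact_mod_cast hr2.le
  have hrn : (4:ℝ) * 2^r ≤ n := by exact_mod_cast hr1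
  have hl2 : 36 * lam * K0 ≤ 1 := by
    have h6 : (n:ℝ) ≤ K0 + i0 := by
      have : n ≤ K0 + i0 := by omega
      exact_mod_cast this
    have e : 36 * lam * K0 = 36/80/256 * (η^2 * K0 * 2^r) / 2^P := by rw [hlam]; ring
    rw [e, div_le_one (by positivity)]
    have : η^2 * K0 * 2^r ≤ η^2 * K0 * (K0+i0) := by
      refine mul_le_mul_of_nonneg_left ?_ (by positivity)
      have : (0:ℝ) < 2^r := by positivity
      linarith
    have : 0 ≤ η^2 * K0 * 2^r := by positivity
    linarith
  have hlam1 : lam ≤ 1 := by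
    have : (1:ℝ) ≤ K0 := by exact_mod_cast hK0
    nlinarith
  have hS := PH_sto K (pf P i0 k η) (η := 0) le_rfl (by norm_num)
  have key := surv_upper (S := fun x => ¬ CH K0 x) hS (lv (vv r i0)) (lv (Psi (pf P i0 k η) K0 η)) lam hlam1
    (fun y => by unfold lv vv; positivity)
    (fun y => Psi_nonneg h0 h1 _ K0 _ _ _ (tl_le _) hK0 (by
      have := tl_le y.1.1; have := tl_le y.1.2; omega))
    (fun y hy _ => Psi_ge_one h0 h1 _ K0 _ _ _ (tl_le _) ((CH_iff hkK y).1 hy))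
    (fun y hy _ => by
      have hy' := (CH_iff hkK y).1 hy
      rw [ap_PH]
      have := vv_op K r i0 (tl y.1.1) (tl y.1.2) (tl y.2) (pf P i0 k η) (by omega) (by omega)
      linarith)
    (fun y hy hv => by
      have hy' := (CH_iff hkK y).1 hy
      rw [ap_PH]
      have := Psi_op h0 h1 K K0 P i0 k r (tl y.1.1) (tl y.1.2) (tl y.2) lam hy' hK (tl_le _)
        ((vv_lt_one _ _ _ _ _).1 hv) hrP (fun hc => by
          have := Nat.log_lt_self 2 (x := tl y.1.1 + tl y.1.2 + i0) (by omega)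
          omega) hlam hl2
      have e : lv (Psi (pf P i0 k η) K0 η) y = Psi (pf P i0 k η) K0 η (tl y.1.1) (tl y.1.2) (tl y.2) := rfl
      rw [e]; linarith) t x
  have hsn := surv_nonneg hS (S := fun x => ¬ CH K0 x) t x
  set v := lv (vv r i0) x with hv
  have hv0 : 0 ≤ v := by rw [hv]; unfold lv vv; positivity
  have hvv : v ^ 2 ≤ (3/8)^n := by
    have e : v = 2^(2^r) / 2^n := by
      rw [hv]; unfold lv vv; rw [hn]; simp only [one_div, inv_pow, pow_add]; field_simp
    have e2 : v^4 ≤ (1/8)^n := by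
      rw [e, div_pow, ← pow_mul, ← pow_mul, one_div, inv_pow, div_le_iff₀ (by positivity), inv_mul_eq_div,
        le_div_iff₀ (by positivity), show (8:ℝ) = 2^3 by norm_num, ← pow_mul, ← pow_add]
      exact pow_le_pow_right₀ (by norm_num) (by omega)
    have e3 : (1/8:ℝ)^n ≤ ((3/8)^n)^2 := by
      rw [← pow_mul, mul_comm, pow_mul]
      exact pow_le_pow_left₀ (by norm_num) (by norm_num) n
    refine le_of_sq_le_sq ?_ (hpos n).le
    calc (v^2)^2 = v^4 := by ring
      _ ≤ _ := e2.trans e3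
  have hw : (1-lam)^t * lv (Psi (pf P i0 k η) K0 η) x ≤ (1/2)^n := by
    have e1 : lv (Psi (pf P i0 k η) K0 η) x ≤ 8 * 2^n := by
      have := Psi_le h0 h1 (pf P i0 k η) K0 (tl x.1.1) (tl x.1.2) (tl x.2)
      have h7 : (2:ℝ)^(tl x.1.1 + tl x.1.2) ≤ 2^n := pow_le_pow_right₀ (by norm_num) (by omega)
      have h8 : (1:ℝ) ≤ 2^n := one_le_pow₀ (by norm_num)
      unfold lv; linarith
    have e2 : (1-lam)^t ≤ Real.exp (-3 * n) := by
      have h9 : (1-lam) ≤ Real.exp (-lam) := by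
        have := Real.add_one_le_exp (-lam); linarith
      calc (1-lam)^t ≤ (Real.exp (-lam))^t := pow_le_pow_left₀ (by linarith) h9 t
        _ = Real.exp (t * (-lam)) := by rw [← Real.exp_nat_mul]
        _ ≤ _ := by
          apply Real.exp_le_exp.2
          have : 491520 / η^2 * 2^P * lam ≤ t * lam := mul_le_mul_of_nonneg_right ht hlam0.le
          have e : 491520 / η^2 * 2^P * lam = 24 * 2^r := by
            rw [hlam]; field_simp; norm_num
          linarith
    have e3 : Real.exp (-3*n) ≤ (1/8)^n := by
      have : Real.exp (-3*n) = (Real.exp (-3))^n := by rw [← Real.exp_nat_mul]; ring_nf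
      rw [this]
      refine pow_le_pow_left₀ (Real.exp_pos _).le ?_ n
      rw [Real.exp_neg, one_div]
      apply inv_anti₀ (by norm_num)
      have : Real.exp 3 = (Real.exp 1)^3 := by rw [← Real.exp_nat_mul]; norm_num
      rw [this]
      have := Real.add_one_le_exp (1:ℝ)
      calc (8:ℝ) = 2^3 := by norm_num
        _ ≤ _ := pow_le_pow_left₀ (by norm_num) (by linarith) 3
    have e4 : (0:ℝ) ≤ (1-lam)^t := pow_nonneg (by linarith) t
    calc _ ≤ (1-lam)^t * (8 * 2^n) := mul_le_mul_of_nonneg_left e1 e4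
      _ ≤ (1/8)^n * (8*2^n) := mul_le_mul_of_nonneg_right (e2.trans e3) (by positivity)
      _ = 8 * (1/2)^n * (1/2)^n := by
        rw [show (1/8:ℝ) = (1/2)*(1/2)*(1/2) by norm_num, mul_pow, mul_pow]
        have : (1/2:ℝ)^n * 2^n = 1 := by rw [← mul_pow]; norm_num
        linear_combination 8 * (1/2)^n * (1/2)^n * this
      _ ≤ 1 * (1/2)^n := by
        refine mul_le_mul_of_nonneg_right ?_ (by positivity)
        have : (1/2:ℝ)^n ≤ (1/2)^4 := pow_le_pow_of_le_one (by norm_num) (by norm_num) hn4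
        norm_num at this ⊢; linarith
      _ = _ := one_mul _
  have hw2 : ((1/2:ℝ)^n)^2 ≤ (3/8)^n := by
    rw [← pow_mul, mul_comm, pow_mul]; exact pow_le_pow_left₀ (by norm_num) (by norm_num) n
  have hle : surv (PH K (pf P i0 k η) 0) (fun x => ¬ CH K0 x) t x ≤ v + (1/2)^n := by linarith
  have hq := pow_le_pow_left₀ hsn hle 2
  nlinarith [sq_nonneg (v - (1/2:ℝ)^n)]

lemma sum_geo_le (n : ℕ) : ∑ l ∈ range n, (3/4:ℝ)^l ≤ 4 := by
  have : ∀ n : ℕ, ∑ l ∈ range n, (3/4:ℝ)^l = 4 - 4 * (3/4)^n := by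
    intro n
    induction n with
    | zero => simp
    | succ n ih => rw [sum_range_succ, ih, pow_succ]; ring
  rw [this]
  have : (0:ℝ) < (3/4)^n := by positivity
  linarith

lemma sum_two_pow (n : ℕ) : ∑ l ∈ range n, (2:ℝ)^l = 2^n - 1 := by
  induction n with
  | zero => simp
  | succ n ih => rw [sum_range_succ, ih, pow_succ]; ring

/-- sums bounded by pendant depth -/
lemma sum_HH_le {K P : ℕ} {p : ℕ → ℕ → ℕ} (hp : ∀ l m, p l m ≤ P) (G : ℕ → ℕ → ℝ) (hG : ∀ l m, 0 ≤ G l m) :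
    ∑ x : HH K p, lv (fun l m _ => G l m) x ≤ 2^(P+1) * ∑ l ∈ range (K+1), ∑ m ∈ range (K+1), 2^l * 2^m * G l m := by
  rw [sum_HH, mul_sum]
  refine sum_le_sum fun l _ => ?_
  rw [mul_sum, mul_sum]
  refine sum_le_sum fun m _ => ?_
  rw [← sum_mul, sum_two_pow]
  have h1 : (2:ℝ)^(p l m + 1) - 1 ≤ 2^(P+1) := by
    have : (2:ℝ)^(p l m + 1) ≤ 2^(P+1) := pow_le_pow_right₀ (by norm_num) (by have := hp l m; omega)
    linarith
  have h2 : (0:ℝ) ≤ 2^l * 2^m * G l m := by have := hG l m; positivity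
  calc (2:ℝ)^l * (2^m * ((2^(p l m + 1) - 1) * G l m)) = (2^(p l m + 1) - 1) * (2^l*2^m*G l m) := by ring
    _ ≤ _ := mul_le_mul_of_nonneg_right h1 h2

lemma surv_H_sum {η : ℝ} (h0 : 0 < η) (h1 : η ≤ 1/10) (K K0 P i0 k t : ℕ) (hkK : k ≤ K0) (hK : K0 ≤ K)
    (hK2 : 2 * K ≤ 3 * K0) (hi0 : 4 ≤ i0) (hP : K0 + i0 ≤ P) (hlam2 : η^2 * K0 * (K0+i0) ≤ 2^P)
    (ht : 491520 / η^2 * 2^P ≤ t) :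
    ∑ x, surv (PH K (pf P i0 k η) 0) (fun x => ¬ CH K0 x) (2*t) x ≤ 128 * 2^P * (3/8)^i0 := by
  have hS := PH_sto K (pf P i0 k η) (η := 0) le_rfl (by norm_num)
  rw [surv_sq hS]
  calc _ ≤ ∑ x : HH K (pf P i0 k η), lv (fun l m _ => 4 * (3/8)^(l + m + i0)) x :=
        sum_le_sum fun x _ => surv_H_bound h0 h1 K K0 P i0 k t hkK hK hK2 hi0 hP hlam2 ht x
    _ ≤ _ := sum_HH_le (P := P) (pf_le P i0 k η) (fun l m => 4 * (3/8)^(l + m + i0)) (fun l m => by positivity)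
    _ = 2^(P+1) * (4 * (3/8)^i0 * ((∑ l ∈ range (K+1), (3/4:ℝ)^l) * ∑ l ∈ range (K+1), (3/4:ℝ)^l)) := by
        rw [sum_mul_sum, mul_sum (range (K+1)) _ (4 * (3/8:ℝ)^i0)]
        congr 1
        refine sum_congr rfl fun l _ => ?_
        rw [mul_sum]
        refine sum_congr rfl fun m _ => ?_
        rw [show (3/4:ℝ) = 2 * (3/8) by norm_num, mul_pow, mul_pow, pow_add, pow_add]; ring
    _ ≤ 2^(P+1) * (4 * (3/8)^i0 * (4*4)) := by
        have h5 := sum_geo_le (K+1)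
        have h6 : 0 ≤ ∑ l ∈ range (K+1), (3/4:ℝ)^l := sum_nonneg fun l _ => by positivity
        gcongr
    _ = _ := by rw [pow_succ]; ring

open Finset Filter
open scoped Classical

/-- auxiliary function `(l+2)2^{-l}` -/
noncomputable def fz (l : ℕ) : ℝ := (l + 2) * (1/2)^l

lemma fz_nonneg (l : ℕ) : 0 ≤ fz l := by unfold fz; positivity

lemma fz_le (l : ℕ) : fz l ≤ 2 := by
  unfold fz
  have : (l + 2 : ℝ) ≤ 2 * 2^l := by
    have h : l + 2 ≤ 2 * 2^l := by
      have : l < 2^l := Nat.lt_two_pow_self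
      omega
    exact_mod_cast h
  rw [one_div, inv_pow, ← div_eq_mul_inv, div_le_iff₀ (by positivity)]; exact this

lemma Dg_fz (K l : ℕ) (hl : l < K) : Dg K fz l = -(1/2)^l := by
  unfold Dg
  rw [if_pos hl]
  rcases l with _ | l
  · simp [fz]; norm_num
  · rw [if_pos (by omega), Nat.add_sub_cancel]
    unfold fz; push_cast; simp only [pow_succ]; ring

lemma Dg_fz_top (K : ℕ) (hK : 1 ≤ K) : Dg K fz K = K * (1/2)^K := by
  unfold Dg
  rw [if_neg (by omega), if_pos hK]
  obtain ⟨K, rfl⟩ : ∃ i, K = i + 1 := ⟨K - 1, by omega⟩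
  rw [Nat.add_sub_cancel]
  unfold fz; push_cast; simp only [pow_succ]; ring

lemma Dg_half_top (K : ℕ) (hK : 1 ≤ K) : Dg K (fun n => (1/2:ℝ)^n) K = (1/2)^K := by
  unfold Dg
  rw [if_neg (by omega), if_pos hK]
  obtain ⟨K, rfl⟩ : ∃ i, K = i + 1 := ⟨K - 1, by omega⟩
  rw [Nat.add_sub_cancel]
  simp only [pow_succ]; ring

/-- supersolution for entering pendants -/
noncomputable def Fen (K k : ℕ) (l m j : ℕ) : ℝ :=
  if j = 0 then 2^k * ((1/2)^l * (1/2)^m + (1/2)^K * (fz l + fz m)) else 1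

lemma Fen_nonneg (K k l m j : ℕ) : 0 ≤ Fen K k l m j := by
  unfold Fen; have := fz_nonneg l; have := fz_nonneg m; split_ifs <;> positivity

lemma Fen_op (K k : ℕ) (p : ℕ → ℕ → ℕ) (hp : ∀ l m, 0 < p l m → l + m < k) (hK : 1 ≤ K) (l m : ℕ)
    (hl : l ≤ K) (hm : m ≤ K) :
    opH K p 0 (Fen K k) l m 0 ≤ 2^k * ((2 * K + 2) * (1/4)^K) := by
  unfold opH
  have e1 : Dg K (fun a => Fen K k a m 0) l = 2^k * ((1/2)^m * Dg K (fun n => (1/2:ℝ)^n) l + (1/2)^K * Dg K fz l) := by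
    unfold Dg Fen; simp only [if_true]; split_ifs <;> ring
  have e2 : Dg K (fun a => Fen K k l a 0) m = 2^k * ((1/2)^l * Dg K (fun n => (1/2:ℝ)^n) m + (1/2)^K * Dg K fz m) := by
    unfold Dg Fen; simp only [if_true]; split_ifs <;> ring
  have e3 : Dg (p l m) (fun a => Fen K k l m a) 0 ≤ 0 := by
    unfold Dg
    rw [if_neg (show ¬ 1 ≤ 0 by omega)]
    split_ifs with h
    · have h1 := hp l m h
      have h2 : (1:ℝ) ≤ Fen K k l m 0 := by
        unfold Fen; rw [if_pos rfl]
        have h3 : (1:ℝ) ≤ 2^k * ((1/2)^l * (1/2)^m) := by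
          rw [← pow_add, one_div, inv_pow, ← div_eq_mul_inv, one_le_div (by positivity)]
          exact pow_le_pow_right₀ (by norm_num) h1.le
        have := fz_nonneg l; have := fz_nonneg m
        have : (0:ℝ) ≤ 2^k * ((1/2)^K * (fz l + fz m)) := by positivity
        linarith
      have h4 : Fen K k l m (0+1) = 1 := by simp [Fen]
      simp only [h4]; linarith
    · simp
  rw [if_pos rfl, e1, e2]
  have hh : (1/4:ℝ)^K = (1/2)^K * (1/2)^K := by rw [← mul_pow]; norm_num
  have hkey : ((1/2)^m * Dg K (fun n => (1/2:ℝ)^n) l + (1/2)^K * Dg K fz l)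
     + ((1/2)^l * Dg K (fun n => (1/2:ℝ)^n) m + (1/2)^K * Dg K fz m) ≤ (2 * K + 2) * (1/4)^K := by
    rw [hh]
    have hK0 : (0:ℝ) < (1/2)^K := by positivity
    have hl0 : (0:ℝ) < (1/2)^l := by positivity
    have hm0 : (0:ℝ) < (1/2)^m := by positivity
    have hKn : (0:ℝ) ≤ K := by positivity
    have hKK : (0:ℝ) ≤ K * ((1/2)^K * (1/2)^K) := by positivity
    have hKK2 : (0:ℝ) ≤ ((1/2)^K * (1/2)^K) := by positivity
    rcases hl.lt_or_eq with h | h <;> rcases hm.lt_or_eq with h' | h'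
    · have := mul_nonpos_of_nonneg_of_nonpos hm0.le (Dg_half_le K l h)
      have := mul_nonpos_of_nonneg_of_nonpos hl0.le (Dg_half_le K m h')
      rw [Dg_fz K l h, Dg_fz K m h']
      nlinarith
    · subst h'
      have := mul_nonpos_of_nonneg_of_nonpos hm0.le (Dg_half_le m l h)
      rw [Dg_fz m l h, Dg_fz_top m hK, Dg_half_top m hK]
      nlinarith
    · subst h
      have := mul_nonpos_of_nonneg_of_nonpos hl0.le (Dg_half_le l m h')
      rw [Dg_fz l m h', Dg_fz_top l hK, Dg_half_top l hK]
      nlinarith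
    · subst h; subst h'
      rw [Dg_fz_top _ hK, Dg_half_top _ hK]
      nlinarith
  have := mul_le_mul_of_nonneg_left hkey (show (0:ℝ) ≤ 2^k by positivity)
  linarith

lemma enter_bound (K k K0 t : ℕ) (p : ℕ → ℕ → ℕ) (hp : ∀ l m, 0 < p l m → l + m < k) (hK : 1 ≤ K)
    (x : TT K × TT K) (hx : K0 ≤ tl x.1 + tl x.2) :
    1 - surv (PH K p 0) isR t (rt p x) ≤ 2^k * ((1/2)^K0 + 4 * (1/2)^K) + t * (2^k * ((2 * K + 2) * (1/4)^K)) := by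
  have hS := PH_sto K p (η := 0) le_rfl (by norm_num)
  have hε : (0:ℝ) ≤ 2^k * ((2 * K + 2) * (1/4)^K) := by positivity
  have key := exit_lemma (S := isR) hS (lv (Fen K k)) (2^k * ((2 * K + 2) * (1/4)^K))
    (fun y => Fen_nonneg _ _ _ _ _) (fun y hy => by
      rw [isR_iff_tl] at hy
      unfold lv Fen; rw [if_neg hy]) hε (fun y hy => by
      rw [isR_iff_tl] at hy
      rw [ap_PH, hy]
      have := Fen_op K k p hp hK (tl y.1.1) (tl y.1.2) (tl_le _) (tl_le _)
      linarith) t (rt p x)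
  refine key.trans ?_
  gcongr
  have e : lv (Fen K k) (rt p x) = 2^k * ((1/2)^(tl x.1) * (1/2)^(tl x.2) + (1/2)^K * (fz (tl x.1) + fz (tl x.2))) := by
    have : tl (rt p x).2 = 0 := tl_root _
    unfold lv Fen; rw [this, if_pos rfl]; rfl
  rw [e]
  refine mul_le_mul_of_nonneg_left ?_ (by positivity)
  have h1 : (1/2:ℝ)^(tl x.1) * (1/2)^(tl x.2) ≤ (1/2)^K0 := by
    rw [← pow_add]; exact pow_le_pow_of_le_one (by norm_num) (by norm_num) hx
  have h2 : (1/2:ℝ)^K * (fz (tl x.1) + fz (tl x.2)) ≤ (1/2)^K * 4 := by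
    refine mul_le_mul_of_nonneg_left ?_ (by positivity)
    linarith [fz_le (tl x.1), fz_le (tl x.2)]
  linarith

lemma card_HH_ge (K : ℕ) (p : ℕ → ℕ → ℕ) : (4:ℝ)^K ≤ Fintype.card (HH K p) := by
  have h1 : (Fintype.card (TT K × TT K):ℝ) ≤ Fintype.card (HH K p) := by
    have : Function.Injective (rt (K := K) p) := fun x y h => congrArg Sigma.fst h
    exact_mod_cast Fintype.card_le_of_injective _ this
  refine le_trans ?_ h1
  have h2 : (2:ℝ)^K ≤ Fintype.card (TT K) := by
    have := sum_TT K (fun _ => 1)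
    simp only [mul_one, sum_const, card_univ, nsmul_eq_mul] at this
    rw [this, sum_two_pow, pow_succ]
    have : (1:ℝ) ≤ 2^K := one_le_pow₀ (by norm_num)
    linarith
  rw [Fintype.card_prod]; push_cast
  have h3 : (0:ℝ) < 2^K := by positivity
  calc (4:ℝ)^K = 2^K * 2^K := by rw [← mul_pow]; norm_num
    _ ≤ _ := by gcongr

lemma card_pend_le (K P i0 k : ℕ) (η : ℝ) (hk : k ≤ K) :
    (∑ x : HH K (pf P i0 k η), if isR x then (0:ℝ) else 1) ≤ 2^(P+1+2*k) := by
  have h := sum_HH_le (K := K) (P := P) (pf_le P i0 k η) (fun l m => if l < k ∧ m < k then 1 else 0)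
    (fun l m => by split_ifs <;> norm_num)
  have h1 : (∑ x : HH K (pf P i0 k η), if isR x then (0:ℝ) else 1)
      ≤ ∑ x : HH K (pf P i0 k η), lv (fun l m _ => if l < k ∧ m < k then 1 else 0) x := by
    refine sum_le_sum fun x _ => ?_
    by_cases h2 : isR x
    · rw [if_pos h2]; unfold lv; beta_reduce; split_ifs <;> norm_num
    · rw [if_neg h2]
      rw [isR_iff_tl] at h2
      have := tl_le x.2
      have := pf_pos P i0 k η (tl x.1.1) (tl x.1.2) (by omega)
      unfold lv
      beta_reduce
      rw [if_pos (by omega)]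
  refine h1.trans (h.trans ?_)
  have h5 : ∑ l ∈ range (K+1), ∑ m ∈ range (K+1), (2:ℝ)^l * 2^m * (if l < k ∧ m < k then 1 else 0)
     = (∑ l ∈ range (K+1), if l < k then (2:ℝ)^l else 0) * (∑ l ∈ range (K+1), if l < k then (2:ℝ)^l else 0) := by
    rw [sum_mul_sum]
    refine sum_congr rfl fun l _ => sum_congr rfl fun m _ => ?_
    by_cases h1 : l < k <;> by_cases h2 : m < k <;> simp [h1, h2]
  have h6 : (∑ l ∈ range (K+1), if l < k then (2:ℝ)^l else 0) ≤ 2^k := by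
    rw [← sum_filter]
    have : (range (K+1)).filter (fun l => l < k) = range k := by
      ext l; simp; omega
    rw [this, sum_two_pow]; linarith
  have h7 : 0 ≤ (∑ l ∈ range (K+1), if l < k then (2:ℝ)^l else 0) :=
    sum_nonneg fun l _ => by split_ifs <;> positivity
  rw [h5]
  calc _ ≤ (2:ℝ)^(P+1) * (2^k * 2^k) := by gcongr
    _ = _ := by rw [← pow_add, ← pow_add]; congr 1; ring

/-- base-chain upper bound (unweighted) -/
lemma UH {η : ℝ} (h0 : 0 < η) (h1 : η ≤ 1/10) (K K0 P i0 k t s0 : ℕ) (hK1 : 1 ≤ K) (hkK : k ≤ K0) (hK : K0 ≤ K)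
    (hK2 : 2 * K ≤ 3 * K0) (hi0 : 4 ≤ i0) (hP : K0 + i0 ≤ P) (hlam2 : η^2 * K0 * (K0+i0) ≤ 2^P)
    (ht : 491520 / η^2 * 2^P ≤ t) (ε1 : ℝ)
    (hε : ∀ x : TT K × TT K, dd (P0 K) s0 x ≤ ε1)
    (hρ : (2:ℝ)^(P+1+2*k) * 2 ≤ 4^K) :
    phi (PH K (pf P i0 k η) 0) (2*(2*t+s0)) ≤ 6 * (128 * 2^P * (3/8)^i0 / Fintype.card (HH K (pf P i0 k η)))
      + 2 * (2 * (2^k * ((1/2)^K0 + 4 * (1/2)^K) + s0 * (2^k * ((2 * K + 2) * (1/4)^K))) + ε1)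
      + 8 * (2^(P+1+2*k) / 4^K)^2 := by
  have hS := PH_sto K (pf P i0 k η) (η := 0) le_rfl (by norm_num)
  have : Nonempty (HH K (pf P i0 k η)) := ⟨rt _ (troot K, troot K)⟩
  have hn := card_HH_ge K (pf P i0 k η)
  have hn0 : (0:ℝ) < Fintype.card (HH K (pf P i0 k η)) := lt_of_lt_of_le (by positivity) hn
  have hpend := card_pend_le K P i0 k η (by omega)
  have hp0 : (0:ℝ) ≤ ∑ x : HH K (pf P i0 k η), if isR x then (0:ℝ) else 1 :=
    sum_nonneg fun x _ => by split_ifs <;> norm_num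
  have hρ1 : (∑ x : HH K (pf P i0 k η), if isR x then (0:ℝ) else 1) / Fintype.card (HH K (pf P i0 k η))
      ≤ 2^(P+1+2*k) / 4^K := by
    gcongr
  have hd0 : 0 ≤ ε1 := le_trans (dd_nonneg _ _) (hε (troot K, troot K))
  have key := regen hS isR (CH K0) (fun x hx => hx.1) _ ?_ (2*t) s0 rfl ?_ ?_
    (ε0 := 2 * (2^k * ((1/2)^K0 + 4 * (1/2)^K) + s0 * (2^k * ((2 * K + 2) * (1/4)^K))) + ε1)
  · refine key.trans ?_
    have h3 := surv_H_sum h0 h1 K K0 P i0 k t hkK hK hK2 hi0 hP hlam2 ht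
    have h4 : (∑ x : HH K (pf P i0 k η), if isR x then (0:ℝ) else 1) / Fintype.card (HH K (pf P i0 k η)) ≥ 0 := by positivity
    gcongr
  · positivity
  · refine hρ1.trans ?_
    rw [div_le_iff₀ (by positivity)]; linarith
  · intro x hx
    have hx' := (isR_iff x).1 hx.1
    have h5 := root_compare (p := pf P i0 k η) s0 x.1
    rw [hx'] at h5
    have h6 := enter_bound K k K0 s0 (pf P i0 k η) (pf_pos P i0 k η) hK1 x.1 hx.2
    rw [hx'] at h6
    have h7 := hε x.1
    linarith

open Finset Filter
open scoped Classical

/-- test set -/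
def BH {K : ℕ} {p : ℕ → ℕ → ℕ} (k : ℕ) (η : ℝ) (x : HH K p) : Prop :=
  cone k η (tl x.1.1) (tl x.1.2) ∧ 1 ≤ tl x.1.1

/-- supersolution for leaving the test set -/
noncomputable def Fw (k i0 : ℕ) (η : ℝ) (l m j : ℕ) : ℝ :=
  (1 + ca η)^l * (1/(1+cb η))^m + (1/2)^l
    + (Real.log ((l:ℝ)+m+i0) - 4/((l:ℝ)+m+i0) * (1 - (1/2)^j)) / Real.log k

lemma Dg_log (K l c : ℕ) (hl : l < K) (h1 : 1 ≤ l) (hc : 1 ≤ c) :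
    Dg K (fun a => Real.log ((a:ℝ)+c)) l ≤ 1/((l:ℝ)+c) := by
  unfold Dg
  rw [if_pos hl, if_pos h1]
  obtain ⟨l, rfl⟩ : ∃ i, l = i + 1 := ⟨l - 1, by omega⟩
  rw [Nat.add_sub_cancel]
  push_cast
  have hl0 : (0:ℝ) ≤ l := by positivity
  have hc0 : (1:ℝ) ≤ c := by exact_mod_cast hc
  set n : ℝ := (l:ℝ) + 1 + c with hn
  have hn2 : 2 ≤ n := by rw [hn]; linarith
  have e1 : Real.log ((l:ℝ)+1+1+c) - Real.log n ≤ 1/n := by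
    rw [← Real.log_div (by positivity) (by positivity)]
    have := Real.log_le_sub_one_of_pos (x := ((l:ℝ)+1+1+c)/n) (by positivity)
    have e : ((l:ℝ)+1+1+c)/n = 1 + 1/n := by rw [hn]; field_simp; ring
    rw [e] at this ⊢; linarith
  have e2 : Real.log ((l:ℝ)+c) - Real.log n ≤ -(1/n) := by
    rw [← Real.log_div (by positivity) (by positivity)]
    have := Real.log_le_sub_one_of_pos (x := ((l:ℝ)+c)/n) (by positivity)
    have e : ((l:ℝ)+c)/n = 1 - 1/n := by rw [hn]; field_simp; ring
    rw [e] at this ⊢; linarith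
  linarith

lemma drift_W {η : ℝ} (h0 : 0 < η) (h1 : η ≤ 1/10) :
    (1-η) * (2*((1+ca η)-1) + (1/(1+ca η)-1)) + (1+η) * (2*(1/(1+cb η)-1) + ((1+cb η)-1)) ≤ 0 := by
  have ha := ca_pos h0
  have hb := cb_pos h0 h1
  have e1 : 1/(1+ca η) ≤ 1 - ca η + (ca η)^2 := by
    rw [div_le_iff₀ (by linarith)]; nlinarith [pow_pos ha 3]
  have e2 : 1/(1+cb η) ≤ 1 - cb η + (cb η)^2 := by
    rw [div_le_iff₀ (by linarith)]; nlinarith [pow_pos hb 3]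
  have e3 : (1-η) * (2*((1+ca η)-1) + (1/(1+ca η)-1)) ≤ (1-η) * (ca η + (ca η)^2) := by
    refine mul_le_mul_of_nonneg_left ?_ (by linarith); linarith
  have e4 : (1+η) * (2*(1/(1+cb η)-1) + ((1+cb η)-1)) ≤ (1+η) * (-(cb η) + 2*(cb η)^2) := by
    refine mul_le_mul_of_nonneg_left ?_ (by linarith); linarith
  have hca : ca η ≤ η/10 * (21/20) := by unfold ca; nlinarith
  have hcb : cb η ≤ η/10 := by unfold cb; nlinarith
  have e5 : (1-η) * (ca η + (ca η)^2) + (1+η) * (-(cb η) + 2*(cb η)^2) ≤ 0 := by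
    have e6 : (1-η) * ca η - (1+η) * cb η = - (η^2/10) := by unfold ca cb; ring
    have e7 : (ca η)^2 ≤ (η/10 * (21/20))^2 := pow_le_pow_left₀ ha.le hca 2
    have e8 : (cb η)^2 ≤ (η/10)^2 := pow_le_pow_left₀ hb.le hcb 2
    have e9 : (1-η) * (ca η)^2 ≤ 1 * (η/10 * (21/20))^2 := by
      apply mul_le_mul <;> first | linarith | positivity
    have e10 : (1+η) * (2*(cb η)^2) ≤ 2 * (2 * (η/10)^2) := by
      apply mul_le_mul <;> first | linarith | positivity
    nlinarith
  linarith

lemma Fw_op {η : ℝ} (h0 : 0 < η) (h1 : η ≤ 1/10) (K P i0 k l m j : ℕ) (hk : 2 ≤ k) (hkK : k ≤ K)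
    (hi0 : 20 ≤ i0) (hP : k + i0 ≤ P)
    (hc : cone k η l m) (hl : 1 ≤ l) (hj : j ≤ pf P i0 k η l m) :
    opH K (pf P i0 k η) η (Fw k i0 η) l m j ≤ 4 * (1/2)^P / Real.log k := by
  have ha := ca_pos h0
  have hb := cb_pos h0 h1
  have hm : 1 ≤ m := by
    by_contra hm
    have hm : m = 0 := by omega
    have h2 := hc.1
    rw [hm, pow_zero] at h2
    have : 1 < (1+ca η)^l := one_lt_pow₀ (by linarith) (by omega)
    linarith
  have hs := hc.2
  have hlk : 0 < Real.log k := Real.log_pos (by exact_mod_cast (by omega : 1 < k))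
  have hn0 : (0:ℝ) < (l:ℝ)+m+i0 := by
    have : (20:ℝ) ≤ i0 := by exact_mod_cast hi0
    positivity
  have hq : Nat.log 2 (l+m+i0) < l + m + i0 := Nat.log_lt_self 2 (by omega)
  have hpv : pf P i0 k η l m = P - Nat.log 2 (l+m+i0) := by simp [pf, hc]
  have hr0 : (0:ℝ) ≤ 4 * (1/2)^P / Real.log k := by positivity
  unfold opH
  by_cases hj0 : j = 0
  · subst hj0
    rw [if_pos rfl]
    have e1 : Dg K (fun a => Fw k i0 η a m 0) l
       ≤ (1/(1+cb η))^m * ((1+ca η)^l * (2*((1+ca η)-1) + (1/(1+ca η)-1))) + (1/Real.log k) * (1/((l:ℝ)+m+i0)) := by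
      have e : Dg K (fun a => Fw k i0 η a m 0) l = (1/(1+cb η))^m * Dg K (fun a => (1+ca η)^a) l
         + Dg K (fun n => (1/2:ℝ)^n) l + (1/Real.log k) * Dg K (fun a => Real.log ((a:ℝ)+(m+i0:ℕ))) l := by
        rw [← Dg_smul, ← Dg_smul, ← Dg_add, ← Dg_add]
        refine Dg_congr K (fun a => ?_) l
        unfold Fw; push_cast; ring_nf
      rw [e, Dg_half K l (by omega), if_neg (by omega), Dg_geo K _ (by positivity) l (by omega), if_neg (by omega)]
      have h3 := Dg_log K l (m+i0) (by omega) hl (by omega)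
      have h4 := mul_le_mul_of_nonneg_left h3 (show 0 ≤ 1/Real.log k by positivity)
      push_cast at h4 ⊢
      rw [← add_assoc (l:ℝ)] at h4
      linarith
    have e2 : Dg K (fun a => Fw k i0 η l a 0) m
       ≤ (1+ca η)^l * ((1/(1+cb η))^m * (2*(1/(1+cb η)-1) + ((1+cb η)-1))) + (1/Real.log k) * (1/((l:ℝ)+m+i0)) := by
      have e : Dg K (fun a => Fw k i0 η l a 0) m = (1+ca η)^l * Dg K (fun a => (1/(1+cb η))^a) m
         + (1/Real.log k) * Dg K (fun a => Real.log ((a:ℝ)+(l+i0:ℕ))) m := by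
        rw [← Dg_smul, ← Dg_smul, ← Dg_add]
        unfold Dg Fw
        have : ∀ a : ℕ, (l:ℝ) + a + i0 = a + (l+i0:ℕ) := by intro a; push_cast; ring
        simp only [this]
        split_ifs <;> ring
      rw [e, Dg_geo K _ (by positivity) m (by omega), if_neg (by omega)]
      have h3 := Dg_log K m (l+i0) (by omega) hm (by omega)
      have h4 := mul_le_mul_of_nonneg_left h3 (show 0 ≤ 1/Real.log k by positivity)
      push_cast at h4 ⊢
      rw [show (m:ℝ) + (l + i0) = (l:ℝ) + m + i0 by ring] at h4
      have h5 : 1/(1/(1+cb η)) = 1 + cb η := by rw [one_div_one_div]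
      rw [h5]
      linarith
    have e3 : Dg (pf P i0 k η l m) (fun a => Fw k i0 η l m a) 0 = -(4 * ((1/Real.log k) * (1/((l:ℝ)+m+i0)))) := by
      unfold Dg
      rw [if_pos (by rw [hpv]; omega), if_neg (by omega)]
      unfold Fw; simp only [zero_add, pow_zero, pow_one]; ring
    have e4 := mul_le_mul_of_nonneg_left e1 (show 0 ≤ 1 - η by linarith)
    have e5 := mul_le_mul_of_nonneg_left e2 (show 0 ≤ 1 + η by linarith)
    have e6 := mul_le_mul_of_nonneg_left (drift_W h0 h1) (show 0 ≤ (1/(1+cb η))^m * (1+ca η)^l by positivity)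
    have e7 : 0 ≤ (1/Real.log k) * (1/((l:ℝ)+m+i0)) := by positivity
    rw [e3]
    nlinarith
  · rw [if_neg hj0, zero_add]
    have e1 : Dg (pf P i0 k η l m) (fun a => Fw k i0 η l m a) j
        = (4/((l:ℝ)+m+i0) / Real.log k) * Dg (pf P i0 k η l m) (fun n => (1/2:ℝ)^n) j := by
      unfold Dg Fw; split_ifs <;> ring
    rw [e1]
    rcases hj.lt_or_eq with h | h
    · have := Dg_half_le _ _ h
      refine le_trans (mul_nonpos_of_nonneg_of_nonpos (by positivity) this) hr0
    · rw [h, Dg_half_top _ (by omega), hpv]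
      have hp2 : (2:ℝ)^(Nat.log 2 (l+m+i0)) ≤ (l:ℝ)+m+i0 := by
        have := Nat.pow_log_le_self 2 (x := l+m+i0) (by omega)
        exact_mod_cast this
      have e5 : (1/2:ℝ)^(P - Nat.log 2 (l+m+i0)) = (1/2)^P * 2^(Nat.log 2 (l+m+i0)) := by
        have : P = (P - Nat.log 2 (l+m+i0)) + Nat.log 2 (l+m+i0) := by omega
        conv_rhs => rw [this, pow_add, mul_assoc, ← mul_pow]
        norm_num
      rw [e5]
      calc 4 / ((l:ℝ)+m+i0) / Real.log k * ((1/2)^P * 2^(Nat.log 2 (l+m+i0)))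
          ≤ 4 / ((l:ℝ)+m+i0) / Real.log k * ((1/2)^P * ((l:ℝ)+m+i0)) := by gcongr
        _ = _ := by field_simp

lemma WH {η : ℝ} (h0 : 0 < η) (h1 : η ≤ 1/10) (K P i0 k t : ℕ) (hk : 2 ≤ k) (hkK : k ≤ K)
    (hi0 : 20 ≤ i0) (hP : k + i0 ≤ P) (x : HH K (pf P i0 k η)) :
    1 - ∑ y, (PH K (pf P i0 k η) η ^ t) x y * (if BH k η y then 1 else 0)
      ≤ (1 + ca η)^(tl x.1.1) * (1/(1+cb η))^(tl x.1.2) + (1/2)^(tl x.1.1)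
        + Real.log ((tl x.1.1:ℝ) + tl x.1.2 + i0) / Real.log k
        + t * ((1/2)^P / (6 * Real.log k)) := by
  have ha := ca_pos h0
  have hb := cb_pos h0 h1
  have hS := PH_sto K (pf P i0 k η) h0.le (by linarith)
  have hlk : 0 < Real.log k := Real.log_pos (by exact_mod_cast (by omega : 1 < k))
  have hge : ∀ l m j : ℕ, 0 ≤ (Real.log ((l:ℝ)+m+i0) - 4/((l:ℝ)+m+i0) * (1 - (1/2)^j)) / Real.log k := by
    intro l m j
    apply div_nonneg _ hlk.le
    have h20 : (20:ℝ) ≤ (l:ℝ)+m+i0 := by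
      have : (20:ℝ) ≤ i0 := by exact_mod_cast hi0
      have : (0:ℝ) ≤ (l:ℝ)+m := by positivity
      linarith
    have h2 : 1 ≤ Real.log ((l:ℝ)+m+i0) := by
      rw [Real.le_log_iff_exp_le (by linarith)]
      have := Real.exp_one_lt_d9; linarith
    have h3 : 4/((l:ℝ)+m+i0) ≤ 1 := by rw [div_le_one (by linarith)]; linarith
    have h4 : (0:ℝ) < (1/2)^j := by positivity
    have h5 : 4/((l:ℝ)+m+i0) * (1 - (1/2)^j) ≤ 4/((l:ℝ)+m+i0) * 1 :=
      mul_le_mul_of_nonneg_left (by linarith) (by positivity)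
    linarith
  have key := exit_lemma (S := BH k η) hS (lv (Fw k i0 η)) ((1/2)^P / (6 * Real.log k))
    (fun y => by
      unfold lv Fw
      have := hge (tl y.1.1) (tl y.1.2) (tl y.2)
      have : 0 ≤ (1 + ca η)^(tl y.1.1) * (1/(1+cb η))^(tl y.1.2) + (1/2)^(tl y.1.1) := by positivity
      linarith)
    (fun y hy => by
      unfold lv Fw
      have e1 := hge (tl y.1.1) (tl y.1.2) (tl y.2)
      have e2 : 0 ≤ (1 + ca η)^(tl y.1.1) * (1/(1+cb η))^(tl y.1.2) := by positivity
      have e3 : (0:ℝ) < (1/2)^(tl y.1.1) := by positivity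
      by_cases h5 : tl y.1.1 = 0
      · have h9 : (1/2:ℝ)^(tl y.1.1) = 1 := by rw [h5, pow_zero]
        linarith
      by_cases h6 : (1 + ca η)^(tl y.1.1) ≤ (1 + cb η)^(tl y.1.2)
      · have h7 : k ≤ tl y.1.1 + tl y.1.2 := by
          by_contra h8
          exact hy ⟨⟨h6, by omega⟩, by omega⟩
        have hj : tl y.2 = 0 := by
          have := tl_le y.2
          have := pf_pos P i0 k η (tl y.1.1) (tl y.1.2)
          omega
        rw [hj, pow_zero, sub_self, mul_zero, sub_zero]
        have : 1 ≤ Real.log ((tl y.1.1:ℝ) + tl y.1.2 + i0) / Real.log k := by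
          rw [one_le_div hlk]
          apply Real.log_le_log
          · exact_mod_cast (by omega : 0 < k)
          · have : (k:ℝ) ≤ tl y.1.1 + tl y.1.2 := by exact_mod_cast h7
            have : (0:ℝ) ≤ i0 := by positivity
            linarith
        linarith
      · have : 1 ≤ (1 + ca η)^(tl y.1.1) * (1/(1+cb η))^(tl y.1.2) := by
          rw [one_div, inv_pow, ← div_eq_mul_inv, one_le_div (by positivity)]
          exact (not_le.1 h6).le
        linarith)
    (by positivity)
    (fun y hy => by
      rw [ap_PH]
      have := Fw_op h0 h1 K P i0 k (tl y.1.1) (tl y.1.2) (tl y.2) hk hkK hi0 hP hy.1 hy.2 (tl_le _)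
      have e : (1/2)^P / (6 * Real.log k) = 1/24 * (4 * (1/2)^P / Real.log k) := by field_simp; norm_num
      rw [e]; linarith) t x
  have h2 := surv_le_prob (S := BH k η) hS t x
  have h3 : lv (Fw k i0 η) x ≤ (1 + ca η)^(tl x.1.1) * (1/(1+cb η))^(tl x.1.2) + (1/2)^(tl x.1.1)
        + Real.log ((tl x.1.1:ℝ) + tl x.1.2 + i0) / Real.log k := by
    unfold lv Fw
    have : 0 ≤ 4/((tl x.1.1:ℝ)+tl x.1.2+i0) * (1 - (1/2)^(tl x.2)) := by
      have : (1/2:ℝ)^(tl x.2) ≤ 1 := pow_le_one₀ (by norm_num) (by norm_num)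
      apply mul_nonneg (by positivity); linarith
    gcongr
    linarith
  linarith

lemma card_BH_le (K P i0 k : ℕ) (η : ℝ) (hk : k ≤ K) :
    (∑ x : HH K (pf P i0 k η), if BH k η x then (1:ℝ) else 0) ≤ 2^(P+1+2*k) := by
  have h := sum_HH_le (K := K) (P := P) (pf_le P i0 k η) (fun l m => if l < k ∧ m < k then 1 else 0)
    (fun l m => by split_ifs <;> norm_num)
  have h1 : (∑ x : HH K (pf P i0 k η), if BH k η x then (1:ℝ) else 0)
      ≤ ∑ x : HH K (pf P i0 k η), lv (fun l m _ => if l < k ∧ m < k then 1 else 0) x := by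
    refine sum_le_sum fun x _ => ?_
    by_cases h2 : BH k η x
    · rw [if_pos h2]
      have := h2.1.2
      unfold lv
      beta_reduce
      rw [if_pos (by omega)]
    · rw [if_neg h2]; unfold lv; beta_reduce; split_ifs <;> norm_num
  refine h1.trans (h.trans ?_)
  have h5 : ∑ l ∈ range (K+1), ∑ m ∈ range (K+1), (2:ℝ)^l * 2^m * (if l < k ∧ m < k then 1 else 0)
     = (∑ l ∈ range (K+1), if l < k then (2:ℝ)^l else 0) * (∑ l ∈ range (K+1), if l < k then (2:ℝ)^l else 0) := by
    rw [sum_mul_sum]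
    refine sum_congr rfl fun l _ => sum_congr rfl fun m _ => ?_
    by_cases h1 : l < k <;> by_cases h2 : m < k <;> simp [h1, h2]
  have h6 : (∑ l ∈ range (K+1), if l < k then (2:ℝ)^l else 0) ≤ 2^k := by
    rw [← sum_filter]
    have : (range (K+1)).filter (fun l => l < k) = range k := by
      ext l; simp; omega
    rw [this, sum_two_pow]; linarith
  have h7 : 0 ≤ (∑ l ∈ range (K+1), if l < k then (2:ℝ)^l else 0) :=
    sum_nonneg fun l _ => by split_ifs <;> positivity
  rw [h5]
  calc _ ≤ (2:ℝ)^(P+1) * (2^k * 2^k) := by gcongr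
    _ = _ := by rw [← pow_add, ← pow_add]; congr 1; ring

lemma card_HH_le (K P i0 k : ℕ) (η : ℝ) (hk : k ≤ K) :
    (Fintype.card (HH K (pf P i0 k η)) : ℝ) ≤ 4 * 4^K + 2^(P+1+2*k) := by
  have h1 := card_pend_le K P i0 k η hk
  have h2 := sum_one_isR (K := K) (p := pf P i0 k η)
  have h3 : (∑ x : HH K (pf P i0 k η), if isR x then (0:ℝ) else 1)
     + (∑ x : HH K (pf P i0 k η), if isR x then (1:ℝ) else 0) = Fintype.card (HH K (pf P i0 k η)) := by
    rw [← sum_add_distrib]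
    have : ∀ x : HH K (pf P i0 k η), ((if isR x then (0:ℝ) else 1) + if isR x then (1:ℝ) else 0) = 1 := by
      intro x; split_ifs <;> norm_num
    simp [this]
  have h4 : (Fintype.card (TT K × TT K):ℝ) ≤ 4 * 4^K := by
    have : (Fintype.card (TT K):ℝ) ≤ 2 * 2^K := by
      have := sum_TT K (fun _ => 1)
      simp only [mul_one, sum_const, card_univ, nsmul_eq_mul] at this
      rw [this, sum_two_pow, pow_succ]; linarith
    rw [Fintype.card_prod]; push_cast
    calc _ ≤ (2 * 2^K) * (2*2^K : ℝ) := by gcongr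
      _ = 4 * (2*2)^K := by rw [mul_pow]; ring
      _ = _ := by norm_num
  linarith

/-- starting set -/
def OH {K : ℕ} {p : ℕ → ℕ → ℕ} (i2 : ℕ) (x : HH K p) : Prop := tl x.1.1 = 5 ∧ tl x.1.2 = i2

lemma card_OH_ge (K P i0 k i2 : ℕ) (η : ℝ) (h5 : 5 ≤ K) (hi2 : i2 ≤ K) (hc : cone k η 5 i2)
    (hP : 5 + i2 + i0 ≤ P) :
    (2:ℝ)^P ≤ (5 + i2 + i0) * ∑ x : HH K (pf P i0 k η), if OH i2 x then (1:ℝ) else 0 := by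
  have e : (∑ x : HH K (pf P i0 k η), if OH i2 x then (1:ℝ) else 0)
      = ∑ x : HH K (pf P i0 k η), lv (fun l m _ => if l = 5 ∧ m = i2 then 1 else 0) x := by
    refine sum_congr rfl fun x _ => ?_
    unfold lv; beta_reduce
    exact if_congr Iff.rfl rfl rfl
  set p := pf P i0 k η with hp
  have h1 : (2:ℝ)^(p 5 i2) ≤ ∑ x : HH K p, if OH i2 x then (1:ℝ) else 0 := by
    rw [e, sum_HH]
    have hnn : ∀ l m j : ℕ, (0:ℝ) ≤ 2^j * (if l = 5 ∧ m = i2 then 1 else 0) := by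
      intro l m j; split_ifs <;> positivity
    have hs : ∀ l m, (0:ℝ) ≤ ∑ j ∈ range (p l m + 1), 2^j * (if l = 5 ∧ m = i2 then 1 else 0) :=
      fun l m => sum_nonneg fun j _ => hnn l m j
    refine le_trans ?_ (single_le_sum (f := fun l => 2^l * ∑ m ∈ range (K+1), 2^m *
      ∑ j ∈ range (p l m + 1), (2:ℝ)^j * (if l = 5 ∧ m = i2 then 1 else 0)) (a := 5)
      (fun l _ => mul_nonneg (by positivity) (sum_nonneg fun m _ => mul_nonneg (by positivity) (hs l m)))
      (by simp; omega))
    have h2 : (2:ℝ)^(p 5 i2) ≤ ∑ m ∈ range (K+1), 2^m *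
      ∑ j ∈ range (p 5 m + 1), (2:ℝ)^j * (if 5 = 5 ∧ m = i2 then 1 else 0) := by
      refine le_trans ?_ (single_le_sum (f := fun m => 2^m *
        ∑ j ∈ range (p 5 m + 1), (2:ℝ)^j * (if 5 = 5 ∧ m = i2 then 1 else 0)) (a := i2)
        (fun m _ => mul_nonneg (by positivity) (hs 5 m)) (by simp; omega))
      have h3 : (2:ℝ)^(p 5 i2) ≤ ∑ j ∈ range (p 5 i2 + 1), (2:ℝ)^j * (if 5 = 5 ∧ i2 = i2 then 1 else 0) := by
        refine le_trans ?_ (single_le_sum (f := fun j => (2:ℝ)^j * (if 5 = 5 ∧ i2 = i2 then 1 else 0)) (a := p 5 i2)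
          (fun j _ => hnn 5 i2 j) (by simp))
        simp
      have h4 : (1:ℝ) ≤ 2^i2 := one_le_pow₀ (by norm_num)
      have := hs 5 i2
      nlinarith
    have h5 : (0:ℝ) < 2^(p 5 i2) := by positivity
    beta_reduce
    nlinarith
  have hq : Nat.log 2 (5+i2+i0) < 5 + i2 + i0 := Nat.log_lt_self 2 (by omega)
  have hpv : p 5 i2 = P - Nat.log 2 (5+i2+i0) := by simp [hp, pf, hc]
  have hlt : (2:ℝ)^(Nat.log 2 (5+i2+i0)) ≤ 5 + i2 + i0 := by
    have := Nat.pow_log_le_self 2 (x := 5+i2+i0) (by omega)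
    exact_mod_cast this
  calc (2:ℝ)^P = 2^(Nat.log 2 (5+i2+i0)) * 2^(p 5 i2) := by rw [← pow_add]; congr 1; omega
    _ ≤ _ := by gcongr

open Finset Filter
open scoped Classical

/-- head moves on the path -/
def hd {N : ℕ} (b : Fin 2) (h : Fin N) : Fin N :=
  if h.1 % 2 = b.1 then (if hh : h.1 + 1 < N then ⟨h.1 + 1, hh⟩ else h)
  else ⟨h.1 - 1, by omega⟩

lemma hd_invol {N : ℕ} (b : Fin 2) (h : Fin N) : hd b (hd b h) = h := by
  unfold hd
  apply Fin.ext
  have := b.2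
  have := h.2
  split_ifs <;> simp_all <;> omega

lemma hd_sum {N : ℕ} (h : Fin N) (f : ℕ → ℝ) :
    ∑ b : Fin 2, (f (hd b h).1 - f h.1) = (if h.1 + 1 < N then f (h.1+1) - f h.1 else 0) + (f (h.1-1) - f h.1) := by
  rw [Fin.sum_univ_two]
  unfold hd
  have h2 : h.1 % 2 = 0 ∨ h.1 % 2 = 1 := by omega
  rcases h2 with h2 | h2 <;> simp only [h2, Fin.val_zero, Fin.val_one] <;> split_ifs <;> simp_all <;> ring

/-- expectation functional over head path and local times -/
noncomputable def Ex {N : ℕ} : ℕ → (Fin N → (Fin N → ℕ) → ℝ) → Fin N → ℝ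
  | 0, F, h => F h 0
  | t+1, F, h => Ex t F h + (12/29) * (Ex t (fun g n => F g (n + Pi.single h 1)) h - Ex t F h)
      + (1/58) * ∑ b, (Ex t F (hd b h) - Ex t F h)

section
variable {N : ℕ}

lemma Ex_add (t : ℕ) (F G : Fin N → (Fin N → ℕ) → ℝ) (h : Fin N) :
    Ex t (fun g n => F g n + G g n) h = Ex t F h + Ex t G h := by
  induction t generalizing F G h with
  | zero => rfl
  | succ t ih => simp only [Ex, ih, Fin.sum_univ_two]; ring

lemma Ex_smul (t : ℕ) (c : ℝ) (F : Fin N → (Fin N → ℕ) → ℝ) (h : Fin N) :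
    Ex t (fun g n => c * F g n) h = c * Ex t F h := by
  induction t generalizing F h with
  | zero => rfl
  | succ t ih => simp only [Ex, ih, Fin.sum_univ_two]; ring

lemma Ex_zero (t : ℕ) (h : Fin N) : Ex t (fun _ _ => 0) h = 0 := by
  have := Ex_smul t 0 (fun _ _ => (0:ℝ)) h
  simpa using this

lemma Ex_sum {κ : Type*} (s : Finset κ) (t : ℕ) (F : κ → Fin N → (Fin N → ℕ) → ℝ) (h : Fin N) :
    Ex t (fun g n => ∑ i ∈ s, F i g n) h = ∑ i ∈ s, Ex t (F i) h := by
  induction s using Finset.induction_on with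
  | empty => simp [Ex_zero]
  | insert a s ha ih => simp only [sum_insert ha, Ex_add, ih]

lemma Ex_mono (t : ℕ) {F G : Fin N → (Fin N → ℕ) → ℝ} (hFG : ∀ g n, F g n ≤ G g n) (h : Fin N) :
    Ex t F h ≤ Ex t G h := by
  induction t generalizing F G h with
  | zero => exact hFG _ _
  | succ t ih =>
    simp only [Ex, Fin.sum_univ_two]
    have h1 := ih hFG h
    have h2 := ih hFG (hd 0 h)
    have h3 := ih hFG (hd 1 h)
    have h4 := ih (F := fun g n => F g (n + Pi.single h 1)) (G := fun g n => G g (n + Pi.single h 1))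
      (fun g n => hFG _ _) h
    linarith

lemma Ex_const (t : ℕ) (c : ℝ) (h : Fin N) : Ex t (fun _ _ => c) h = c := by
  induction t generalizing h with
  | zero => rfl
  | succ t ih => simp only [Ex, ih]; simp

lemma Ex_sub (t : ℕ) (F G : Fin N → (Fin N → ℕ) → ℝ) (h : Fin N) :
    Ex t (fun g n => F g n - G g n) h = Ex t F h - Ex t G h := by
  have h1 := Ex_smul t (-1) G h
  have h2 := Ex_add t F (fun g n => -1 * G g n) h
  rw [h1] at h2
  have : (fun g n => F g n - G g n) = (fun g n => F g n + -1 * G g n) := by funext g n; ring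
  rw [this, h2]; ring

lemma Ex_abs (t : ℕ) (F : Fin N → (Fin N → ℕ) → ℝ) (h : Fin N) :
    |Ex t F h| ≤ Ex t (fun g n => |F g n|) h := by
  rw [abs_le]
  constructor
  · have := Ex_mono t (F := fun g n => -1 * |F g n|) (G := F) (fun g n => by
      have := neg_abs_le (F g n); linarith) h
    rw [Ex_smul] at this; linarith
  · exact Ex_mono t (fun g n => le_abs_self _) h

lemma hd_perm_sum (b : Fin 2) (f : Fin N → ℝ) : ∑ h, f (hd b h) = ∑ h, f h :=
  sum_invol (s := hd b) (hd_invol b) f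

/-- total local time -/
lemma Ex_local (t : ℕ) (c : Fin N) : ∑ h, Ex t (fun _ n => (n c : ℝ)) h = 12/29 * t := by
  induction t with
  | zero => simp [Ex]
  | succ t ih =>
    have e : ∀ h : Fin N, Ex t (fun (_ : Fin N) (n : Fin N → ℕ) => (((n + Pi.single h 1 : Fin N → ℕ) c : ℕ) : ℝ)) h
        = Ex t (fun _ n => (n c : ℝ)) h + (if h = c then 1 else 0) := by
      intro h
      have : (fun (_ : Fin N) (n : Fin N → ℕ) => (((n + Pi.single h 1 : Fin N → ℕ) c : ℕ) : ℝ))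
        = fun _ n => (n c : ℝ) + (if h = c then 1 else 0) := by
        funext g n
        by_cases hc : h = c
        · subst hc; simp
        · simp [hc, Pi.single_apply, Ne.symm hc]
      rw [this, Ex_add, Ex_const]
    simp only [Ex, e, Fin.sum_univ_two]
    simp only [sum_add_distrib, ← mul_sum, sum_sub_distrib, hd_perm_sum, ih]
    simp; ring

/-- local time Laplace bound -/
lemma Ex_laplace (c : Fin N) (t : ℕ) (h : Fin N) :
    Ex t (fun _ n => (1 - 1/(6*(N:ℝ)))^(n c)) h ≤ 2 * (1 - 1/(58*(N:ℝ)^2))^t := by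
  have hN : (1:ℝ) ≤ N := by
    have : 1 ≤ N := by have := c.2; omega
    exact_mod_cast this
  set R : ℝ := (N:ℝ) with hR
  set g : ℕ → ℝ := fun h => if c.1 ≤ h then (R-1-c)*(R-c) - (R-1-h)*(R-h) else c*(c+1) - h*(h+1) with hg
  have hcN : (c.1:ℝ) + 1 ≤ R := by rw [hR]; exact_mod_cast c.2
  have hgb : ∀ h : Fin N, 0 ≤ g h ∧ g h ≤ R^2 := by
    intro h
    have hh : (h.1:ℝ) + 1 ≤ R := by rw [hR]; exact_mod_cast h.2
    have h0 : (0:ℝ) ≤ h.1 := by positivity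
    have c0 : (0:ℝ) ≤ c.1 := by positivity
    simp only [hg]
    split_ifs with hc
    · have : (c.1:ℝ) ≤ h.1 := by exact_mod_cast hc
      constructor <;> nlinarith
    · have : (h.1:ℝ) ≤ c.1 := by exact_mod_cast (not_le.1 hc).le
      constructor <;> nlinarith
  set ψ : ℕ → ℝ := fun h => 1 + 1/R^2 * g h with hψ
  have hψ1 : ∀ h : Fin N, 1 ≤ ψ h := fun h => by
    have := (hgb h).1
    have : 0 ≤ 1/R^2 * g h := by positivity
    simp only [hψ]; linarith
  have hψ2 : ∀ h : Fin N, ψ h ≤ 2 := fun h => by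
    have := (hgb h).2
    have : 1/R^2 * g h ≤ 1 := by rw [one_div, inv_mul_eq_div, div_le_one (by positivity)]; exact this
    simp only [hψ]; linarith
  have hlap : ∀ h : Fin N, ∑ b : Fin 2, (g (hd b h) - g h) ≤ if h = c then 2*(R-1) else -2 := by
    intro h
    rw [hd_sum]
    have hh : (h.1:ℝ) + 1 ≤ R := by rw [hR]; exact_mod_cast h.2
    rcases lt_trichotomy h.1 c.1 with hlt | heq | hgt
    · have hne : h ≠ c := fun e => by rw [e] at hlt; exact lt_irrefl _ hlt
      rw [if_neg hne, if_pos (by have := c.2; omega)]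
      have e1 : g (h.1+1) = c*(c+1) - (h.1+1)*(h.1+2) := by
        simp only [hg]
        split_ifs with hc
        · have : c.1 = h.1+1 := by omega
          rw [this]; push_cast; ring
        · push_cast; ring
      have e2 : g h.1 = c*(c+1) - h.1*(h.1+1) := by simp only [hg]; rw [if_neg (by omega)]
      have e3 : g (h.1-1) - g h.1 = 2*h.1 := by
        rcases Nat.eq_zero_or_pos h.1 with h0 | h0
        · rw [h0]; simp
        · rw [e2]; simp only [hg]; rw [if_neg (by omega), Nat.cast_pred h0]; ring
      rw [e3, e1, e2]; apply le_of_eq; ring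
    · have he : h = c := Fin.ext heq
      rw [if_pos he]
      have e2 : g h.1 = 0 := by simp only [hg]; rw [if_pos heq.ge, heq]; ring
      have e1 : (if h.1 + 1 < N then g (h.1+1) - g h.1 else 0) ≤ 2*(R-1-h.1) := by
        split_ifs with hc
        · rw [e2]; simp only [hg]; rw [if_pos (by omega), heq]; push_cast; apply le_of_eq; ring
        · linarith
      have e3 : g (h.1-1) - g h.1 ≤ 2*h.1 := by
        rcases Nat.eq_zero_or_pos h.1 with h0 | h0
        · rw [h0]; simp
        · rw [e2]; simp only [hg]; rw [if_neg (by omega), Nat.cast_pred h0, heq]; apply le_of_eq; ring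
      linarith
    · have hne : h ≠ c := fun e => by rw [e] at hgt; exact lt_irrefl _ hgt
      rw [if_neg hne]
      have e2 : g h.1 = (R-1-c)*(R-c) - (R-1-h)*(R-h) := by simp only [hg]; rw [if_pos hgt.le]
      have e3 : g (h.1-1) = (R-1-c)*(R-c) - (R-h)*(R-h+1) := by
        simp only [hg]; rw [if_pos (by omega), Nat.cast_pred (by omega)]; ring
      have e1 : (if h.1 + 1 < N then g (h.1+1) - g h.1 else 0) ≤ 2*(R-1-h.1) := by
        split_ifs with hc
        · rw [e2]; simp only [hg]; rw [if_pos (by omega)]; push_cast; apply le_of_eq; ring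
        · linarith
      rw [e3]
      rw [e2] at e1 ⊢
      linarith
  have hl0 : 0 ≤ 1 - 1/(58*R^2) := by
    have : 1/(58*R^2) ≤ 1 := by rw [div_le_one (by positivity)]; nlinarith
    linarith
  have main : ∀ (t : ℕ) (h : Fin N), Ex t (fun _ n => (1 - 1/(6*R))^(n c)) h ≤ ψ h * (1 - 1/(58*R^2))^t := by
    intro t
    induction t with
    | zero => intro h; simp only [Ex, Pi.zero_apply, pow_zero, mul_one]; exact hψ1 h
    | succ t ih =>
      intro h
      have e : Ex t (fun (_ : Fin N) (n : Fin N → ℕ) => (1 - 1/(6*R))^((n + Pi.single h 1 : Fin N → ℕ) c)) h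
          = (1 - if h = c then 1/(6*R) else 0) * Ex t (fun _ n => (1 - 1/(6*R))^(n c)) h := by
        rw [← Ex_smul]; congr 1; funext g n
        by_cases hc : h = c
        · subst hc; simp [pow_succ]; ring
        · simp [hc, Pi.single_apply, Ne.symm hc]
      simp only [Ex, e]
      set E := Ex t (fun _ n => (1 - 1/(6*R))^(n c)) with hE
      set q := (1 - 1/(58*R^2))^t with hq
      have hq0 : 0 ≤ q := pow_nonneg hl0 t
      have h6R : 1/(6*R) ≤ 1 := by rw [div_le_one (by positivity)]; linarith
      have h6R0 : 0 ≤ 1/(6*R) := by positivity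
      rw [Fin.sum_univ_two]
      have i1 := ih h
      have i2 := ih (hd 0 h)
      have i3 := ih (hd 1 h)
      have hl := hlap h
      rw [Fin.sum_univ_two] at hl
      set θ := (if h = c then 1/(6*R) else 0) with hθ
      have hθ0 : 0 ≤ θ := by rw [hθ]; split_ifs <;> linarith
      have hθ1 : θ ≤ 1 := by rw [hθ]; split_ifs <;> linarith
      have i1' : (1 - 12/29*θ - 2/58) * E h ≤ (1 - 12/29*θ - 2/58) * (ψ h * q) :=
        mul_le_mul_of_nonneg_left i1 (by linarith)
      have step : E h + 12/29 * ((1-θ) * E h - E h) + 1/58 * ((E (hd 0 h) - E h) + (E (hd 1 h) - E h))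
         ≤ ((1 - 12/29*θ) * ψ h + 1/58 * ((ψ (hd 0 h) - ψ h) + (ψ (hd 1 h) - ψ h))) * q := by
        linarith
      refine step.trans ?_
      rw [pow_succ, ← hq, mul_comm q, ← mul_assoc]
      refine mul_le_mul_of_nonneg_right ?_ hq0
      have hψd : (ψ (hd 0 h) - ψ h) + (ψ (hd 1 h) - ψ h) = 1/R^2 * ((g (hd 0 h) - g h) + (g (hd 1 h) - g h)) := by
        simp only [hψ]; ring
      rw [hψd]
      have hRi : 0 < 1/R^2 := by positivity
      have hl2 := mul_le_mul_of_nonneg_left hl hRi.le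
      have hb := hψ2 h
      have hb1 := hψ1 h
      have e58 : 1/(58*R^2) = 1/58 * (1/R^2) := by field_simp
      rw [e58]
      by_cases hc : h = c
      · rw [if_pos hc] at hl2 hθ
        have : ψ h = 1 := by simp only [hψ, hg]; rw [hc, if_pos le_rfl]; ring
        rw [this, hθ]
        have e9 : 1/R^2 * (2*(R-1)) = 2*(1/R) - 2*(1/R^2) := by field_simp
        have e10 : 1/(6*R) = 1/6*(1/R) := by field_simp
        rw [e10]
        have : 1/R^2 ≤ 1/R := by apply one_div_le_one_div_of_le <;> nlinarith
        have : 0 < 1/R := by positivity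
        linarith
      · rw [if_neg hc] at hl2 hθ
        rw [hθ]
        nlinarith
  calc _ ≤ _ := main t h
    _ ≤ _ := mul_le_mul_of_nonneg_right (hψ2 h) (pow_nonneg hl0 t)

end

open Finset Filter
open scoped Classical

section omega
variable {X : Type*} [Fintype X] [DecidableEq X] {ι : Type*} [Fintype ι]

/-- slots of the product chain with a head -/
def sO {N : ℕ} (s : ι → X → X) : ι ⊕ Fin 2 → (Fin N → X) × Fin N → (Fin N → X) × Fin N
  | Sum.inl i, x => (Function.update x.1 x.2 (s i (x.1 x.2)), x.2)
  | Sum.inr b, x => (x.1, hd b x.2)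

/-- weights -/
def wO (w : ι → ℝ) : ι ⊕ Fin 2 → ℝ
  | Sum.inl i => w i
  | Sum.inr _ => 1

lemma sO_invol {N : ℕ} (s : ι → X → X) (hs : ∀ i x, s i (s i x) = x) (i) (x : (Fin N → X) × Fin N) :
    sO s i (sO s i x) = x := by
  rcases i with i | b
  · simp [sO, hs]
  · simp [sO, hd_invol]

/-- product kernel -/
noncomputable def Tk {N : ℕ} (P : Matrix X X ℝ) (n : Fin N → ℕ) (x y : Fin N → X) : ℝ :=
  ∏ c, (P^(n c)) (x c) (y c)

/-- the product chain -/
noncomputable def PO (N : ℕ) (s : ι → X → X) (w : ι → ℝ) : Matrix ((Fin N → X) × Fin N) ((Fin N → X) × Fin N) ℝ :=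
  slotP (sO s) (wO w) (1/58)

lemma PO_sto (N : ℕ) (s : ι → X → X) (w : ι → ℝ) (hs : ∀ i x, s i (s i x) = x) (hw : ∀ i, 0 ≤ w i)
    (hw12 : ∑ i, w i = 12) : Sto (PO N s w) := by
  refine slotP_sto _ _ _ (sO_invol s hs) ?_ (by norm_num) ?_
  · rintro (i | b)
    · exact hw i
    · simp [wO]
  · rw [Fintype.sum_sum_type]; simp only [wO, hw12]; norm_num

lemma Tk_step {N : ℕ} (s : ι → X → X) (w : ι → ℝ) (n : Fin N → ℕ) (x y : Fin N → X) (h : Fin N) :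
    (1/24) * ∑ i, w i * (Tk (slotP s w (1/24)) n (Function.update x h (s i (x h))) y - Tk (slotP s w (1/24)) n x y)
     = Tk (slotP s w (1/24)) (n + Pi.single h 1) x y - Tk (slotP s w (1/24)) n x y := by
  set P := slotP s w (1/24) with hP
  have e1 : ∀ z, Tk P n (Function.update x h z) y = (P^(n h)) z (y h) * ∏ c ∈ univ.erase h, (P^(n c)) (x c) (y c) := by
    intro z
    unfold Tk
    rw [← mul_prod_erase univ _ (mem_univ h)]
    congr 1
    · simp
    · refine prod_congr rfl fun c hc => ?_
      rw [Function.update_of_ne (ne_of_mem_erase hc)]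
  have e2 : Tk P n x y = (P^(n h)) (x h) (y h) * ∏ c ∈ univ.erase h, (P^(n c)) (x c) (y c) := by
    have := e1 (x h); rwa [Function.update_eq_self] at this
  have e3 : Tk P (n + Pi.single h 1) x y = (P^(n h+1)) (x h) (y h) * ∏ c ∈ univ.erase h, (P^(n c)) (x c) (y c) := by
    unfold Tk
    rw [← mul_prod_erase univ _ (mem_univ h)]
    congr 1
    · simp
    · refine prod_congr rfl fun c hc => ?_
      simp [Pi.single_apply, (ne_of_mem_erase hc)]
  have e4 : (P^(n h+1)) (x h) (y h) = (P^(n h)) (x h) (y h) + (1/24) * ∑ i, w i * ((P^(n h)) (s i (x h)) (y h) - (P^(n h)) (x h) (y h)) := by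
    rw [pow_succ_apply]
    exact ap_slotP s w (1/24) (fun z => (P^(n h)) z (y h)) (x h)
  simp only [e1, e3, e2, e4]
  simp only [← sub_mul, ← mul_assoc, ← sum_mul]
  ring

lemma PO_pow {N : ℕ} (s : ι → X → X) (w : ι → ℝ) (t : ℕ) (x y : Fin N → X) (h g : Fin N) :
    ((PO N s w)^t) (x, h) (y, g)
      = Ex t (fun g' n => if g' = g then Tk (slotP s w (1/24)) n x y else 0) h := by
  induction t generalizing x h with
  | zero =>
    simp only [pow_zero, Matrix.one_apply, Prod.mk.injEq, Ex, Tk, Pi.zero_apply]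
    by_cases hg : h = g
    · rw [if_pos hg]
      by_cases hx : x = y
      · simp [hx, hg]
      · rw [if_neg (fun h => hx h.1)]
        obtain ⟨c, hc⟩ := Function.ne_iff.1 hx
        symm; apply prod_eq_zero (mem_univ c); simp [hc]
    · simp [hg]
  | succ t ih =>
    rw [pow_succ_apply]
    have h1 := ap_slotP (sO s) (wO w) (1/58) (fun z => ((PO N s w)^t) z (y, g)) (x, h)
    simp only [ap] at h1
    rw [PO] at h1 ⊢
    rw [h1, ← PO, Fintype.sum_sum_type]
    simp only [sO, wO, ih, Ex, one_mul]
    set P := slotP s w (1/24) with hP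
    have h2 : ∑ i, w i * (Ex t (fun g' n => if g' = g then Tk P n (Function.update x h (s i (x h))) y else 0) h
         - Ex t (fun g' n => if g' = g then Tk P n x y else 0) h)
       = 24 * (Ex t (fun g' n => if g' = g then Tk P (n + Pi.single h 1) x y else 0) h
         - Ex t (fun g' n => if g' = g then Tk P n x y else 0) h) := by
      simp only [← Ex_sub, ← Ex_smul, ← Ex_sum]
      congr 1
      funext g' n
      by_cases hg : g' = g
      · simp only [hg, if_true]
        have := Tk_step s w n x y h
        rw [← hP] at this
        linarith
      · simp [hg]
    rw [h2]; ring

end omega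

/-- L1 distance of products -/
lemma prod_l1 {X : Type*} [Fintype X] {I : Type*} [Fintype I] [DecidableEq I] (p q : I → X → ℝ)
    (hp : ∀ c x, 0 ≤ p c x) (hq : ∀ c x, 0 ≤ q c x)
    (hp1 : ∀ c, ∑ x, p c x = 1) (hq1 : ∀ c, ∑ x, q c x = 1) :
    ∑ y : I → X, |∏ c, p c (y c) - ∏ c, q c (y c)| ≤ ∑ c, ∑ x, |p c x - q c x| := by
  have key : ∀ S : Finset I, ∑ y : I → X, |∏ c, (if c ∈ S then p c (y c) else q c (y c)) - ∏ c, q c (y c)|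
      ≤ ∑ c ∈ S, ∑ x, |p c x - q c x| := by
    intro S
    induction S using Finset.induction_on with
    | empty => simp
    | insert a S ha ih =>
      rw [sum_insert ha]
      have e : ∀ y : I → X, |∏ c, (if c ∈ insert a S then p c (y c) else q c (y c)) - ∏ c, q c (y c)|
         ≤ (∏ c, (if c = a then |p c (y c) - q c (y c)| else if c ∈ S then p c (y c) else q c (y c)))
          + |∏ c, (if c ∈ S then p c (y c) else q c (y c)) - ∏ c, q c (y c)| := by
        intro y
        refine (abs_sub_le _ (∏ c, (if c ∈ S then p c (y c) else q c (y c))) _).trans ?_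
        gcongr
        rw [← mul_prod_erase univ _ (mem_univ a),
          ← mul_prod_erase univ (fun c => if c ∈ S then p c (y c) else q c (y c)) (mem_univ a),
          ← mul_prod_erase univ (fun c => if c = a then |p c (y c) - q c (y c)| else if c ∈ S then p c (y c) else q c (y c)) (mem_univ a)]
        have e1 : ∏ c ∈ univ.erase a, (if c ∈ insert a S then p c (y c) else q c (y c))
          = ∏ c ∈ univ.erase a, (if c ∈ S then p c (y c) else q c (y c)) :=
          prod_congr rfl fun c hc => by simp [ne_of_mem_erase hc]
        have e2 : ∏ c ∈ univ.erase a, (if c = a then |p c (y c) - q c (y c)| else if c ∈ S then p c (y c) else q c (y c))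
          = ∏ c ∈ univ.erase a, (if c ∈ S then p c (y c) else q c (y c)) :=
          prod_congr rfl fun c hc => by simp [ne_of_mem_erase hc]
        rw [e1, e2]
        have e3 : 0 ≤ ∏ c ∈ univ.erase a, (if c ∈ S then p c (y c) else q c (y c)) :=
          prod_nonneg fun c _ => by split_ifs; exacts [hp _ _, hq _ _]
        simp only [mem_insert_self, if_true, ha, if_false]
        rw [← sub_mul, abs_mul, abs_of_nonneg e3]
      refine (sum_le_sum fun y _ => e y).trans ?_
      rw [sum_add_distrib]
      gcongr
      have e4 := Finset.prod_univ_sum (fun _ : I => (univ : Finset X))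
        (fun c x => if c = a then |p c x - q c x| else if c ∈ S then p c x else q c x)
      rw [Fintype.piFinset_univ] at e4
      rw [← e4, ← mul_prod_erase univ _ (mem_univ a)]
      have e5 : ∏ c ∈ univ.erase a, ∑ x, (if c = a then |p c x - q c x| else if c ∈ S then p c x else q c x) = 1 := by
        apply prod_eq_one
        intro c hc
        simp only [ne_of_mem_erase hc, if_false]
        split_ifs
        · exact hp1 c
        · exact hq1 c
      rw [e5]; simp
  have := key univ
  simpa using this

open Finset Filter
open scoped Classical

/-- head chain -/
noncomputable def QN (N : ℕ) : Matrix (Fin N) (Fin N) ℝ := slotP (hd (N := N)) (fun _ => 1) (1/58)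

lemma QN_sto (N : ℕ) : Sto (QN N) :=
  slotP_sto _ _ _ hd_invol (fun _ => by norm_num) (by norm_num) (by simp; norm_num)

lemma Ex_head {N : ℕ} (t : ℕ) (g h : Fin N) :
    Ex t (fun g' _ => if g' = g then 1 else 0) h = ((QN N)^t) h g := by
  induction t generalizing h with
  | zero => simp [Ex, Matrix.one_apply]
  | succ t ih =>
    simp only [Ex, ih]
    rw [pow_succ_apply]
    have := ap_slotP (hd (N := N)) (fun _ => 1) (1/58) (fun z => ((QN N)^t) z g) h
    simp only [ap] at this
    rw [QN] at this ⊢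
    rw [this]; simp

section omega
variable {X : Type*} [Fintype X] [DecidableEq X] {ι : Type*} [Fintype ι]

lemma sum_pi_one {N : ℕ} (c : Fin N) (f : X → ℝ) :
    ∑ y : Fin N → X, f (y c) = (Fintype.card X : ℝ)^(N-1) * ∑ x, f x := by
  have e4 := Finset.prod_univ_sum (fun _ : Fin N => (univ : Finset X))
        (fun c' x => if c' = c then f x else 1)
  rw [Fintype.piFinset_univ] at e4
  have : ∀ y : Fin N → X, ∏ c', (if c' = c then f (y c') else 1) = f (y c) := by
    intro y; simp
  simp only [this] at e4
  rw [← e4, ← mul_prod_erase univ _ (mem_univ c)]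
  have e5 : ∏ c' ∈ univ.erase c, ∑ x : X, (if c' = c then f x else 1) = (Fintype.card X : ℝ)^(N-1) := by
    have hcd : (univ.erase c).card = N - 1 := by rw [card_erase_of_mem (mem_univ c), card_univ, Fintype.card_fin]
    rw [← hcd, ← prod_const]
    apply prod_congr rfl
    intro c' hc
    simp [ne_of_mem_erase hc]
  rw [e5]; simp; ring

lemma Tk_l1 {N : ℕ} {P : Matrix X X ℝ} (hP : Sto P) (n : Fin N → ℕ) (x : Fin N → X) :
    ∑ y, |Tk P n x y - (1/(Fintype.card X:ℝ))^N| ≤ ∑ c, dd P (n c) (x c) := by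
  have := prod_l1 (I := Fin N) (fun c y => (P^(n c)) (x c) y) (fun _ _ => 1/(Fintype.card X:ℝ))
    (fun c y => (hP.pow _).nonneg _ _) (fun _ _ => by positivity) (fun c => (hP.pow _).row _)
    (fun c => sum_unif (x c))
  simpa [Tk, dd] using this

lemma card_O (N : ℕ) : (Fintype.card ((Fin N → X) × Fin N) : ℝ) = (Fintype.card X:ℝ)^N * N := by
  rw [Fintype.card_prod, Fintype.card_fun, Fintype.card_fin]; push_cast; rfl

lemma Ex_nc_lt {N : ℕ} (c : Fin N) (t T0 : ℕ) (h : Fin N) :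
    Ex t (fun _ n => if n c < T0 then (1:ℝ) else 0) h
     ≤ 2 * (1 - 1/(58*(N:ℝ)^2))^t / (1 - 1/(6*(N:ℝ)))^T0 := by
  have hN : (1:ℝ) ≤ N := by
    have : 1 ≤ N := by have := c.2; omega
    exact_mod_cast this
  have hr : 0 < 1 - 1/(6*(N:ℝ)) := by
    have : 1/(6*(N:ℝ)) < 1 := by rw [div_lt_one (by positivity)]; linarith
    linarith
  have hr1 : 1 - 1/(6*(N:ℝ)) ≤ 1 := by
    have : 0 ≤ 1/(6*(N:ℝ)) := by positivity
    linarith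
  set r := 1 - 1/(6*(N:ℝ)) with hrr
  have h1 := Ex_laplace c t h
  rw [le_div_iff₀ (by positivity), mul_comm, ← Ex_smul]
  refine (Ex_mono t (fun g n => ?_) h).trans h1
  split_ifs with hn
  · rw [mul_one]; exact pow_le_pow_of_le_one hr.le hr1 hn.le
  · rw [mul_zero]; positivity

lemma dd_O_le {N : ℕ} (s : ι → X → X) (w : ι → ℝ) (hs : ∀ i x, s i (s i x) = x) (hw : ∀ i, 0 ≤ w i)
    (hw12 : ∑ i, w i = 12) (t T0 : ℕ) (x : Fin N → X) (h : Fin N) :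
    dd (PO N s w) t (x, h) ≤ ∑ c, dd (slotP s w (1/24)) T0 (x c)
      + 2 * N * (2 * (1 - 1/(58*(N:ℝ)^2))^t / (1 - 1/(6*(N:ℝ)))^T0) + dd (QN N) t h := by
  have hP : Sto (slotP s w (1/24)) := slotP_sto _ _ _ hs hw (by norm_num) (by rw [hw12]; norm_num)
  set P := slotP s w (1/24) with hPP
  set C : ℝ := (Fintype.card X : ℝ) with hC
  unfold dd
  rw [Fintype.sum_prod_type, card_O, Fintype.card_fin]
  have hu : ∑ y : Fin N → X, (1/C)^N = 1 := by
    simp only [sum_const, card_univ, Fintype.card_fun, Fintype.card_fin, nsmul_eq_mul]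
    have : 0 < C := card_pos_of (x h)
    push_cast
    rw [← mul_pow]; rw [mul_one_div_cancel this.ne', one_pow]
  have e1 : ∀ y g, |((PO N s w)^t) (x,h) (y,g) - 1/(C^N*N)|
     ≤ Ex t (fun g' n => if g' = g then |Tk P n x y - (1/C)^N| else 0) h + (1/C)^N * |((QN N)^t) h g - 1/N| := by
    intro y g
    rw [PO_pow, ← hPP]
    have : Ex t (fun g' n => if g' = g then Tk P n x y else 0) h - 1/(C^N*N)
      = Ex t (fun g' n => if g' = g then Tk P n x y - (1/C)^N else 0) h + (1/C)^N * (((QN N)^t) h g - 1/N) := by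
      have e : (fun (g' : Fin N) (n : Fin N → ℕ) => if g' = g then Tk P n x y - (1/C)^N else 0)
        = fun g' n => (if g' = g then Tk P n x y else 0) - (1/C)^N * (if g' = g then 1 else 0) := by
        funext g' n; split_ifs <;> ring
      rw [e, Ex_sub, Ex_smul, Ex_head]
      have : 1/(C^N*N) = (1/C)^N * (1/N) := by rw [one_div_pow]; field_simp
      rw [this]; ring
    rw [this]
    refine (abs_add_le _ _).trans ?_
    rw [abs_mul, abs_of_nonneg (by positivity : 0 ≤ (1/C)^N)]
    gcongr
    refine (Ex_abs _ _ _).trans (Ex_mono t (fun g' n => ?_) h)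
    split_ifs <;> simp
  refine (sum_le_sum fun y _ => sum_le_sum fun g _ => e1 y g).trans ?_
  simp only [sum_add_distrib, ← Ex_sum]
  have hq : ∑ y : Fin N → X, ∑ g, (1/C)^N * |((QN N)^t) h g - 1/N| = ∑ g, |((QN N)^t) h g - 1/N| := by
    rw [sum_comm]
    refine sum_congr rfl fun g _ => ?_
    rw [← sum_mul, hu, one_mul]
  rw [hq]
  gcongr
  have e2 : ∀ (g : Fin N) (n : Fin N → ℕ), ∑ y, ∑ g', (if g = g' then |Tk P n x y - (1/C)^N| else 0)
     ≤ ∑ c, dd P T0 (x c) + ∑ c, 2 * (if n c < T0 then 1 else 0) := by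
    intro g n
    simp only [sum_ite_eq, mem_univ, if_true]
    refine (Tk_l1 hP n x).trans ?_
    rw [← sum_add_distrib]
    refine sum_le_sum fun c _ => ?_
    split_ifs with hc
    · have h1 := dd_le_two hP (n c) (x c)
      have h2 := dd_nonneg (P := P) T0 (x c)
      linarith
    · have := dd_anti hP (x c) (not_lt.1 hc)
      simp only at this
      linarith
  refine (Ex_mono t e2 h).trans ?_
  rw [Ex_add, Ex_const, Ex_sum]
  unfold dd
  gcongr
  simp only [Ex_smul]
  refine (sum_le_sum fun c _ => mul_le_mul_of_nonneg_left (Ex_nc_lt c t T0 h) (by norm_num)).trans ?_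
  simp only [sum_const, card_univ, Fintype.card_fin, nsmul_eq_mul]
  apply le_of_eq; ring

lemma phi_O_le {N : ℕ} (s : ι → X → X) (w : ι → ℝ) (hs : ∀ i x, s i (s i x) = x) (hw : ∀ i, 0 ≤ w i)
    (hw12 : ∑ i, w i = 12) (t T0 : ℕ) (D : ℝ) (hD : ∀ h, dd (QN N) t h ≤ D) [Nonempty X] (hN : 1 ≤ N) :
    phi (PO N s w) t ≤ N * phi (slotP s w (1/24)) T0
      + 2 * N * (2 * (1 - 1/(58*(N:ℝ)^2))^t / (1 - 1/(6*(N:ℝ)))^T0) + D := by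
  have hC : (0:ℝ) < Fintype.card X := card_pos_of (Classical.arbitrary X)
  have hN' : (0:ℝ) < N := by exact_mod_cast hN
  unfold phi
  rw [card_O, div_le_iff₀ (by positivity), Fintype.sum_prod_type]
  refine (sum_le_sum fun x _ => sum_le_sum fun h _ => (dd_O_le s w hs hw hw12 t T0 x h).trans
    (add_le_add_right (hD h) _)).trans ?_
  simp only [sum_const, card_univ, Fintype.card_fin, nsmul_eq_mul, ← mul_sum, sum_add_distrib]
  rw [sum_comm]
  simp only [fun c : Fin N => sum_pi_one c (fun x => dd (slotP s w (1/24)) T0 x)]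
  simp only [sum_const, card_univ, Fintype.card_fin, nsmul_eq_mul, Fintype.card_fun]
  push_cast
  have : (Fintype.card X:ℝ)^N = (Fintype.card X:ℝ)^(N-1) * Fintype.card X := by
    rw [← pow_succ]; congr 1; omega
  apply le_of_eq
  rw [this]
  field_simp

lemma dd_ge {P : Matrix X X ℝ} (hP : Sto P) (t : ℕ) (x : X) (E : X → Prop) :
    2 * (∑ y, (P^t) x y * (if E y then 1 else 0) - (∑ y, if E y then (1:ℝ) else 0) / Fintype.card X) ≤ dd P t x := by
  unfold dd
  set C : ℝ := (Fintype.card X : ℝ)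
  have h1 : ∑ y, ((P^t) x y - 1/C) * (2 * (if E y then 1 else 0) - 1)
     = 2 * (∑ y, (P^t) x y * (if E y then 1 else 0) - (∑ y, if E y then (1:ℝ) else 0) / C) := by
    have e : ∀ y, ((P^t) x y - 1/C) * (2 * (if E y then 1 else 0) - 1)
      = 2 * ((P^t) x y * (if E y then 1 else 0)) - (2/C) * (if E y then 1 else 0) - (P^t) x y + 1/C := fun y => by ring
    simp only [e, sum_add_distrib, sum_sub_distrib, ← mul_sum, (hP.pow t).row, sum_unif x]
    rw [sum_unif x]; ring
  rw [← h1]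
  refine sum_le_sum fun y _ => ?_
  split_ifs
  · refine le_trans (le_of_eq ?_) (le_abs_self _); ring
  · refine le_trans (le_of_eq ?_) (neg_le_abs _); ring

lemma Tk_marg {N : ℕ} {P : Matrix X X ℝ} (hP : Sto P) (n : Fin N → ℕ) (x : Fin N → X) (c : Fin N) (f : X → ℝ) :
    ∑ y, Tk P n x y * f (y c) = ∑ y, (P^(n c)) (x c) y * f y := by
  have e4 := Finset.prod_univ_sum (fun _ : Fin N => (univ : Finset X))
        (fun c' y => (P^(n c')) (x c') y * if c' = c then f y else 1)
  rw [Fintype.piFinset_univ] at e4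
  have : ∀ y : Fin N → X, ∏ c', ((P^(n c')) (x c') (y c') * if c' = c then f (y c') else 1) = Tk P n x y * f (y c) := by
    intro y; rw [prod_mul_distrib]; simp [Tk]
  simp only [this] at e4
  rw [← e4, ← mul_prod_erase univ _ (mem_univ c)]
  rw [prod_eq_one, mul_one]
  · simp
  · intro c' hc
    simp [ne_of_mem_erase hc, (hP.pow _).row]

lemma dd_O_ge {N : ℕ} (s : ι → X → X) (w : ι → ℝ) (hs : ∀ i x, s i (s i x) = x) (hw : ∀ i, 0 ≤ w i)
    (hw12 : ∑ i, w i = 12) (B : X → Prop) (a ε : ℝ) (t : ℕ) (x : Fin N → X) (c : Fin N)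
    (hx : ∀ n : ℕ, 1 - ∑ y, ((slotP s w (1/24))^n) (x c) y * (if B y then 1 else 0) ≤ a + n * ε) (hN : 1 ≤ N) :
    N * (2 * (1 - a - (∑ y, if B y then (1:ℝ) else 0) / Fintype.card X)) - 2 * ε * (12/29 * t) ≤ ∑ h, dd (PO N s w) t (x, h) := by
  have hP : Sto (slotP s w (1/24)) := slotP_sto _ _ _ hs hw (by norm_num) (by rw [hw12]; norm_num)
  set P := slotP s w (1/24) with hPP
  have hC : (0:ℝ) < Fintype.card X := card_pos_of (x c)
  set C : ℝ := (Fintype.card X : ℝ) with hCC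
  have hN' : (0:ℝ) < N := by exact_mod_cast hN
  set β := (∑ y, if B y then (1:ℝ) else 0) / C with hβ
  have key : ∀ h, 2 * (1 - a - β) - 2*ε * Ex t (fun _ n => (n c:ℝ)) h ≤ dd (PO N s w) t (x,h) := by
    intro h
    refine le_trans ?_ (dd_ge (PO_sto N s w hs hw hw12) t (x,h) (fun z => B (z.1 c)))
    rw [card_O, ← hCC, Fintype.sum_prod_type, Fintype.sum_prod_type]
    simp only [PO_pow, ← hPP]
    simp only [mul_comm _ (if B _ then (1:ℝ) else 0), ← Ex_smul, ← Ex_sum]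
    have e1 : (fun (g:Fin N) (n : Fin N → ℕ) => ∑ y : Fin N → X, ∑ g', (if B (y c) then (1:ℝ) else 0) * (if g = g' then Tk P n x y else 0))
       = fun g n => ∑ y, (P^(n c)) (x c) y * (if B y then 1 else 0) := by
      funext g n
      rw [← Tk_marg hP n x c]
      refine sum_congr rfl fun y _ => ?_
      rw [← mul_sum]; simp [mul_comm]
    rw [e1]
    have e2 : (∑ y : Fin N → X, ∑ g : Fin N, (if B (y c) then (1:ℝ) else 0)) / (C^N * N) = β := by
      simp only [sum_const, card_univ, Fintype.card_fin, nsmul_eq_mul, ← mul_sum]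
      rw [sum_pi_one c (fun y => if B y then (1:ℝ) else 0), ← hCC, hβ]
      have : C^N = C^(N-1) * C := by
        rw [← pow_succ]; congr 1; omega
      rw [this]; field_simp
    rw [e2]
    have e3 : Ex t (fun _ n => (1 - a) - ε * (n c:ℝ)) h ≤ Ex t (fun g n => ∑ y, (P^(n c)) (x c) y * (if B y then 1 else 0)) h :=
      Ex_mono t (fun g n => by have := hx (n c); linarith) h
    rw [Ex_sub, Ex_const, Ex_smul] at e3
    rw [Ex_smul]
    linarith
  have := sum_le_sum fun h (_ : h ∈ univ) => key h
  rw [sum_sub_distrib, ← mul_sum univ (fun h => Ex t (fun _ n => (n c:ℝ)) h) (2*ε), Ex_local] at this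
  simpa using this

lemma phi_O_ge {N : ℕ} (s : ι → X → X) (w : ι → ℝ) (hs : ∀ i x, s i (s i x) = x) (hw : ∀ i, 0 ≤ w i)
    (hw12 : ∑ i, w i = 12) (B O : X → Prop) (a ε β : ℝ) (t : ℕ) [Nonempty X]
    (hx : ∀ x, O x → ∀ n : ℕ, 1 - ∑ y, ((slotP s w (1/24))^n) x y * (if B y then 1 else 0) ≤ a + n * ε) (hN : 1 ≤ N)
    (hβ : (∑ y, if B y then (1:ℝ) else 0) ≤ β * Fintype.card X)
    (hO : (Fintype.card X:ℝ) ≤ N * ∑ y, if O y then (1:ℝ) else 0)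
    (hL : 0 ≤ 1 - a - β - ε * (12/29 * t) / N) :
    1 - a - β - ε * (12/29 * t) / N ≤ phi (PO N s w) t := by
  have hC : (0:ℝ) < Fintype.card X := card_pos_of (Classical.arbitrary X)
  have hN' : (0:ℝ) < N := by exact_mod_cast hN
  unfold phi
  rw [card_O, le_div_iff₀ (by positivity), Fintype.sum_prod_type]
  set C : ℝ := (Fintype.card X : ℝ) with hCC
  set L := 1 - a - β - ε * (12/29 * t) / N with hLL
  have h1 : ∀ x : Fin N → X, 2 * N * L * (1 - ∏ c, (1 - if O (x c) then (1:ℝ) else 0)) ≤ ∑ h, dd (PO N s w) t (x, h) := by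
    intro x
    by_cases h : ∃ c, O (x c)
    · obtain ⟨c, hc⟩ := h
      have e : ∏ c, (1 - if O (x c) then (1:ℝ) else 0) = 0 := prod_eq_zero (mem_univ c) (by simp [hc])
      rw [e]
      refine le_trans ?_ (dd_O_ge s w hs hw hw12 B a ε t x c (hx _ hc) hN)
      have : (∑ y, if B y then (1:ℝ) else 0) / Fintype.card X ≤ β := by rwa [div_le_iff₀ hC]
      have e2 : 2 * N * L * (1 - 0) = N * (2 * (1 - a - β)) - 2*ε*(12/29*t) := by
        rw [hLL]; field_simp; ring
      rw [e2]
      gcongr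
    · push Not at h
      have e : ∏ c, (1 - if O (x c) then (1:ℝ) else 0) = 1 := prod_eq_one (fun c _ => by simp [h c])
      rw [e]; simp only [sub_self, mul_zero]
      exact sum_nonneg fun _ _ => dd_nonneg _ _
  refine le_trans ?_ (sum_le_sum fun x _ => h1 x)
  rw [← mul_sum, sum_sub_distrib]
  have e4 := Finset.prod_univ_sum (fun _ : Fin N => (univ : Finset X))
        (fun _ y => (1:ℝ) - if O y then (1:ℝ) else 0)
  rw [Fintype.piFinset_univ] at e4
  rw [← e4]
  simp only [prod_const, sum_sub_distrib, sum_const, card_univ, Fintype.card_fin, Fintype.card_fun, nsmul_eq_mul, mul_one]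
  push_cast
  rw [← hCC]
  set o := ∑ y, if O y then (1:ℝ) else 0 with ho
  have hoC : o ≤ C := by
    have : o ≤ ∑ y : X, (1:ℝ) := sum_le_sum fun y _ => by split_ifs <;> norm_num
    simpa using this
  have h5 : (C - o)^N ≤ C^N / 2 := by
    have e5 : C - o = C * (1 - o/C) := by field_simp
    rw [e5, mul_pow]
    have h6 : 1 - o/C ≤ Real.exp (-(o/C)) := by have := Real.add_one_le_exp (-(o/C)); linarith
    have h7 : 0 ≤ 1 - o/C := by
      have : o/C ≤ 1 := by rw [div_le_one hC]; exact hoC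
      linarith
    have h8 : (1 - o/C)^N ≤ Real.exp (-1) := by
      refine (pow_le_pow_left₀ h7 h6 N).trans ?_
      rw [← Real.exp_nat_mul]
      apply Real.exp_le_exp.2
      have : 1 ≤ N * (o/C) := by rw [← mul_div_assoc, le_div_iff₀ hC]; linarith
      linarith
    have h9 : Real.exp (-1) ≤ 1/2 := by
      have := Real.exp_one_gt_d9
      rw [Real.exp_neg, inv_eq_one_div]
      apply one_div_le_one_div_of_le <;> linarith
    have : 0 < C^N := by positivity
    nlinarith
  have h10 : 0 ≤ N * L := by positivity
  nlinarith

end omega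

open Finset Filter
open scoped Classical

section gap
variable {X : Type*} [Fintype X] [DecidableEq X] {ι : Type*} [Fintype ι]

lemma gap_slot (s : ι → X → X) (w : ι → ℝ) (c w0 : ℝ) (hs : ∀ i x, s i (s i x) = x)
    (hw0 : 0 < w0) (hw : ∀ i, w0 ≤ w i) (hc : 0 < c) (hcw : 2 * c * ∑ i, w i ≤ 1) (hcw0 : c * w0 ≤ 1)
    (m : ℕ) (hm : 1 ≤ m) (r : X) (hr : ∀ x, ∃ l : List ι, l.length ≤ m ∧ l.foldr s r = x) (t : ℕ) (x : X) :
    (dd (slotP s w c) t x)^2 ≤ Fintype.card X * (1 - c * w0 / (4 * Fintype.card X * m^2))^t := by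
  haveI : Nonempty X := ⟨x⟩
  have hn : (1:ℝ) ≤ Fintype.card X := by
    have : 0 < Fintype.card X := Fintype.card_pos_iff.2 ⟨x⟩
    exact_mod_cast this
  have hm' : (1:ℝ) ≤ m := by exact_mod_cast hm
  have hwn : ∀ i, 0 ≤ w i := fun i => hw0.le.trans (hw i)
  have hsum : 0 ≤ ∑ i, w i := sum_nonneg fun i _ => hwn i
  refine gap_dd (P := slotP s w c) (slotP_sto _ _ _ hs hwn hc.le (by nlinarith))
    (slotP s w (2*c)) (slotP_sto _ _ _ hs hwn (by linarith) hcw) (slotP_lazy _ _ _) _ ?_ ?_ t x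
  · rw [div_le_one (by positivity)]
    have : (1:ℝ) ≤ m^2 := one_le_pow₀ hm'
    nlinarith
  · intro f hf
    rw [dirichlet _ _ _ hs]
    have h1 := radius_poincare s m r hr f hf
    have h2 : w0 * en s f ≤ ∑ i, w i * ∑ x, (f (s i x) - f x)^2 := by
      unfold en; rw [mul_sum]
      exact sum_le_sum fun i _ => mul_le_mul_of_nonneg_right (hw i) (sum_nonneg fun _ _ => sq_nonneg _)
    have h3 : c/2 * (w0 * en s f) ≤ c/2 * ∑ i, w i * ∑ x, (f (s i x) - f x)^2 :=
      mul_le_mul_of_nonneg_left h2 (by positivity)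
    refine le_trans ?_ h3
    rw [div_mul_eq_mul_div, div_le_iff₀ (by positivity)]
    have h4 := mul_le_mul_of_nonneg_left h1 (mul_pos hc hw0).le
    refine h4.trans (le_of_eq (by ring))

lemma phi_tendsto (s : ι → X → X) (w : ι → ℝ) (c w0 : ℝ) (hs : ∀ i x, s i (s i x) = x)
    (hw0 : 0 < w0) (hw : ∀ i, w0 ≤ w i) (hc : 0 < c) (hcw : 2 * c * ∑ i, w i ≤ 1) (hcw0 : c * w0 ≤ 1)
    (r : X) (hr : ∀ x, ∃ l : List ι, l.foldr s r = x) (ε : ℝ) (hε : 0 < ε) :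
    ∀ᶠ t in atTop, ∀ x, dd (slotP s w c) t x ≤ ε := by
  choose l hl using hr
  set m := univ.sup (fun x => (l x).length) + 1 with hm
  have hn : (1:ℝ) ≤ Fintype.card X := by
    have : 0 < Fintype.card X := Fintype.card_pos_iff.2 ⟨r⟩
    exact_mod_cast this
  have hm' : (1:ℝ) ≤ m := by rw [hm]; push_cast; linarith [(Nat.cast_nonneg (univ.sup (fun x => (l x).length)) : (0:ℝ) ≤ _)]
  have h1 := gap_slot s w c w0 hs hw0 hw hc hcw hcw0 m (by omega) r
    (fun x => ⟨l x, by have := Finset.le_sup (f := fun x => (l x).length) (mem_univ x); omega, hl x⟩)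
  set q := 1 - c * w0 / (4 * Fintype.card X * m^2) with hq
  have hq1 : q < 1 := by
    have : 0 < c * w0 / (4 * Fintype.card X * m^2) := by positivity
    linarith
  have hq0 : 0 ≤ q := by
    have : c * w0 / (4 * Fintype.card X * m^2) ≤ 1 := by
      rw [div_le_one (by positivity)]
      have : (1:ℝ) ≤ m^2 := one_le_pow₀ hm'
      nlinarith
    linarith
  have ht : Tendsto (fun t : ℕ => (Fintype.card X:ℝ) * q^t) atTop (nhds ((Fintype.card X:ℝ) * 0)) :=
    (tendsto_pow_atTop_nhds_zero_of_lt_one hq0 hq1).const_mul _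
  rw [mul_zero] at ht
  filter_upwards [ht.eventually (gt_mem_nhds (by positivity : (0:ℝ) < ε^2))] with t ht x
  have := h1 t x
  exact abs_le_of_sq_le_sq' (this.trans ht.le) hε.le |>.2

end gap

lemma hd_radius {N : ℕ} (hN : 1 ≤ N) (h : Fin N) :
    ∃ l : List (Fin 2), l.length ≤ N ∧ l.foldr hd (⟨0, hN⟩ : Fin N) = h := by
  have : ∀ k (hk : k < N), ∃ l : List (Fin 2), l.length = k ∧ l.foldr hd (⟨0, hN⟩ : Fin N) = ⟨k, hk⟩ := by
    intro k
    induction k with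
    | zero => intro hk; exact ⟨[], rfl, rfl⟩
    | succ k ih =>
      intro hk
      obtain ⟨l, h1, h2⟩ := ih (by omega)
      refine ⟨(⟨k % 2, by omega⟩ : Fin 2) :: l, by simp [h1], ?_⟩
      rw [List.foldr_cons, h2]
      simp [hd, hk]
  obtain ⟨l, h1, h2⟩ := this h.1 h.2
  exact ⟨l, by have := h.2; omega, h2⟩

lemma QN_mix {N : ℕ} (hN : 1 ≤ N) (t : ℕ) (h : Fin N) :
    (dd (QN N) t h)^2 ≤ N * (1 - 1/(232*(N:ℝ)^3))^t := by
  have := gap_slot (hd (N := N)) (fun _ => 1) (1/58) 1 hd_invol (by norm_num) (fun _ => le_rfl) (by norm_num)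
    (by simp; norm_num) (by norm_num) N hN ⟨0, hN⟩ (hd_radius hN) t h
  rw [Fintype.card_fin] at this
  refine this.trans (le_of_eq ?_)
  congr 2
  have : (N:ℝ) ≠ 0 := by positivity
  field_simp; ring

lemma QN_tendsto {N : ℕ} (hN : 1 ≤ N) (ε : ℝ) (hε : 0 < ε) :
    ∀ᶠ t in atTop, ∀ h, dd (QN N) t h ≤ ε :=
  phi_tendsto (hd (N := N)) (fun _ => 1) (1/58) 1 hd_invol (by norm_num) (fun _ => le_rfl) (by norm_num)
    (by simp; norm_num) (by norm_num) ⟨0, hN⟩ (fun h => by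
      obtain ⟨l, _, h⟩ := hd_radius hN h; exact ⟨l, h⟩) ε hε


lemma HH_conn {K : ℕ} {p : ℕ → ℕ → ℕ} (x : HH K p) :
    ∃ l : List IH, l.foldr hs (rt p (troot K, troot K)) = x := by
  obtain ⟨⟨a, b⟩, z⟩ := x
  obtain ⟨la, -, ha⟩ := tree_radius a
  obtain ⟨lb, -, hb⟩ := tree_radius b
  obtain ⟨lz, -, hz⟩ := tree_radius z
  refine ⟨lz.map Sum.inr ++ (lb.map (fun i => Sum.inl (Sum.inr i)) ++ la.map (fun i => Sum.inl (Sum.inl i))), ?_⟩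
  rw [List.foldr_append, List.foldr_append]
  have h1 : ∀ l : List I4, ∀ a b : TT K, (l.map (fun i => (Sum.inl (Sum.inl i) : IH))).foldr hs (rt p (a, b)) = rt p (l.foldr ts a, b) := by
    intro l a b
    induction l with
    | nil => rfl
    | cons i l ih => rw [List.map_cons, List.foldr_cons, ih, hs_rt]; rfl
  have h2 : ∀ l : List I4, ∀ a b : TT K, (l.map (fun i => (Sum.inl (Sum.inr i) : IH))).foldr hs (rt p (a, b)) = rt p (a, l.foldr ts b) := by
    intro l a b
    induction l with
    | nil => rfl
    | cons i l ih => rw [List.map_cons, List.foldr_cons, ih, hs_rt]; rfl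
  rw [h1, h2, ha, hb]
  have h3 : ∀ l : List I4, (l.map (Sum.inr : I4 → IH)).foldr hs (rt p (a, b)) = (⟨(a,b), l.foldr ts (troot _)⟩ : HH K p) := by
    intro l
    induction l with
    | nil => rfl
    | cons i l ih => rw [List.map_cons, List.foldr_cons, ih]; rfl
  rw [h3, hz]

lemma PH_tendsto (K : ℕ) (p : ℕ → ℕ → ℕ) {η : ℝ} (h0 : 0 ≤ η) (h1 : η ≤ 1/2) (ε : ℝ) (hε : 0 < ε) :
    ∀ᶠ t in atTop, ∀ x, dd (PH K p η) t x ≤ ε := by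
  refine phi_tendsto hs (wH η) (1/24) (1/2) hs_invol (by norm_num) ?_ (by norm_num) ?_ (by norm_num) _ HH_conn ε hε
  · rintro ((i | i) | i) <;> simp only [wH] <;> linarith
  · rw [sum_wH]; norm_num

lemma PO_tendsto {X : Type*} [Fintype X] [DecidableEq X] [Nonempty X] {ι : Type*} [Fintype ι] {N : ℕ} (hN : 1 ≤ N)
    (s : ι → X → X) (w : ι → ℝ) (hs : ∀ i x, s i (s i x) = x) (hw : ∀ i, 0 ≤ w i)
    (hw12 : ∑ i, w i = 12) (hP : ∀ ε > 0, ∀ᶠ t in atTop, ∀ x, dd (slotP s w (1/24)) t x ≤ ε) (ε : ℝ) (hε : 0 < ε) :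
    ∀ᶠ t in atTop, phi (PO N s w) t ≤ ε := by
  have hN' : (1:ℝ) ≤ N := by exact_mod_cast hN
  have hC : (0:ℝ) < Fintype.card X := card_pos_of (Classical.arbitrary X)
  obtain ⟨T0, hT0⟩ := (hP (ε/(3*N)) (by positivity)).exists
  have h1 : phi (slotP s w (1/24)) T0 ≤ ε/(3*N) := by
    unfold phi
    rw [div_le_iff₀ hC]
    refine (sum_le_sum fun x _ => hT0 x).trans ?_
    simp [card_univ]; apply le_of_eq; ring
  have h2 : (N:ℝ) * phi (slotP s w (1/24)) T0 ≤ ε/3 := by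
    have := mul_le_mul_of_nonneg_left h1 (by linarith : (0:ℝ) ≤ N)
    refine this.trans (le_of_eq (by field_simp))
  have hq : Tendsto (fun t : ℕ => (1 - 1/(58*(N:ℝ)^2))^t) atTop (nhds 0) := by
    apply tendsto_pow_atTop_nhds_zero_of_lt_one
    · have : 1/(58*(N:ℝ)^2) ≤ 1 := by rw [div_le_one (by positivity)]; nlinarith
      linarith
    · have : 0 < 1/(58*(N:ℝ)^2) := by positivity
      linarith
  have hq2 := ((hq.const_mul 2).div_const ((1 - 1/(6*(N:ℝ)))^T0)).const_mul (2*(N:ℝ))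
  simp only [mul_zero, zero_div] at hq2
  filter_upwards [hq2.eventually (gt_mem_nhds (by positivity : (0:ℝ) < ε/3)), QN_tendsto hN (ε/3) (by positivity)] with t h3 h4
  have := phi_O_le s w hs hw hw12 t T0 (ε/3) h4 hN
  linarith

open Finset Filter
open scoped Classical

section vchain
variable {Y : Type*} [Fintype Y] [DecidableEq Y] {I : Type*} [Fintype I] [DecidableEq I]

/-- action of the slots of `V` on the base -/
def aV (s : I → Y → Y) : I ⊕ Option I → Y → Y
  | Sum.inl i => s i
  | Sum.inr _ => id

/-- flipped coordinates -/
def dV : I ⊕ Option I → Option I → Bool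
  | Sum.inl i => fun j => decide (j = some i)
  | Sum.inr o => fun j => decide (j = none ∨ j = o)

/-- weights -/
def wV (w : I → ℝ) : I ⊕ Option I → ℝ
  | Sum.inl i => w i
  | Sum.inr _ => 1

/-- slots of `V` -/
def sV (s : I → Y → Y) (θ : I ⊕ Option I) (v : Y × (Option I → Bool)) : Y × (Option I → Bool) :=
  (aV s θ v.1, fun j => xor (v.2 j) (dV θ j))

/-- the chain on `V` -/
noncomputable def PV (s : I → Y → Y) (w : I → ℝ) : Matrix (Y × (Option I → Bool)) (Y × (Option I → Bool)) ℝ :=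
  slotP (sV s) (wV w) (1/58)

lemma aV_invol (s : I → Y → Y) (hs : ∀ i x, s i (s i x) = x) (θ) (y : Y) : aV s θ (aV s θ y) = y := by
  rcases θ with i | o
  · exact hs i y
  · rfl

lemma sV_invol (s : I → Y → Y) (hs : ∀ i x, s i (s i x) = x) (θ) (v) : sV s θ (sV s θ v) = v := by
  unfold sV
  simp [aV_invol s hs]

lemma dV_inj : Function.Injective (dV (I := I)) := by
  intro θ θ' h
  rcases θ with i | o <;> rcases θ' with i' | o'
  · have := congrFun h (some i); simp [dV] at this; rw [this]
  · have := congrFun h none; simp [dV] at this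
  · have := congrFun h none; simp [dV] at this
  · rcases o with _ | o <;> rcases o' with _ | o'
    · rfl
    · have := congrFun h (some o'); simp [dV] at this
    · have := congrFun h (some o); simp [dV] at this
    · have := congrFun h (some o); simp [dV] at this; rw [this]

lemma dV_ne (θ : I ⊕ Option I) : ∃ j, dV θ j = true := by
  rcases θ with i | o
  · exact ⟨some i, by simp [dV]⟩
  · exact ⟨none, by simp [dV]⟩

lemma sum_wV (w : I → ℝ) (hw : ∑ i, w i = 14) (hI : Fintype.card I = 14) : ∑ θ, wV w θ = 29 := by
  rw [Fintype.sum_sum_type]; simp only [wV, hw]; simp [hI]; norm_num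

lemma PV_sto (s : I → Y → Y) (w : I → ℝ) (hs : ∀ i x, s i (s i x) = x) (hw0 : ∀ i, 0 ≤ w i)
    (hw : ∑ i, w i = 14) (hI : Fintype.card I = 14) : Sto (PV s w) := by
  refine slotP_sto _ _ _ (sV_invol s hs) ?_ (by norm_num) ?_
  · rintro (i | o)
    · exact hw0 i
    · simp [wV]
  · rw [sum_wV w hw hI]; norm_num

/-- sign -/
def sg (a b : Bool) : ℝ := if a && b then -1 else 1

/-- characters -/
noncomputable def ch (S κ : Option I → Bool) : ℝ := ∏ j, sg (S j) (κ j)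

lemma sg_xor (a b c : Bool) : sg a (xor b c) = sg a b * sg a c := by
  cases a <;> cases b <;> cases c <;> simp [sg]

lemma ch_xor (S κ μ : Option I → Bool) : ch S (fun j => xor (κ j) (μ j)) = ch S κ * ch S μ := by
  unfold ch; simp only [sg_xor, prod_mul_distrib]

lemma ch_abs (S κ : Option I → Bool) : |ch S κ| = 1 := by
  unfold ch; rw [abs_prod]; apply prod_eq_one; intro j _; unfold sg; split_ifs <;> simp

lemma ch_le (S κ : Option I → Bool) : ch S κ ≤ 1 := by rw [← ch_abs S κ]; exact le_abs_self _

lemma ch_ge (S κ : Option I → Bool) : -1 ≤ ch S κ := by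
  have := neg_abs_le (ch S κ); rwa [ch_abs] at this

lemma ch_zero (κ : Option I → Bool) : ch (fun _ => false) κ = 1 := by
  simp [ch, sg]

lemma ch_orth (κ μ : Option I → Bool) :
    ∑ S, ch S κ * ch S μ = if κ = μ then (2:ℝ)^(Fintype.card (Option I)) else 0 := by
  have e4 := Finset.prod_univ_sum (fun _ : Option I => (univ : Finset Bool))
        (fun j a => sg a (κ j) * sg a (μ j))
  rw [Fintype.piFinset_univ] at e4
  simp only [ch, ← prod_mul_distrib]
  rw [← e4]
  have e : ∀ b c : Bool, ∑ a, sg a b * sg a c = if b = c then (2:ℝ) else 0 := by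
    intro b c; cases b <;> cases c <;> simp [sg] <;> norm_num
  simp only [e]
  split_ifs with h
  · subst h; simp
  · obtain ⟨j, hj⟩ := Function.ne_iff.1 h
    exact prod_eq_zero (mem_univ j) (by simp [hj])

/-- sector operator -/
noncomputable def MS (s : I → Y → Y) (w : I → ℝ) (S : Option I → Bool) : Matrix Y Y ℝ :=
  fun x y => dlt x y + (1/58) * ∑ θ, wV w θ * (ch S (dV θ) * dlt (aV s θ x) y - dlt x y)

lemma ap_MS (s : I → Y → Y) (w : I → ℝ) (S : Option I → Bool) (f : Y → ℝ) (x : Y) :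
    ap (MS s w S) f x = f x + (1/58) * ∑ θ, wV w θ * (ch S (dV θ) * f (aV s θ x) - f x) := by
  unfold ap MS
  simp only [add_mul, Finset.sum_add_distrib, sum_dlt_mul]
  congr 1
  simp only [mul_assoc, ← Finset.mul_sum, Finset.sum_mul]
  rw [Finset.sum_comm]
  congr 1
  refine sum_congr rfl fun θ _ => ?_
  rw [← mul_sum]; congr 1
  simp only [sub_mul, mul_assoc, sum_sub_distrib, ← mul_sum, sum_dlt_mul]

lemma PV_pow (s : I → Y → Y) (w : I → ℝ) (t : ℕ) (x y : Y) (κ μ : Option I → Bool) :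
    ((PV s w)^t) (x, κ) (y, μ) = (1/2)^(Fintype.card (Option I)) * ∑ S, ch S κ * ch S μ * ((MS s w S)^t) x y := by
  induction t generalizing x κ with
  | zero =>
    simp only [pow_zero, ← sum_mul, ch_orth, Matrix.one_apply, Prod.mk.injEq]
    by_cases hx : x = y
    · by_cases hk : κ = μ
      · simp [hx, hk]
      · simp [hk]
    · simp [hx]
  | succ t ih =>
    rw [pow_succ_apply]
    have h1 := ap_slotP (sV s) (wV w) (1/58) (fun z => ((PV s w)^t) z (y, μ)) (x, κ)
    simp only [ap] at h1
    rw [PV] at h1 ⊢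
    rw [h1, ← PV]
    simp only [sV, ih, ch_xor]
    have h2 : ∀ S, ((MS s w S)^(t+1)) x y = ((MS s w S)^t) x y + (1/58) * ∑ θ, wV w θ * (ch S (dV θ) * ((MS s w S)^t) (aV s θ x) y - ((MS s w S)^t) x y) := by
      intro S
      rw [pow_succ_apply]
      exact ap_MS s w S (fun z => ((MS s w S)^t) z y) x
    simp only [h2, mul_add, sum_add_distrib]
    congr 1
    simp only [mul_sum, ← sum_sub_distrib]
    rw [sum_comm]
    refine sum_congr rfl fun S _ => ?_
    refine sum_congr rfl fun θ _ => ?_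
    ring

lemma ch_none (S : Option I → Bool) : ch S (dV (Sum.inr none)) = sg (S none) true := by
  unfold ch; rw [Fintype.prod_option]; simp [dV, sg]

lemma ch_some (S : Option I → Bool) (i : I) : ch S (dV (Sum.inr (some i))) = sg (S none) true * sg (S (some i)) true := by
  unfold ch; rw [Fintype.prod_option]; 
  simp only [dV, decide_true, true_or]
  congr 1
  rw [prod_eq_single i]
  · simp
  · intro j _ hj; simp [hj, sg]
  · simp

lemma ch_sum_le (S : Option I → Bool) (hS : S ≠ fun _ => false) (hI : Fintype.card I = 14) :
    ∑ o, ch S (dV (Sum.inr o)) ≤ 13 := by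
  have : ∃ o, ch S (dV (Sum.inr o)) = -1 := by
    by_contra hcon
    push Not at hcon
    apply hS
    have h1 := hcon none
    rw [ch_none] at h1
    have hn : S none = false := by
      by_contra h; simp at h; simp [h, sg] at h1
    funext j
    rcases j with _ | i
    · exact hn
    · have h2 := hcon (some i)
      rw [ch_some, hn] at h2
      by_contra h; simp at h; simp [h, sg] at h2
  obtain ⟨o, ho⟩ := this
  rw [← add_sum_erase univ _ (mem_univ o), ho]
  have h2 : ∑ o' ∈ univ.erase o, ch S (dV (Sum.inr o')) ≤ ∑ o' ∈ univ.erase o, (1:ℝ) := sum_le_sum fun o' _ => ch_le _ _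
  rw [sum_const, card_erase_of_mem (mem_univ o), card_univ, Fintype.card_option, hI] at h2
  simp only [nsmul_eq_mul] at h2
  norm_num at h2 ⊢
  linarith

lemma ch_sum_ge (S : Option I → Bool) (hI : Fintype.card I = 14) :
    -15 ≤ ∑ o, ch S (dV (Sum.inr o)) := by
  have h2 : ∑ o' : Option I, (-1:ℝ) ≤ ∑ o' : Option I, ch S (dV (Sum.inr o')) := sum_le_sum fun o' _ => ch_ge _ _
  rw [sum_const, card_univ, Fintype.card_option, hI] at h2
  simp only [nsmul_eq_mul] at h2
  norm_num at h2 ⊢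
  linarith

lemma MS_row (s : I → Y → Y) (w : I → ℝ) (hw0 : ∀ i, 0 ≤ w i)
    (hw : ∑ i, w i = 14) (hI : Fintype.card I = 14) (S : Option I → Bool) (hS : S ≠ fun _ => false) (x : Y) :
    ∑ y, |MS s w S x y| ≤ 28/29 := by
  have e : ∀ y, MS s w S x y = ((29 + ∑ o, ch S (dV (Sum.inr o)))/58) * dlt x y
     + (1/58) * ∑ i, w i * (ch S (dV (Sum.inl i)) * dlt (s i x) y) := by
    intro y
    unfold MS
    rw [Fintype.sum_sum_type]
    simp only [wV, aV, one_mul, id, mul_sub, sum_sub_distrib, ← sum_mul, hw]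
    simp [hI]; ring
  have h1 := ch_sum_ge S hI
  have h2 := ch_sum_le S hS hI
  set σ := ∑ o, ch S (dV (Sum.inr o))
  have e2 : ∀ y, |MS s w S x y| ≤ ((29 + σ)/58) * dlt x y + (1/58) * ∑ i, w i * dlt (s i x) y := by
    intro y
    rw [e]
    refine (abs_add_le _ _).trans ?_
    rw [abs_mul, abs_mul, abs_of_nonneg (by linarith : 0 ≤ (29+σ)/58), abs_of_nonneg (dlt_nonneg _ _),
      abs_of_nonneg (by norm_num : (0:ℝ) ≤ 1/58)]
    gcongr
    refine (abs_sum_le_sum_abs _ _).trans (sum_le_sum fun i _ => ?_)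
    rw [abs_mul, abs_mul, ch_abs, one_mul, abs_of_nonneg (hw0 i), abs_of_nonneg (dlt_nonneg _ _)]
  refine (sum_le_sum fun y _ => e2 y).trans ?_
  rw [sum_add_distrib, ← mul_sum, ← mul_sum, sum_comm]
  simp only [← mul_sum, sum_dlt, mul_one, hw]
  linarith

lemma MS_pow_row (s : I → Y → Y) (w : I → ℝ) (hw0 : ∀ i, 0 ≤ w i)
    (hw : ∑ i, w i = 14) (hI : Fintype.card I = 14) (S : Option I → Bool) (hS : S ≠ fun _ => false) (t : ℕ) (x : Y) :
    ∑ y, |((MS s w S)^t) x y| ≤ (28/29)^t := by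
  induction t generalizing x with
  | zero => simp [Matrix.one_apply]; rw [sum_eq_single x] <;> simp +contextual [eq_comm]
  | succ t ih =>
    simp only [pow_succ_apply]
    calc _ ≤ ∑ y, ∑ z, |MS s w S x z| * |((MS s w S)^t) z y| := by
          refine sum_le_sum fun y _ => (abs_sum_le_sum_abs _ _).trans (le_of_eq ?_)
          simp only [abs_mul]
      _ = ∑ z, |MS s w S x z| * ∑ y, |((MS s w S)^t) z y| := by
          rw [sum_comm]; simp only [mul_sum]
      _ ≤ ∑ z, |MS s w S x z| * (28/29)^t := sum_le_sum fun z _ => mul_le_mul_of_nonneg_left (ih z) (abs_nonneg _)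
      _ ≤ _ := by
          rw [← sum_mul, pow_succ, mul_comm]
          exact mul_le_mul_of_nonneg_left (MS_row s w hw0 hw hI S hS x) (by positivity)

lemma MS_zero (s : I → Y → Y) (w : I → ℝ) : MS s w (fun _ => false) = slotP s w (1/58) := by
  apply mat_ext_ap
  intro f x
  rw [ap_MS, ap_slotP, Fintype.sum_sum_type]
  simp [wV, aV, ch_zero]

lemma card_V (hI : Fintype.card I = 14) : (Fintype.card (Y × (Option I → Bool)) : ℝ) = Fintype.card Y * 2^15 := by
  rw [Fintype.card_prod, Fintype.card_fun, Fintype.card_option, hI]; simp; norm_num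

lemma sum_kap (hI : Fintype.card I = 14) (c : ℝ) : ∑ _κ : Option I → Bool, c = 2^15 * c := by
  rw [sum_const, card_univ, Fintype.card_fun, Fintype.card_option, hI]; simp; norm_num

lemma dd_V_le (s : I → Y → Y) (w : I → ℝ) (hw0 : ∀ i, 0 ≤ w i)
    (hw : ∑ i, w i = 14) (hI : Fintype.card I = 14) (t : ℕ) (x : Y) (κ : Option I → Bool) :
    dd (PV s w) t (x, κ) ≤ dd (slotP s w (1/58)) t x + 2^15 * (28/29)^t := by
  unfold dd
  rw [Fintype.sum_prod_type, card_V hI]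
  have h1 : ∀ y μ, |((PV s w)^t) (x,κ) (y,μ) - 1/(Fintype.card Y * 2^15)|
     ≤ (1/2)^15 * |((slotP s w (1/58))^t) x y - 1/Fintype.card Y|
       + (1/2)^15 * ∑ S ∈ univ.erase (fun _ => false), |((MS s w S)^t) x y| := by
    intro y μ
    rw [PV_pow, Fintype.card_option, hI, ← add_sum_erase univ _ (mem_univ (fun _ => false)), MS_zero, ch_zero, ch_zero]
    have e : (1:ℝ)/(Fintype.card Y * 2^15) = (1/2)^15 * (1/Fintype.card Y) := by
      rw [one_div_pow]; field_simp
    rw [e]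
    have : ∀ a b c : ℝ, (1/2)^(14+1) * (1*1*a + b) - (1/2)^15 * c = (1/2)^15 * (a - c) + (1/2)^15 * b := fun a b c => by ring
    rw [this]
    refine (abs_add_le _ _).trans ?_
    rw [abs_mul, abs_mul, abs_of_nonneg (by positivity : (0:ℝ) ≤ (1/2)^15)]
    gcongr
    refine (abs_sum_le_sum_abs _ _).trans (sum_le_sum fun S _ => ?_)
    rw [abs_mul, abs_mul, ch_abs, ch_abs]; simp
  refine (sum_le_sum fun y _ => sum_le_sum fun μ _ => h1 y μ).trans ?_
  simp only [sum_kap hI, mul_add, ← mul_assoc, sum_add_distrib]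
  norm_num
  have h2 : ∑ y, ∑ S ∈ univ.erase (fun _ => false), |((MS s w S)^t) x y| ≤ ∑ _S : Option I → Bool, (28/29)^t := by
    rw [sum_comm]
    refine le_trans (sum_le_sum fun S hS => MS_pow_row s w hw0 hw hI S (ne_of_mem_erase hS) t x) ?_
    exact sum_le_sum_of_subset_of_nonneg (erase_subset _ _) (fun _ _ _ => by positivity)
  rw [sum_kap hI] at h2
  norm_num at h2 ⊢
  exact h2

lemma phi_V_le [Nonempty Y] (s : I → Y → Y) (w : I → ℝ) (hw0 : ∀ i, 0 ≤ w i)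
    (hw : ∑ i, w i = 14) (hI : Fintype.card I = 14) (t : ℕ) :
    phi (PV s w) t ≤ phi (slotP s w (1/58)) t + 2^15 * (28/29)^t := by
  have hC : (0:ℝ) < Fintype.card Y := card_pos_of (Classical.arbitrary Y)
  unfold phi
  rw [card_V hI, Fintype.sum_prod_type, div_le_iff₀ (by positivity)]
  refine (sum_le_sum fun y _ => sum_le_sum fun κ _ => dd_V_le s w hw0 hw hI t y κ).trans ?_
  simp only [sum_kap hI, ← mul_sum, sum_add_distrib, sum_const, card_univ, nsmul_eq_mul]
  apply le_of_eq; field_simp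

lemma PV_lump (s : I → Y → Y) (w : I → ℝ) (t : ℕ) (x y : Y) (κ : Option I → Bool) :
    ∑ μ, ((PV s w)^t) (x, κ) (y, μ) = ((slotP s w (1/58))^t) x y := by
  induction t generalizing x κ with
  | zero =>
    simp only [pow_zero, Matrix.one_apply, Prod.mk.injEq]
    by_cases hx : x = y
    · simp [hx]
    · simp [hx]
  | succ t ih =>
    simp only [pow_succ_apply]
    rw [sum_comm]
    simp only [← mul_sum]
    have h0 : ∀ z : Y × (Option I → Bool), ∑ μ, ((PV s w)^t) z (y, μ) = ((slotP s w (1/58))^t) z.1 y := fun z => ih z.1 z.2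
    simp only [h0]
    have h1 := ap_slotP (sV s) (wV w) (1/58) (fun z => ((slotP s w (1/58))^t) z.1 y) (x, κ)
    have h2 := ap_slotP s w (1/58) (fun z => ((slotP s w (1/58))^t) z y) x
    unfold ap at h1 h2
    rw [PV, h1, h2, Fintype.sum_sum_type]
    simp [wV, aV, sV]

lemma phi_V_ge [Nonempty Y] (s : I → Y → Y) (w : I → ℝ) (hI : Fintype.card I = 14) (t : ℕ) :
    phi (slotP s w (1/58)) t ≤ phi (PV s w) t := by
  have hC : (0:ℝ) < Fintype.card Y := card_pos_of (Classical.arbitrary Y)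
  unfold phi
  rw [card_V hI, Fintype.sum_prod_type, div_le_div_iff₀ (by positivity) (by positivity)]
  have h1 : ∀ x κ, dd (slotP s w (1/58)) t x ≤ dd (PV s w) t (x, κ) := by
    intro x κ
    unfold dd
    rw [card_V hI, Fintype.sum_prod_type]
    refine sum_le_sum fun y _ => ?_
    refine le_trans (le_of_eq ?_) (abs_sum_le_sum_abs _ _)
    rw [sum_sub_distrib, PV_lump, sum_kap hI]
    congr 2; field_simp
  have := sum_le_sum fun x (_ : x ∈ univ) => sum_le_sum fun κ (_ : κ ∈ univ) => h1 x κ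
  simp only [sum_kap hI, ← mul_sum] at this
  nlinarith

end vchain

open Finset Filter
open scoped Classical

section graph
variable {V : Type*} [Fintype V] [DecidableEq V] {Θ : Type*} [Fintype Θ]

/-- graph spanned by slots -/
def slotG (s : Θ → V → V) (hs : ∀ θ v, s θ (s θ v) = v) (hf : ∀ θ v, s θ v ≠ v) : SimpleGraph V where
  Adj v v' := ∃ θ, s θ v = v'
  symm := ⟨fun v v' ⟨θ, h⟩ => ⟨θ, by rw [← h, hs]⟩⟩
  loopless := ⟨fun v ⟨θ, h⟩ => hf θ v h⟩

variable {s : Θ → V → V} {hs : ∀ θ v, s θ (s θ v) = v} {hf : ∀ θ v, s θ v ≠ v}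

lemma slotG_sum (hi : ∀ v, Function.Injective (fun θ => s θ v)) (x : V) (f : V → ℝ) :
    (∑ z, if (slotG s hs hf).Adj x z then f z else 0) = ∑ θ, f (s θ x) := by
  rw [← sum_filter]
  have : univ.filter (fun z => (slotG s hs hf).Adj x z) = univ.image (fun θ => s θ x) := by
    ext z
    simp only [mem_filter, mem_univ, true_and, mem_image]
    exact Iff.rfl
  rw [this, sum_image (fun a _ b _ h => hi x h)]

lemma slotG_degree (x : V) [Fintype ((slotG s hs hf).neighborSet x)] :
    (slotG s hs hf).degree x ≤ Fintype.card Θ := by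
  unfold SimpleGraph.degree
  have : (slotG s hs hf).neighborFinset x ⊆ univ.image (fun θ => s θ x) := by
    intro z hz
    rw [SimpleGraph.mem_neighborFinset] at hz
    obtain ⟨θ, h⟩ := hz
    exact mem_image.2 ⟨θ, mem_univ _, h⟩
  exact (card_le_card this).trans card_image_le

lemma slotP_self (hf : ∀ θ v, s θ v ≠ v) (W : Θ → ℝ) (hW : ∑ θ, W θ = 29) (x : V) : slotP s W (1/58) x x = 1/2 := by
  unfold slotP
  have : ∀ θ, W θ * (dlt (s θ x) x - dlt x x) = - W θ := by
    intro θ; simp [dlt, (hf θ x).symm]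
  simp only [this, sum_neg_distrib, hW]
  simp [dlt]; norm_num

lemma slotP_adj (hi : ∀ v, Function.Injective (fun θ => s θ v)) (hf : ∀ θ v, s θ v ≠ v) (W : Θ → ℝ) (x : V) (θ : Θ) :
    slotP s W (1/58) x (s θ x) = W θ / 58 := by
  unfold slotP
  have e : dlt x (s θ x) = 0 := by simp [dlt, hf]
  have : ∀ θ', W θ' * (dlt (s θ' x) (s θ x) - dlt x (s θ x)) = if θ' = θ then W θ else 0 := by
    intro θ'; rw [e]
    by_cases h : θ' = θ
    · simp [h, dlt]
    · have : s θ x ≠ s θ' x := fun h' => h (hi x h').symm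
      simp [h, dlt, this]
  simp only [this]
  rw [e]; simp; ring

lemma slotP_not (W : Θ → ℝ) (c : ℝ) (x y : V) (hxy : y ≠ x) (hn : ¬ ∃ θ, s θ x = y) :
    slotP s W c x y = 0 := by
  unfold slotP
  push Not at hn
  have e : dlt x y = 0 := by simp [dlt, hxy]
  have : ∀ θ, W θ * (dlt (s θ x) y - dlt x y) = 0 := by
    intro θ; simp [dlt, hxy, (hn θ).symm]
  simp only [this]
  rw [e]; simp

lemma lazy_slot (hi : ∀ v, Function.Injective (fun θ => s θ v)) (W : Θ → ℝ) (hW : ∑ θ, W θ = 29)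
    (k : ℝ) (hk : 0 < k) (w : V → V → ℝ) (hw : ∀ θ v, w v (s θ v) = k * W θ) :
    lazyGraphP (slotG s hs hf) w = slotP s W (1/58) := by
  ext x y
  unfold lazyGraphP
  rw [slotG_sum hi]
  simp only [hw, ← mul_sum, hW]
  split_ifs with h1 h2
  · rw [h1, slotP_self hf W hW]
  · obtain ⟨θ, rfl⟩ := h2
    rw [slotP_adj hi hf, hw]
    field_simp; ring
  · rw [slotP_not W _ x y h1 h2]

lemma pi_slot (hi : ∀ v, Function.Injective (fun θ => s θ v)) (W : Θ → ℝ) (hW : ∑ θ, W θ = 29)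
    (k : ℝ) (hk : 0 < k) (w : V → V → ℝ) (hw : ∀ θ v, w v (s θ v) = k * W θ) (x : V) :
    graphPi (slotG s hs hf) w x = 1 / Fintype.card V := by
  unfold graphPi
  simp only [slotG_sum hi]
  simp only [hw, ← mul_sum, hW]
  have := card_pos_of x
  simp only [sum_const, card_univ, nsmul_eq_mul]
  field_simp

lemma mix_slot (hi : ∀ v, Function.Injective (fun θ => s θ v)) (W : Θ → ℝ) (hW : ∑ θ, W θ = 29)
    (k : ℝ) (hk : 0 < k) (w : V → V → ℝ) (hw : ∀ θ v, w v (s θ v) = k * W θ) :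
    graphMixAvg (slotG s hs hf) w = sInf {t | phi (slotP s W (1/58)) t ≤ 1/2} := by
  unfold graphMixAvg
  simp only [lazy_slot hi W hW k hk w hw, pi_slot hi W hW k hk w hw]
  congr 1
  ext t
  simp only [Set.mem_setOf_eq]
  have : ∑ x : V, 1/(Fintype.card V:ℝ) * ((∑ y, |((slotP s W (1/58))^t) x y - 1/Fintype.card V|)/2)
     = phi (slotP s W (1/58)) t / 2 := by
    unfold phi dd
    rw [← mul_sum, ← sum_div]; ring
  rw [this]
  constructor <;> intro h <;> linarith

lemma reach_of_pow (W : Θ → ℝ) (c : ℝ) (t : ℕ) (x y : V) (h : ((slotP s W c)^t) x y ≠ 0) :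
    (slotG s hs hf).Reachable x y := by
  induction t generalizing x with
  | zero =>
    rw [pow_zero, Matrix.one_apply] at h
    have : x = y := by by_contra hc; simp [hc] at h
    rw [this]
  | succ t ih =>
    rw [pow_succ_apply] at h
    obtain ⟨z, -, hz⟩ := exists_ne_zero_of_sum_ne_zero h
    have h1 := left_ne_zero_of_mul hz
    have h2 := ih z (right_ne_zero_of_mul hz)
    by_cases hzx : z = x
    · rwa [hzx] at h2
    · by_cases ha : ∃ θ, s θ x = z
      · exact (SimpleGraph.Adj.reachable (G := slotG s hs hf) ha).trans h2
      · exact absurd (slotP_not W c x z hzx ha) h1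

lemma conn_of_phi [Nonempty V] (W : Θ → ℝ) (c : ℝ) (h : ∀ ε > 0, ∃ t, phi (slotP s W c) t ≤ ε) :
    (slotG s hs hf).Connected := by
  haveI := ‹Nonempty V›
  refine ⟨fun x y => ?_⟩
  by_contra hn
  have hC := card_pos_of x
  obtain ⟨t, ht⟩ := h (1/(2*(Fintype.card V:ℝ)^2)) (by positivity)
  have h0 : ((slotP s W c)^t) x y = 0 := by
    by_contra h; exact hn (reach_of_pow W c t x y h)
  have h1 : 1/(Fintype.card V:ℝ) ≤ dd (slotP s W c) t x := by
    unfold dd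
    refine le_trans (le_of_eq ?_) (single_le_sum (f := fun y => |((slotP s W c)^t) x y - 1/Fintype.card V|) (fun _ _ => abs_nonneg _) (mem_univ y))
    simp [h0]
  have h2 : 1/(Fintype.card V:ℝ)/(Fintype.card V:ℝ) ≤ phi (slotP s W c) t := by
    unfold phi
    gcongr
    exact h1.trans (single_le_sum (f := fun x => dd (slotP s W c) t x) (fun _ _ => dd_nonneg _ _) (mem_univ x))
  have h3 := h2.trans ht
  rw [div_div, ← sq, div_le_div_iff₀ (by positivity) (by positivity)] at h3
  have : (0:ℝ) < (Fintype.card V:ℝ)^2 := by positivity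
  linarith

lemma phi_conj {U : Type*} [Fintype U] [DecidableEq U] (e : U ≃ V) (s : Θ → V → V) (W : Θ → ℝ) (c : ℝ) (t : ℕ) :
    phi (slotP (fun θ u => e.symm (s θ (e u))) W c) t = phi (slotP s W c) t := by
  have h1 : ∀ t x y, ((slotP (fun θ u => e.symm (s θ (e u))) W c)^t) x y = ((slotP s W c)^t) (e x) (e y) := by
    intro t
    have h0 : ∀ x y, (slotP (fun θ u => e.symm (s θ (e u))) W c) x y = (slotP s W c) (e x) (e y) := by
      intro x y
      have : ∀ a b, dlt (e.symm a) b = dlt a (e b) := fun a b => by simp [dlt, Equiv.eq_symm_apply]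
      have h' : dlt x y = dlt (e x) (e y) := by simp [dlt]
      simp only [slotP, this, h']
    induction t with
    | zero => intro x y; simp [Matrix.one_apply]
    | succ t ih =>
      intro x y
      rw [pow_succ_apply, pow_succ_apply, ← e.sum_comp]
      simp only [ih, h0]
  unfold phi dd
  simp only [h1, Fintype.card_congr e]
  rw [← e.sum_comp]
  congr 1
  refine sum_congr rfl fun x _ => ?_
  rw [← e.sum_comp]

end graph

lemma graph_real {Y : Type*} [Fintype Y] [DecidableEq Y] [Nonempty Y] {I : Type*} [Fintype I] [DecidableEq I]
    (s : I → Y → Y) (hs : ∀ i x, s i (s i x) = x) (w : I → ℝ) (η δ : ℝ) (h0 : 0 ≤ η) (h1 : η < 1)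
    (hδ : (1+η)/(1-η) ≤ 1 + δ) (hw : ∀ i, 1 - η ≤ w i ∧ w i ≤ 1 + η) (hI : Fintype.card I = 14) (hw14 : ∑ i, w i = 14)
    (hc : ∀ ε > 0, ∃ t, phi (PV s (fun _ => 1)) t ≤ ε) :
    ∃ (m : ℕ) (G : SimpleGraph (Fin m)) (w' : Fin m → Fin m → ℝ), Fintype.card Y ≤ m ∧ G.Connected ∧
      (∀ v (_ : Fintype (G.neighborSet v)), G.degree v ≤ 29) ∧ (∀ x y, w' x y = w' y x) ∧
      (∀ x y, G.Adj x y → 1 ≤ w' x y ∧ w' x y ≤ 1 + δ) ∧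
      graphMixAvg G (fun _ _ => 1) = sInf {t | phi (PV s (fun _ => 1)) t ≤ 1/2} ∧
      graphMixAvg G w' = sInf {t | phi (PV s w) t ≤ 1/2} := by
  have hη : 0 < 1 - η := by linarith
  let e : Fin (Fintype.card (Y × (Option I → Bool))) ≃ Y × (Option I → Bool) := (Fintype.equivFin _).symm
  let σ : I ⊕ Option I → Fin (Fintype.card (Y × (Option I → Bool))) → Fin (Fintype.card (Y × (Option I → Bool))) :=
    fun θ u => e.symm (sV s θ (e u))
  have hσ : ∀ θ v, σ θ (σ θ v) = v := fun θ v => by simp [σ, sV_invol s hs]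
  have hκ : ∀ θ v, (fun j => xor ((e v).2 j) ((e (σ θ v)).2 j)) = dV θ := by
    intro θ v; funext j; simp [σ, sV]
  have hf : ∀ θ v, σ θ v ≠ v := by
    intro θ v h
    obtain ⟨j, hj⟩ := dV_ne θ
    have := congrFun (hκ θ v) j
    rw [h, hj] at this; simp at this
  have hi : ∀ v, Function.Injective (fun θ => σ θ v) := by
    intro v θ θ' h
    simp only at h
    apply dV_inj
    rw [← hκ θ v, ← hκ θ' v, h]
  let w' : Fin (Fintype.card (Y × (Option I → Bool))) → Fin (Fintype.card (Y × (Option I → Bool))) → ℝ :=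
    fun u v => (1/(1-η)) * ∑ θ, if (fun j => xor ((e u).2 j) ((e v).2 j)) = dV θ then wV w θ else 0
  have hw' : ∀ θ v, w' v (σ θ v) = (1/(1-η)) * wV w θ := by
    intro θ v
    simp only [w', hκ, dV_inj.eq_iff]
    simp
  have hcard : Fintype.card (I ⊕ Option I) = 29 := by
    rw [Fintype.card_sum, Fintype.card_option, hI]
  have hW1 : ∑ θ, wV (fun _ : I => (1:ℝ)) θ = 29 := sum_wV _ (by simp [hI]) hI
  refine ⟨Fintype.card (Y × (Option I → Bool)), slotG σ hσ hf, w', ?_, ?_, ?_, ?_, ?_, ?_, ?_⟩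
  · rw [Fintype.card_prod]; exact Nat.le_mul_of_pos_right _ Fintype.card_pos
  · haveI : Nonempty (Fin (Fintype.card (Y × (Option I → Bool)))) := ⟨e.symm (Classical.arbitrary _)⟩
    refine conn_of_phi (wV (fun _ => 1)) (1/58) ?_
    intro ε hε
    obtain ⟨t, ht⟩ := hc ε hε
    refine ⟨t, ?_⟩
    rw [phi_conj e (sV s)]; exact ht
  · intro v _
    rw [← hcard]
    exact slotG_degree v
  · intro x y
    simp only [w', Bool.xor_comm]
  · rintro x y ⟨θ, rfl⟩
    rw [hw']
    have hb : 1 - η ≤ wV w θ ∧ wV w θ ≤ 1 + η := by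
      rcases θ with i | o
      · exact hw i
      · simp only [wV]; constructor <;> linarith
    rw [one_div, inv_mul_eq_div]
    refine ⟨by rw [le_div_iff₀ hη]; linarith [hb.1], le_trans ?_ hδ⟩
    gcongr; exact hb.2
  · rw [mix_slot hi (wV (fun _ => 1)) hW1 1 one_pos (fun _ _ => 1)]
    · congr 1; ext t; simp only [Set.mem_setOf_eq]; rw [phi_conj e (sV s)]; rfl
    · intro θ v; rcases θ with i | o <;> simp [wV]
  · rw [mix_slot hi (wV w) (sum_wV w hw14 hI) (1/(1-η)) (by positivity) w' hw']
    congr 1; ext t; simp only [Set.mem_setOf_eq]; rw [phi_conj e (sV s)]; rfl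

open Finset Filter
open scoped Classical

lemma lim_exp (A c : ℝ) (hc : 0 < c) (n : ℕ) :
    Tendsto (fun x : ℝ => A * x ^ n * Real.exp (-(x / c))) atTop (nhds 0) := by
  have h := (Real.tendsto_pow_mul_exp_neg_atTop_nhds_zero n).comp (tendsto_id.atTop_div_const hc)
  have h2 := h.const_mul (A * c ^ n)
  rw [mul_zero] at h2
  refine h2.congr fun x => ?_
  simp only [Function.comp, id, div_pow]
  field_simp

lemma lim_inv (A : ℝ) (n : ℕ) (hn : n ≠ 0) : Tendsto (fun x : ℝ => A / x ^ n) atTop (nhds 0) :=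
  tendsto_const_nhds.div_atTop (tendsto_pow_atTop hn)

lemma ev_num (M A1 A2 A4 : ℝ) (hM : 0 < M) : ∀ᶠ J : ℕ in atTop,
    A1 / ((4:ℝ)^J)^2 ≤ 1/32 ∧ A2 * (16*J+2) / (4:ℝ)^J ≤ 1/32 ∧
    24*M*((4:ℝ)^J)^5 * Real.exp (-((4:ℝ)^J/49152)) ≤ 1/32 ∧ A4 / ((4:ℝ)^J)^1 ≤ 1/32 ∧
    24*M*((4:ℝ)^J)^1 * Real.exp (-((4:ℝ)^J/(9*M))) ≤ 1/32 ∧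
    6*M*((4:ℝ)^J)^1 * Real.exp (-((4:ℝ)^J/(108*M^2))) ≤ 1/1024 ∧
    (2:ℝ)^15*(28/29)^J ≤ 1/32 := by
  have hX : Tendsto (fun J : ℕ => (4:ℝ)^J) atTop atTop := tendsto_pow_atTop_atTop_of_one_lt (by norm_num)
  have g : ∀ {f : ℕ → ℝ} {e : ℝ}, 0 < e → Tendsto f atTop (nhds 0) → ∀ᶠ J in atTop, f J ≤ e :=
    fun he hf => (hf.eventually (gt_mem_nhds he)).mono fun _ h => h.le
  have h1 := g (e := 1/32) (by norm_num) ((lim_inv A1 2 (by norm_num)).comp hX)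
  have h4 := g (e := 1/32) (by norm_num) ((lim_inv A4 1 (by norm_num)).comp hX)
  have h3 := g (e := 1/32) (by norm_num) ((lim_exp (24*M) 49152 (by norm_num) 5).comp hX)
  have h5 := g (e := 1/32) (by norm_num) ((lim_exp (24*M) (9*M) (by positivity) 1).comp hX)
  have h6 := g (e := 1/1024) (by norm_num) ((lim_exp (6*M) (108*M^2) (by positivity) 1).comp hX)
  have h7 : ∀ᶠ J : ℕ in atTop, (2:ℝ)^15*(28/29)^J ≤ 1/32 := by
    refine g (by norm_num) ?_
    simpa using (tendsto_pow_atTop_nhds_zero_of_lt_one (r := (28/29:ℝ)) (by norm_num) (by norm_num)).const_mul ((2:ℝ)^15)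
  have h2 : ∀ᶠ J : ℕ in atTop, A2 * (16*J+2) / (4:ℝ)^J ≤ 1/32 := by
    refine g (by norm_num) ?_
    have a := (tendsto_self_mul_const_pow_of_lt_one (r := (1/4:ℝ)) (by norm_num) (by norm_num)).const_mul (A2*16)
    have b := (tendsto_pow_atTop_nhds_zero_of_lt_one (r := (1/4:ℝ)) (by norm_num) (by norm_num)).const_mul (A2*2)
    have c := a.add b
    simp only [mul_zero, add_zero] at c
    refine c.congr fun J => ?_
    rw [one_div, inv_pow]; field_simp
  filter_upwards [h1, h2, h3, h4, h5, h6, h7] with J a b c d e f g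
  exact ⟨a, b, c, d, e, f, g⟩

lemma ratio_bd (N T : ℕ) (hN : 1 ≤ N) :
    2 * (1 - 1 / (58 * (N:ℝ) ^ 2)) ^ (39*N*T) / (1 - 1 / (6 * (N:ℝ))) ^ T ≤ 2 * Real.exp (-(T/(3*N))) := by
  have hN' : (1:ℝ) ≤ N := by exact_mod_cast hN
  have h1 : (1 - 1 / (58 * (N:ℝ) ^ 2)) ^ (39*N*T) ≤ Real.exp (-(39*T/(58*N))) := by
    have : 0 ≤ 1 - 1 / (58 * (N:ℝ) ^ 2) := by
      rw [sub_nonneg, div_le_one (by positivity)]; nlinarith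
    have h := pow_le_pow_left₀ this (Real.one_sub_le_exp_neg (1 / (58 * (N:ℝ) ^ 2))) (39*N*T)
    rw [← Real.exp_nat_mul] at h
    refine h.trans (le_of_eq ?_)
    congr 1; push_cast; field_simp
  have hp : 0 < 1 - 1 / (6 * (N:ℝ)) := by
    rw [sub_pos, div_lt_one (by positivity)]; linarith
  have h2 : Real.exp (-(T/(5*N))) ≤ (1 - 1 / (6 * (N:ℝ))) ^ T := by
    have a : Real.exp (-(1/(5*N))) ≤ 1 - 1 / (6 * (N:ℝ)) := by
      rw [Real.exp_neg, inv_le_comm₀ (Real.exp_pos _) hp]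
      refine le_trans ?_ (Real.add_one_le_exp _)
      rw [inv_eq_one_div, div_le_iff₀ hp]
      have : (1 / (5 * (N:ℝ)) + 1) * (1 - 1 / (6 * N)) - 1 = (N - 1)/(30*N^2) := by field_simp; ring
      have h' : 0 ≤ ((N:ℝ) - 1)/(30*N^2) := div_nonneg (by linarith) (by positivity)
      linarith
    have h := pow_le_pow_left₀ (Real.exp_pos _).le a T
    rw [← Real.exp_nat_mul] at h
    refine le_trans (le_of_eq ?_) h
    congr 1; ring
  rw [div_le_iff₀ (by positivity)]
  calc 2 * (1 - 1 / (58 * (N:ℝ) ^ 2)) ^ (39*N*T) ≤ 2 * Real.exp (-(39*T/(58*N))) := by gcongr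
    _ ≤ 2 * (Real.exp (-(T/(3*N))) * Real.exp (-(T/(5*N)))) := by
        rw [← Real.exp_add]; gcongr
        have : (39*T/(58*N):ℝ) - (T/(3*N) + T/(5*N)) = (121/870) * (T / N) := by field_simp; ring
        have h' : 0 ≤ (121/870) * ((T:ℝ) / N) := by positivity
        linarith
    _ ≤ _ := by rw [mul_assoc]; gcongr

lemma eps_bd (J : ℕ) (hJ : 1 ≤ J) (x : TT (8*J) × TT (8*J)) :
    dd (P0 (8*J)) (2^(12*J)) x ≤ 2*((4:ℝ)^J)^4 * Real.exp (-((4:ℝ)^J/49152)) := by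
  have h := prod_mix (K := 8*J) (by omega) (2^(12*J)) x
  have hn1 : 1 ≤ Fintype.card (TT (8*J)) := Fintype.card_pos_iff.2 ⟨x.1⟩
  have hn : (Fintype.card (TT (8*J)) : ℝ) ≤ 2*((4:ℝ)^J)^4 := by
    have : Fintype.card (TT (8*J)) ≤ 2^(8*J+1) := by rw [card_TT]; exact Nat.sub_le _ _
    have h' : (Fintype.card (TT (8*J)) : ℝ) ≤ 2^(8*J+1) := by exact_mod_cast this
    refine h'.trans (le_of_eq ?_)
    rw [pow_succ, mul_comm, ← pow_mul, show (4:ℝ) = 2^2 by norm_num, ← pow_mul]; congr 2; ring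
  set n : ℝ := (Fintype.card (TT (8*J)) : ℝ) with hnd
  have hn1' : (1:ℝ) ≤ n := by rw [hnd]; exact_mod_cast hn1
  have hJ' : (1:ℝ) ≤ J := by exact_mod_cast hJ
  have hX : ((J:ℝ))^2 ≤ (4:ℝ)^J := by
    have : (J:ℝ) ≤ 2^J := by exact_mod_cast (Nat.lt_two_pow_self (n := J)).le
    calc (J:ℝ)^2 ≤ (2^J)^2 := by gcongr
      _ = 4^J := by rw [← pow_mul, mul_comm, pow_mul]; norm_num
  have hs : ((2^(12*J) : ℕ):ℝ) = ((4:ℝ)^J)^6 := by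
    push_cast; rw [← pow_mul, show (4:ℝ) = 2^2 by norm_num, ← pow_mul]; congr 1; ring
  set X : ℝ := (4:ℝ)^J with hXd
  have hXp : 0 < X := by positivity
  push_cast at h
  have hb : 0 ≤ 1 - 1 / (192 * n * (8*(J:ℝ)) ^ 2) := by
    rw [sub_nonneg, div_le_one (by positivity)]
    have : 1 ≤ n * (8*(J:ℝ))^2 := by nlinarith
    nlinarith
  have h2 := pow_le_pow_left₀ hb (Real.one_sub_le_exp_neg (1 / (192 * n * (8*(J:ℝ)) ^ 2))) (2^(12*J))
  rw [← Real.exp_nat_mul, hs] at h2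
  have h3 : X^6 * -(1 / (192 * n * (8*(J:ℝ)) ^ 2)) ≤ -(X/49152) + -(X/49152) := by
    have : X * (1/24576) ≤ X^6 * (1 / (192 * n * (8*(J:ℝ)) ^ 2)) := by
      rw [mul_one_div, mul_one_div, div_le_div_iff₀ (by norm_num) (by positivity)]
      calc X * (192 * n * (8*(J:ℝ)) ^ 2) ≤ X * (192 * (2*X^4) * (64 * X)) := by
            have : (8*(J:ℝ))^2 ≤ 64 * X := by nlinarith
            gcongr
        _ = X^6*24576 := by ring
    linarith
  have h4 := h2.trans (Real.exp_le_exp.2 h3)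
  rw [Real.exp_add] at h4
  have hfin : dd (P0 (8*J)) (2^(12*J)) x ^2 ≤ (2*X^4 * Real.exp (-(X/49152)))^2 := by
    calc dd (P0 (8*J)) (2^(12*J)) x ^2 ≤ _ := h
      _ ≤ (2*X^4)^2 * (Real.exp (-(X/49152)) * Real.exp (-(X/49152))) := by
        gcongr
      _ = _ := by ring
  exact abs_le_of_sq_le_sq' hfin (by positivity) |>.2

lemma D_bd (N T J : ℕ) (M : ℝ) (hM : 0 < M) (hN : 1 ≤ N) (hNM : (N:ℝ) ≤ 6*M*4^J) (hT : 2*((4:ℝ)^J)^6 ≤ T)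
    (h6 : 6*M*((4:ℝ)^J)^1 * Real.exp (-((4:ℝ)^J/(108*M^2))) ≤ 1/1024) (h : Fin N) :
    dd (QN N) (39*N*T) h ≤ 1/32 := by
  have hN' : (1:ℝ) ≤ N := by exact_mod_cast hN
  have h1 := QN_mix hN (39*N*T) h
  have hX1 : (1:ℝ) ≤ 4^J := one_le_pow₀ (by norm_num)
  set X : ℝ := (4:ℝ)^J with hXd
  have hb : 0 ≤ 1 - 1 / (232 * (N:ℝ)^3) := by
    rw [sub_nonneg, div_le_one (by positivity)]
    have : (1:ℝ) ≤ (N:ℝ)^3 := one_le_pow₀ hN'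
    linarith
  have h2 := pow_le_pow_left₀ hb (Real.one_sub_le_exp_neg (1 / (232 * (N:ℝ)^3))) (39*N*T)
  rw [← Real.exp_nat_mul] at h2
  have h3 : ((39*N*T : ℕ):ℝ) * -(1 / (232 * (N:ℝ)^3)) ≤ -(X/(108*M^2)) := by
    have e : ((39*N*T : ℕ):ℝ) * -(1 / (232 * (N:ℝ)^3)) = -(39*T/(232*(N:ℝ)^2)) := by
      push_cast; field_simp
    rw [e, neg_le_neg_iff, div_le_div_iff₀ (by positivity) (by positivity)]
    have hN2 : (N:ℝ)^2 ≤ 36*M^2*X^2 := by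
      calc (N:ℝ)^2 ≤ (6*M*X)^2 := by gcongr
        _ = _ := by ring
    have hX4 : X^3 ≤ X^6 := pow_le_pow_right₀ hX1 (by norm_num)
    calc X * (232 * (N:ℝ)^2) ≤ X*(232*(36*M^2*X^2)) := by gcongr
      _ = 8352 * M^2 * X^3 := by ring
      _ ≤ 8424 * M^2 * X^6 := by gcongr; norm_num
      _ = 39 * (2*X^6) * (108*M^2) := by ring
      _ ≤ _ := by gcongr
  have h4 : dd (QN N) (39*N*T) h ^2 ≤ (1/32)^2 := by
    calc _ ≤ _ := h1
      _ ≤ (6*M*X^1) * Real.exp (-(X/(108*M^2))) := by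
        rw [pow_one]
        gcongr
        exact h2.trans (Real.exp_le_exp.2 h3)
      _ ≤ _ := h6.trans (by norm_num)
  exact abs_le_of_sq_le_sq' h4 (by norm_num) |>.2

open Finset Filter
open scoped Classical

lemma two_pow_X (J a b : ℕ) (h : b = 2*a) : (2:ℝ)^(b*J) = ((4:ℝ)^J)^a := by
  rw [← pow_mul, show (4:ℝ) = 2^2 by norm_num, ← pow_mul, h]; congr 1; ring

lemma up_phi {η : ℝ} (h0 : 0 < η) (h1 : η ≤ 1/10) (J i0 k t' : ℕ) (hJk : k + 10 ≤ J) (hJi : i0 ≤ J) (hi0 : 20 ≤ i0)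
    (ht : 491520/η^2*2^(14*J) ≤ (t':ℝ)) :
    phi (PH (8*J) (pf (14*J) i0 k η) 0) (2*(2*t'+2^(12*J))) ≤
      6*(128*2^(14*J)*(3/8)^i0/(Fintype.card (HH (8*J) (pf (14*J) i0 k η)) : ℝ)) +
      2*(2*(2^k*(5/((4:ℝ)^J)^3) + ((4:ℝ)^J)^6*(2^k*((16*J+2)/((4:ℝ)^J)^8))) + 2*((4:ℝ)^J)^4 * Real.exp (-((4:ℝ)^J/49152)))
      + 8*(2^(1+2*k)/(4:ℝ)^J)^2 := by
  have hJ1 : (1:ℝ) ≤ J := by exact_mod_cast (by omega : 1 ≤ J)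
  have hX1 : (1:ℝ) ≤ 4^J := one_le_pow₀ (by norm_num)
  have hX2 : (J:ℝ)^2 ≤ 4^J := by
    have : (J:ℝ) ≤ 2^J := by exact_mod_cast (Nat.lt_two_pow_self (n := J)).le
    calc (J:ℝ)^2 ≤ (2^J)^2 := by gcongr
      _ = 4^J := by rw [← pow_mul, mul_comm, pow_mul]; norm_num
  have hρ : (2:ℝ)^(14*J+1+2*k)*2 ≤ 4^(8*J) := by
    rw [← pow_succ, show (4:ℝ) = 2^2 by norm_num, ← pow_mul]
    exact pow_le_pow_right₀ (by norm_num) (by omega)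
  have hl : η^2*((6*J : ℕ):ℝ)*(((6*J:ℕ):ℝ)+i0) ≤ 2^(14*J) := by
    rw [two_pow_X J 7 14 rfl]
    have hi : (i0:ℝ) ≤ J := by exact_mod_cast hJi
    have hη : η^2 ≤ 1/100 := by nlinarith
    push_cast
    have : ((4:ℝ)^J)^1 ≤ ((4:ℝ)^J)^7 := pow_le_pow_right₀ hX1 (by norm_num)
    calc η^2*(6*J)*(6*J+i0) ≤ 1/100*(6*J)*(6*J+J) := by gcongr
      _ ≤ (J:ℝ)^2 := by nlinarith
      _ ≤ _ := by linarith
  have h := UH h0 h1 (8*J) (6*J) (14*J) i0 k t' (2^(12*J)) (by omega) (by omega) (by omega) (by omega) (by omega)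
    (by omega) hl ht _ (eps_bd J (by omega)) hρ
  refine h.trans ?_
  have e0 : ((2^(12*J) : ℕ):ℝ) = ((4:ℝ)^J)^6 := by push_cast; exact two_pow_X J 6 12 rfl
  have e1 : (1/2:ℝ)^(6*J) = 1/((4:ℝ)^J)^3 := by rw [one_div_pow, two_pow_X J 3 6 rfl]
  have e2 : (1/2:ℝ)^(8*J) = 1/((4:ℝ)^J)^4 := by rw [one_div_pow, two_pow_X J 4 8 rfl]
  have e3 : (4:ℝ)^(8*J) = ((4:ℝ)^J)^8 := by rw [← pow_mul]; congr 1; ring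
  have e4 : (1/4:ℝ)^(8*J) = 1/((4:ℝ)^J)^8 := by rw [one_div_pow, e3]
  have e5 : (2:ℝ)^(14*J+1+2*k) = 2^(1+2*k)*((4:ℝ)^J)^7 := by
    rw [← two_pow_X J 7 14 rfl, ← pow_add]; congr 1; ring
  rw [e0, e1, e2, e3, e4, e5]
  push_cast
  set X : ℝ := (4:ℝ)^J
  have hX0 : 0 < X := by linarith
  have f1 : 1/X^3 + 4*(1/X^4) ≤ 5/X^3 := by
    have : 1/X^4 ≤ 1/X^3 := by
      apply one_div_le_one_div_of_le (by positivity); exact pow_le_pow_right₀ hX1 (by norm_num)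
    have e : 5/X^3 = 1/X^3 + 4*(1/X^3) := by ring
    linarith
  have f2 : (2*(8*(J:ℝ))+2)*(1/X^8) = (16*J+2)/X^8 := by ring
  have f3 : 2^(1+2*k)*X^7/X^8 = 2^(1+2*k)/X := by field_simp
  rw [f2, f3]
  gcongr

lemma up_lem {η : ℝ} (h0 : 0 < η) (h1 : η ≤ 1/10) (J i0 k N t' : ℕ) (M : ℝ) (hM : 0 < M) (hJk : k + 10 ≤ J) (hJi : i0 ≤ J)
    (hi0 : 20 ≤ i0) (hN : 1 ≤ N) (hNM : (N:ℝ) ≤ 6*M*4^J)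
    (hNc : (N:ℝ)*2^(14*J) ≤ 2*(Fintype.card (HH (8*J) (pf (14*J) i0 k η)) : ℝ)*M)
    (ht : 491520/η^2*2^(14*J) ≤ (t':ℝ)) (hi : 1536*M*(3/8:ℝ)^i0 ≤ 1/16)
    (hev : 120*M*2^k / ((4:ℝ)^J)^2 ≤ 1/32 ∧ 24*M*2^k * (16*J+2) / (4:ℝ)^J ≤ 1/32 ∧
    24*M*((4:ℝ)^J)^5 * Real.exp (-((4:ℝ)^J/49152)) ≤ 1/32 ∧ 48*M*(2^(1+2*k))^2 / ((4:ℝ)^J)^1 ≤ 1/32 ∧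
    24*M*((4:ℝ)^J)^1 * Real.exp (-((4:ℝ)^J/(9*M))) ≤ 1/32 ∧
    6*M*((4:ℝ)^J)^1 * Real.exp (-((4:ℝ)^J/(108*M^2))) ≤ 1/1024 ∧
    (2:ℝ)^15*(28/29)^J ≤ 1/32) :
    phi (PO N (hs (K := 8*J) (p := pf (14*J) i0 k η)) (wH 0)) (39*N*(2*(2*t'+2^(12*J)))) ≤ 1/4 := by
  obtain ⟨a1, a2, a3, a4, a5, a6, -⟩ := hev
  have hX1 : (1:ℝ) ≤ 4^J := one_le_pow₀ (by norm_num)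
  have hc1 := card_HH_ge (8*J) (pf (14*J) i0 k η)
  have hc0 : (0:ℝ) < Fintype.card (HH (8*J) (pf (14*J) i0 k η)) := lt_of_lt_of_le (by positivity) hc1
  haveI : Nonempty (HH (8*J) (pf (14*J) i0 k η)) := Fintype.card_pos_iff.1 (by exact_mod_cast hc0)
  have hT : 2*((4:ℝ)^J)^6 ≤ ((2*(2*t'+2^(12*J)) : ℕ) : ℝ) := by
    push_cast; rw [two_pow_X J 6 12 rfl]
    have : (0:ℝ) ≤ t' := by positivity
    linarith
  have hN' : (1:ℝ) ≤ N := by exact_mod_cast hN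
  have hu := up_phi h0 h1 J i0 k t' hJk hJi hi0 ht
  set T := 2*(2*t'+2^(12*J))
  have h := phi_O_le (N := N) (hs (K := 8*J) (p := pf (14*J) i0 k η)) (wH 0) hs_invol (wH_nonneg le_rfl (by norm_num)) (sum_wH 0)
    (39*N*T) T (1/32) (D_bd N T J M hM hN hNM hT a6) hN
  have hr := ratio_bd N T hN
  set X : ℝ := (4:ℝ)^J
  have hX0 : 0 < X := by linarith
  have hq0 : X*(3*N) ≤ (T:ℝ)*(9*M) := by
    have : X^2 ≤ X^6 := pow_le_pow_right₀ hX1 (by norm_num)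
    calc X*(3*N) ≤ X*(3*(6*M*X)) := by gcongr
      _ = 2*X^2*(9*M) := by ring
      _ ≤ 2*X^6*(9*M) := by gcongr
      _ ≤ _ := by gcongr
  have b5 : 2*(N:ℝ)*(2 * (1 - 1 / (58 * (N:ℝ) ^ 2)) ^ (39*N*T) / (1 - 1 / (6 * (N:ℝ))) ^ T) ≤ 1/32 := by
    refine le_trans ?_ a5
    calc _ ≤ 2*(N:ℝ)*(2 * Real.exp (-(T/(3*N)))) := by gcongr
      _ ≤ 2*(6*M*X)*(2 * Real.exp (-(X/(9*M)))) := by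
        have hq : X/(9*M) ≤ (T:ℝ)/(3*N) := by
          rw [div_le_div_iff₀ (by positivity) (by positivity)]
          exact hq0
        have hq' := Real.exp_le_exp.2 (neg_le_neg hq)
        gcongr
      _ = _ := by ring
  have b0 : (N:ℝ)*phi (slotP (hs (K := 8*J) (p := pf (14*J) i0 k η)) (wH 0) (1/24)) T ≤ 6/32 := by
    refine (mul_le_mul_of_nonneg_left hu (by positivity)).trans ?_
    set c : ℝ := (Fintype.card (HH (8*J) (pf (14*J) i0 k η)) : ℝ)
    have c0 : N*(6*(128*2^(14*J)*(3/8)^i0/c)) ≤ 1/16 := by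
      refine le_trans ?_ hi
      have e : N*(6*(128*2^(14*J)*(3/8:ℝ)^i0/c)) = N*2^(14*J)*(768*(3/8:ℝ)^i0)/c := by ring
      rw [e, div_le_iff₀ hc0]
      calc _ ≤ 2*c*M*(768*(3/8:ℝ)^i0) := by gcongr
        _ = _ := by ring
    have c1 : N*(2^k*(5/X^3)) * 4 ≤ 1/32 := by
      refine le_trans ?_ a1
      calc _ ≤ (6*M*X)*(2^k*(5/X^3)) * 4 := by gcongr
        _ = _ := by field_simp; ring
    have c2 : N*(X^6*(2^k*((16*J+2)/X^8)))*4 ≤ 1/32 := by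
      refine le_trans ?_ a2
      calc _ ≤ (6*M*X)*(X^6*(2^k*((16*J+2)/X^8)))*4 := by gcongr
        _ = _ := by field_simp; ring
    have c3 : N*(2*X^4*Real.exp (-(X/49152)))*2 ≤ 1/32 := by
      refine le_trans ?_ a3
      calc _ ≤ (6*M*X)*(2*X^4*Real.exp (-(X/49152)))*2 := by gcongr
        _ = _ := by ring
    have c4 : N*(8*(2^(1+2*k)/X)^2) ≤ 1/32 := by
      refine le_trans ?_ a4
      calc _ ≤ (6*M*X)*(8*(2^(1+2*k)/X)^2) := by gcongr
        _ = _ := by field_simp; ring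
    linarith
  linarith

lemma low_lem {η : ℝ} (h0 : 0 < η) (h1 : η ≤ 1/10) (J i0 i2 k N t : ℕ) (hJk : k + 10 ≤ J) (hJi : i0 ≤ J) (hi0 : 20 ≤ i0)
    (hi2 : 5 + i2 < k) (hcb : (1+ca η)^5*(1/(1+cb η))^i2 ≤ 1/32) (hlog : Real.log (5+i2+i0)/Real.log k ≤ 1/16) (hN : 1 ≤ N)
    (hNc : (Fintype.card (HH (8*J) (pf (14*J) i0 k η)) : ℝ)*(5+i2+i0) ≤ N*2^(14*J))
    (ht : phi (PO N (hs (K := 8*J) (p := pf (14*J) i0 k η)) (wH η)) t ≤ 1/2) :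
    29/8*(N*2^(14*J)*Real.log k) ≤ t := by
  by_contra hlt
  push Not at hlt
  have hc1 := card_HH_ge (8*J) (pf (14*J) i0 k η)
  have hc0 : (0:ℝ) < Fintype.card (HH (8*J) (pf (14*J) i0 k η)) := lt_of_lt_of_le (by positivity) hc1
  haveI : Nonempty (HH (8*J) (pf (14*J) i0 k η)) := Fintype.card_pos_iff.1 (by exact_mod_cast hc0)
  have hN' : (1:ℝ) ≤ N := by exact_mod_cast hN
  have hlk : 0 < Real.log k := Real.log_pos (by exact_mod_cast (by omega : 1 < k))
  have hcone : cone k η 5 i2 := by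
    refine ⟨?_, hi2⟩
    have := cb_pos h0 h1
    rw [one_div_pow, mul_one_div, div_le_iff₀ (by positivity)] at hcb
    have : 0 < (1+cb η)^i2 := by positivity
    linarith
  have hO := card_OH_ge (8*J) (14*J) i0 k i2 η (by omega) (by omega) hcone (by omega)
  have hx : ∀ x : HH (8*J) (pf (14*J) i0 k η), OH i2 x → ∀ n : ℕ,
      1 - ∑ y, ((slotP hs (wH η) (1/24))^n) x y * (if BH k η y then 1 else 0) ≤ 1/8 + n*((1/2)^(14*J)/(6*Real.log k)) := by
    intro x hx n
    have h := WH h0 h1 (8*J) (14*J) i0 k n (by omega) (by omega) hi0 (by omega) x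
    rw [hx.1, hx.2] at h
    push_cast at h
    refine h.trans ?_
    have : (1/2:ℝ)^5 = 1/32 := by norm_num
    linarith
  have hβ : (∑ y : HH (8*J) (pf (14*J) i0 k η), if BH k η y then (1:ℝ) else 0) ≤ 1/16 * (Fintype.card (HH (8*J) (pf (14*J) i0 k η)) : ℝ) := by
    refine (card_BH_le (8*J) (14*J) i0 k η (by omega)).trans ?_
    have : (2:ℝ)^(14*J+1+2*k) * 2^4 ≤ 4^(8*J) := by
      rw [← pow_add, show (4:ℝ) = 2^2 by norm_num, ← pow_mul]
      exact pow_le_pow_right₀ (by norm_num) (by omega)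
    linarith
  have hO' : (Fintype.card (HH (8*J) (pf (14*J) i0 k η)) : ℝ) ≤ N * ∑ y : HH (8*J) (pf (14*J) i0 k η), if OH i2 y then (1:ℝ) else 0 := by
    set S := ∑ y : HH (8*J) (pf (14*J) i0 k η), if OH i2 y then (1:ℝ) else 0
    have hp : (0:ℝ) < 2^(14*J) := by positivity
    have hM : (0:ℝ) < 5+i2+i0 := by positivity
    have : (Fintype.card (HH (8*J) (pf (14*J) i0 k η)) : ℝ)*(5+i2+i0) ≤ (N*S)*(5+i2+i0) := by
      refine hNc.trans ?_
      have := mul_le_mul_of_nonneg_left hO (by positivity : (0:ℝ) ≤ N)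
      linarith
    exact le_of_mul_le_mul_right this hM
  have hε : ((1/2:ℝ)^(14*J)/(6*Real.log k))*(12/29*t)/N ≤ 1/4 := by
    rw [one_div_pow, div_le_iff₀ (by positivity), div_div, mul_comm, mul_one_div, div_le_iff₀ (by positivity)]
    nlinarith
  have h := phi_O_ge (N := N) (hs (K := 8*J) (p := pf (14*J) i0 k η)) (wH η) hs_invol (wH_nonneg h0.le (by linarith)) (sum_wH η)
    (BH k η) (OH i2) (1/8) ((1/2)^(14*J)/(6*Real.log k)) (1/16) t hx hN hβ hO' (by linarith)
  linarith

open Finset Filter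
open scoped Classical

section gen
variable {X : Type*} [Fintype X] [DecidableEq X] [Nonempty X] {ι : Type*} [Fintype ι] [DecidableEq ι]

/-- average distance of the final chain -/
noncomputable def FV (N : ℕ) (s : ι → X → X) (w : ι → ℝ) (t : ℕ) : ℝ := phi (PV (sO (N := N) s) (wO w)) t

lemma FV_le (N : ℕ) (hN : 1 ≤ N) (s : ι → X → X) (w : ι → ℝ) (hw0 : ∀ i, 0 ≤ wO w i) (hw : ∑ i, wO w i = 14)
    (hI : Fintype.card (ι ⊕ Fin 2) = 14) (t : ℕ) : FV N s w t ≤ phi (PO N s w) t + 2^15*(28/29)^t := by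
  have : Nonempty (Fin N) := ⟨⟨0, hN⟩⟩
  exact phi_V_le (sO (N := N) s) (wO w) hw0 hw hI t

lemma FV_ge (N : ℕ) (hN : 1 ≤ N) (s : ι → X → X) (w : ι → ℝ)
    (hI : Fintype.card (ι ⊕ Fin 2) = 14) (t : ℕ) : phi (PO N s w) t ≤ FV N s w t := by
  have : Nonempty (Fin N) := ⟨⟨0, hN⟩⟩
  exact phi_V_ge (sO (N := N) s) (wO w) hI t

lemma FV_graph (N : ℕ) (hN : 1 ≤ N) (s : ι → X → X) (hs : ∀ i x, s i (s i x) = x) (w w1 : ι → ℝ) (hw1 : wO w1 = fun _ => 1)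
    (η δ : ℝ) (h0 : 0 ≤ η) (h1 : η < 1)
    (hδ : (1+η)/(1-η) ≤ 1 + δ) (hw : ∀ i, 1 - η ≤ wO w i ∧ wO w i ≤ 1 + η) (hI : Fintype.card (ι ⊕ Fin 2) = 14)
    (hw14 : ∑ i, wO w i = 14) (hc : ∀ ε > 0, ∃ t, FV N s w1 t ≤ ε) :
    ∃ (m : ℕ) (G : SimpleGraph (Fin m)) (w' : Fin m → Fin m → ℝ), Fintype.card ((Fin N → X) × Fin N) ≤ m ∧ G.Connected ∧
      (∀ v (_ : Fintype (G.neighborSet v)), G.degree v ≤ 29) ∧ (∀ x y, w' x y = w' y x) ∧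
      (∀ x y, G.Adj x y → 1 ≤ w' x y ∧ w' x y ≤ 1 + δ) ∧
      graphMixAvg G (fun _ _ => 1) = sInf {t | FV N s w1 t ≤ 1/2} ∧
      graphMixAvg G w' = sInf {t | FV N s w t ≤ 1/2} := by
  have : Nonempty (Fin N) := ⟨⟨0, hN⟩⟩
  unfold FV at *
  rw [hw1] at *
  exact graph_real (sO (N := N) s) (sO_invol s hs) (wO w) η δ h0 h1 hδ hw hI hw14 hc

end gen

lemma wO_one : wO (wH 0) = fun _ => 1 := by
  funext i
  rcases i with ((i|i)|i)|i <;> simp [wO, wH]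

lemma card_fourteen : Fintype.card (IH ⊕ Fin 2) = 14 := by
  have h := sum_wH 0
  have e : ∀ i, wH 0 i = 1 := by intro i; rcases i with (i|i)|i <;> simp [wH]
  simp only [e, sum_const, card_univ, nsmul_eq_mul, mul_one] at h
  have h' : Fintype.card IH = 12 := by exact_mod_cast h
  rw [Fintype.card_sum, h', Fintype.card_fin]

lemma sum_wO (η : ℝ) : ∑ i, wO (wH η) i = 14 := by
  rw [Fintype.sum_sum_type]
  have := sum_wH η
  simp only [wO, this]
  norm_num

lemma wO_bd {η : ℝ} (h0 : 0 ≤ η) (i : IH ⊕ Fin 2) : 1 - η ≤ wO (wH η) i ∧ wO (wH η) i ≤ 1 + η := by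
  rcases i with ((i|i)|i)|i <;> simp only [wO, wH] <;> constructor <;> linarith

lemma pv_tendsto {η : ℝ} (h0 : 0 ≤ η) (h1 : η ≤ 1/2) (K : ℕ) (p : ℕ → ℕ → ℕ) [Nonempty (HH K p)] (N : ℕ) (hN : 1 ≤ N) (ε : ℝ) (hε : 0 < ε) :
    ∃ t, FV N (hs (K := K) (p := p)) (wH η) t ≤ ε := by
  haveI : Nonempty (Fin N) := ⟨⟨0, hN⟩⟩
  have a := PO_tendsto hN (hs (K := K) (p := p)) (wH η) hs_invol (wH_nonneg h0 (by linarith)) (sum_wH η)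
    (fun e he => PH_tendsto K p h0 h1 e he) (ε/2) (by linarith)
  have b : Tendsto (fun t : ℕ => (2:ℝ)^15*(28/29)^t) atTop (nhds 0) := by
    simpa using (tendsto_pow_atTop_nhds_zero_of_lt_one (r := (28/29:ℝ)) (by norm_num) (by norm_num)).const_mul ((2:ℝ)^15)
  obtain ⟨t, h, h'⟩ := (a.and (b.eventually (gt_mem_nhds (by linarith : (0:ℝ) < ε/2)))).exists
  refine ⟨t, ?_⟩
  have c := FV_le N hN (hs (K := K) (p := p)) (wH η) (fun i => by linarith [(wO_bd h0 i).1]) (sum_wO η) card_fourteen t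
  linarith

set_option maxHeartbeats 1600000 in
lemma exists_one (η δ : ℝ) (h0 : 0 < η) (h1 : η ≤ 1/10) (hδ : (1+η)/(1-η) ≤ 1+δ) (hδ0 : 0 < δ) (n : ℕ) :
    ∃ (m : ℕ) (G : SimpleGraph (Fin m)) (w' : Fin m → Fin m → ℝ), n ≤ m ∧ G.Connected ∧
      (∀ v (_ : Fintype (G.neighborSet v)), G.degree v ≤ 29) ∧ (∀ x y, w' x y = w' y x) ∧
      (∀ x y, G.Adj x y → 1 ≤ w' x y ∧ w' x y ≤ 1 + δ) ∧
      (graphMixAvg G (fun _ _ => 1) : ℝ) ≤ δ * (graphMixAvg G w' : ℝ) := by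
  have hca := ca_pos h0
  have hcb := cb_pos h0 h1
  -- i2
  obtain ⟨i2, hi2⟩ : ∃ i2 : ℕ, (1+ca η)^5*(1/(1+cb η))^i2 ≤ 1/32 := by
    have := (tendsto_pow_atTop_nhds_zero_of_lt_one (r := (1/(1+cb η))) (by positivity)
      (by rw [div_lt_one (by positivity)]; linarith)).const_mul ((1+ca η)^5)
    rw [mul_zero] at this
    obtain ⟨i, hi⟩ := (this.eventually (gt_mem_nhds (by norm_num : (0:ℝ) < 1/32))).exists
    exact ⟨i, hi.le⟩
  -- i0
  obtain ⟨i0, hi0, hi⟩ : ∃ i0 : ℕ, 20 ≤ i0 ∧ 1536*((5:ℝ)+i2+i0)*(3/8:ℝ)^i0 ≤ 1/16 := by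
    have a := (tendsto_self_mul_const_pow_of_lt_one (r := (3/8:ℝ)) (by norm_num) (by norm_num)).const_mul 1536
    have b := (tendsto_pow_atTop_nhds_zero_of_lt_one (r := (3/8:ℝ)) (by norm_num) (by norm_num)).const_mul (1536*((5:ℝ)+i2))
    have c := b.add a
    simp only [mul_zero, add_zero] at c
    obtain ⟨i, hi, hi'⟩ := ((c.eventually (gt_mem_nhds (by norm_num : (0:ℝ) < 1/16))).and (eventually_ge_atTop 20)).exists
    refine ⟨i, hi', le_trans (le_of_eq (by ring)) hi.le⟩
  have hM : (0:ℝ) < 5+i2+i0 := by positivity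
  -- k
  obtain ⟨k, hk1, hk2, hk3⟩ : ∃ k : ℕ, 5 + i2 < k ∧ 16*Real.log (5+i2+i0) ≤ Real.log k ∧ 10^8/(η^2*δ) ≤ Real.log k := by
    have hl := Real.tendsto_log_atTop.comp (tendsto_natCast_atTop_atTop (R := ℝ))
    obtain ⟨k, a, b, c⟩ := ((eventually_gt_atTop (5+i2)).and ((hl.eventually (eventually_ge_atTop (16*Real.log (5+i2+i0)))).and
      (hl.eventually (eventually_ge_atTop (10^8/(η^2*δ)))))).exists
    exact ⟨k, a, b, c⟩
  have hlk : 0 < Real.log k := Real.log_pos (by exact_mod_cast (by omega : 1 < k))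
  -- J
  obtain ⟨J, hev, hJk, hJi, hJn⟩ := ((ev_num (5+i2+i0) (120*(5+i2+i0)*2^k) (24*(5+i2+i0)*2^k) (48*(5+i2+i0)*(2^(1+2*k))^2) hM).and
    ((eventually_ge_atTop (k+10)).and ((eventually_ge_atTop i0).and (eventually_ge_atTop n)))).exists
  have hc1 := card_HH_ge (8*J) (pf (14*J) i0 k η)
  have hc2 := card_HH_le (8*J) (14*J) i0 k η (by omega)
  have hc0 : (0:ℝ) < Fintype.card (HH (8*J) (pf (14*J) i0 k η)) := lt_of_lt_of_le (by positivity) hc1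
  haveI : Nonempty (HH (8*J) (pf (14*J) i0 k η)) := Fintype.card_pos_iff.1 (by exact_mod_cast hc0)
  have hP : (0:ℝ) < 2^(14*J) := by positivity
  have hX1 : (1:ℝ) ≤ 4^J := one_le_pow₀ (by norm_num)
  -- N
  obtain ⟨N, hN1, hNc, hNc2, hNM⟩ : ∃ N : ℕ, 1 ≤ N ∧
      (Fintype.card (HH (8*J) (pf (14*J) i0 k η)) : ℝ)*(5+i2+i0) ≤ N*2^(14*J) ∧
      (N:ℝ)*2^(14*J) ≤ 2*(Fintype.card (HH (8*J) (pf (14*J) i0 k η)) : ℝ)*(5+i2+i0) ∧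
      (N:ℝ) ≤ 6*(5+i2+i0)*4^J := by
    set c : ℝ := (Fintype.card (HH (8*J) (pf (14*J) i0 k η)) : ℝ)
    have hM1 : (1:ℝ) ≤ 5+i2+i0 := by
      have : (0:ℝ) ≤ i2 := by positivity
      have : (0:ℝ) ≤ i0 := by positivity
      linarith
    set M : ℝ := 5+i2+i0
    have hPc : (2:ℝ)^(14*J) ≤ c := by
      refine le_trans ?_ hc1
      rw [show (4:ℝ) = 2^2 by norm_num, ← pow_mul]
      exact pow_le_pow_right₀ (by norm_num) (by omega)
    have h1c : (2:ℝ)^(14*J) ≤ c*M := by nlinarith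
    have hpos : 0 < c*M/2^(14*J) := by positivity
    have hg := Nat.le_ceil (c*M/2^(14*J))
    have hl := (Nat.ceil_lt_add_one hpos.le).le
    refine ⟨⌈c*M/2^(14*J)⌉₊, Nat.ceil_pos.2 hpos, ?_, ?_, ?_⟩
    · rwa [div_le_iff₀ hP] at hg
    · calc _ ≤ (c*M/2^(14*J)+1)*2^(14*J) := by gcongr
        _ = c*M + 2^(14*J) := by field_simp
        _ ≤ _ := by linarith
    · have : c ≤ 5*(2^(14*J)*4^J) := by
        refine hc2.trans ?_
        have e1 : (4:ℝ)^(8*J) = 2^(14*J)*4^J := by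
          rw [show (4:ℝ) = 2^2 by norm_num, ← pow_mul, ← pow_mul, ← pow_add]; congr 1; ring
        have e2 : (2:ℝ)^(14*J+1+2*k) ≤ 4^(8*J) := by
          rw [show (4:ℝ) = 2^2 by norm_num, ← pow_mul]
          exact pow_le_pow_right₀ (by norm_num) (by omega)
        linarith
      refine hl.trans ?_
      have : c*M/2^(14*J) ≤ 5*M*4^J := by
        rw [div_le_iff₀ hP]
        calc c*M ≤ 5*(2^(14*J)*4^J)*M := by gcongr
          _ = _ := by ring
      nlinarith
  haveI : Nonempty (Fin N) := ⟨⟨0, hN1⟩⟩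
  have hN' : (1:ℝ) ≤ N := by exact_mod_cast hN1
  -- time
  set t' := ⌈491520/η^2*2^(14*J)⌉₊ with ht'
  have ht : 491520/η^2*2^(14*J) ≤ (t':ℝ) := Nat.le_ceil _
  have ht2 : (t':ℝ) ≤ 491520/η^2*2^(14*J) + 1 := (Nat.ceil_lt_add_one (by positivity)).le
  have hup := up_lem h0 h1 J i0 k N t' (5+i2+i0) hM hJk hJi hi0 hN1 hNM hNc2 ht hi hev
  set TU := 39*N*(2*(2*t'+2^(12*J))) with hTU
  have hTUJ : J ≤ TU := by
    have a : J < 2^(12*J) := lt_of_le_of_lt (by omega : J ≤ 12*J) (Nat.lt_two_pow_self)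
    rw [hTU]
    calc J ≤ 2^(12*J) := a.le
      _ ≤ 2*(2*t'+2^(12*J)) := by omega
      _ ≤ 39*N*(2*(2*t'+2^(12*J))) := Nat.le_mul_of_pos_left _ (by omega)
  have hU : FV N (hs (K := 8*J) (p := pf (14*J) i0 k η)) (wH 0) TU ≤ 1/2 := by
    have c := FV_le N hN1 (hs (K := 8*J) (p := pf (14*J) i0 k η)) (wH 0)
      (fun i => by linarith [(wO_bd le_rfl i).1]) (sum_wO 0) card_fourteen TU
    have d : (2:ℝ)^15*(28/29)^TU ≤ 1/32 := by
      refine le_trans ?_ hev.2.2.2.2.2.2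
      gcongr 2^15 * ?_
      exact pow_le_pow_of_le_one (by norm_num) (by norm_num) hTUJ
    linarith
  have hW : ∀ t, FV N (hs (K := 8*J) (p := pf (14*J) i0 k η)) (wH η) t ≤ 1/2 →
      29/8*(N*2^(14*J)*Real.log k) ≤ t := by
    intro t h
    refine low_lem h0 h1 J i0 i2 k N t hJk hJi hi0 hk1 hi2 ?_ hN1 hNc ?_
    · rw [div_le_iff₀ hlk]; linarith
    · exact (FV_ge N hN1 (hs (K := 8*J) (p := pf (14*J) i0 k η)) (wH η) card_fourteen t).trans h
  obtain ⟨m, G, w', g1, g2, g3, g4, g5, g6, g7⟩ := FV_graph N hN1 (hs (K := 8*J) (p := pf (14*J) i0 k η))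
    hs_invol (wH η) (wH 0) wO_one η δ h0.le (by linarith) hδ (wO_bd h0.le) card_fourteen (sum_wO η)
    (pv_tendsto le_rfl (by norm_num) (8*J) (pf (14*J) i0 k η) N hN1)
  refine ⟨m, G, w', ?_, g2, g3, g4, g5, ?_⟩
  · have hcn : 4^(8*J) ≤ Fintype.card (HH (8*J) (pf (14*J) i0 k η)) := by exact_mod_cast hc1
    have hJ4 : J ≤ 4^(8*J) := by
      have : 8*J < 4^(8*J) := Nat.lt_pow_self (by norm_num)
      omega
    have hY : Fintype.card (HH (8*J) (pf (14*J) i0 k η)) ≤ Fintype.card ((Fin N → HH (8*J) (pf (14*J) i0 k η)) × Fin N) := by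
      rw [Fintype.card_prod, Fintype.card_fun, Fintype.card_fin]
      have : 1 ≤ Fintype.card (HH (8*J) (pf (14*J) i0 k η)) := Fintype.card_pos
      exact (Nat.le_self_pow (by omega) _).trans (Nat.le_mul_of_pos_right _ hN1)
    omega
  · rw [g6, g7]
    have hmem := Nat.sInf_mem (s := {t | FV N (hs (K := 8*J) (p := pf (14*J) i0 k η)) (wH η) t ≤ 1/2})
      (pv_tendsto h0.le (by linarith) (8*J) (pf (14*J) i0 k η) N hN1 (1/2) (by norm_num))
    have hw := hW _ hmem
    have hu : sInf {t | FV N (hs (K := 8*J) (p := pf (14*J) i0 k η)) (wH 0) t ≤ 1/2} ≤ TU := Nat.sInf_le hU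
    have hu' : ((sInf {t | FV N (hs (K := 8*J) (p := pf (14*J) i0 k η)) (wH 0) t ≤ 1/2} : ℕ) : ℝ) ≤ TU := by
      exact_mod_cast hu
    refine hu'.trans (le_trans ?_ (mul_le_mul_of_nonneg_left hw hδ0.le))
    have hη2 : 0 < η^2 := by positivity
    have hη3 : η^2 ≤ 1 := by nlinarith
    have k1 : (10:ℝ)^8/η^2 ≤ δ*Real.log k := by
      rw [div_le_iff₀ (by positivity)] at hk3
      rw [div_le_iff₀ hη2]; linarith
    have p1 : (2:ℝ)^(12*J) ≤ 2^(14*J) := pow_le_pow_right₀ (by norm_num) (by omega)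
    have p2 : (1:ℝ) ≤ 2^(14*J) := one_le_pow₀ (by norm_num)
    have p3 : (2:ℝ)^(14*J) ≤ 2^(14*J)/η^2 := by
      rw [le_div_iff₀ hη2]; nlinarith
    have k2 : (2*(2*t'+2^(12*J)) : ℝ) ≤ 2000000*(2^(14*J)/η^2) := by
      have e : 491520/η^2*2^(14*J) = 491520*(2^(14*J)/η^2) := by ring
      rw [e] at ht2
      linarith
    calc (TU:ℝ) = 39*N*(2*(2*t'+2^(12*J))) := by rw [hTU]; push_cast; ring
      _ ≤ 39*N*(2000000*(2^(14*J)/η^2)) := by gcongr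
      _ = (78/100)*(N*2^(14*J))*(10^8/η^2) := by ring
      _ ≤ (29/8)*(N*2^(14*J))*(δ*Real.log k) :=
        mul_le_mul (mul_le_mul_of_nonneg_right (by norm_num) (by positivity)) k1 (by positivity) (by positivity)
      _ = _ := by ring

/-- The average total variation mixing time is not robust: bounded-degree graphs with
weights in `[1, 1+δ_n]`, `δ_n → 0`, whose average mixing time changes by a diverging factor. -/
theorem average_mixing_not_robust :
    ∃ (m : ℕ → ℕ) (G : ∀ n, SimpleGraph (Fin (m n)))
      (w : ∀ n, Fin (m n) → Fin (m n) → ℝ) (δ : ℕ → ℝ) (D : ℕ),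
      Tendsto m atTop atTop ∧
      (∀ n, (G n).Connected) ∧
      (∀ n v, (G n).degree v ≤ D) ∧
      (∀ n, 0 < δ n) ∧ Tendsto δ atTop (nhds 0) ∧
      (∀ n x y, w n x y = w n y x) ∧
      (∀ n x y, (G n).Adj x y → 1 ≤ w n x y ∧ w n x y ≤ 1 + δ n) ∧
      (∀ n, (graphMixAvg (G n) (fun _ _ => 1) : ℝ) ≤
        δ n * (graphMixAvg (G n) (w n) : ℝ)) := by
  have h : ∀ n : ℕ, ∃ (m : ℕ) (G : SimpleGraph (Fin m)) (w' : Fin m → Fin m → ℝ), n ≤ m ∧ G.Connected ∧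
      (∀ v (_ : Fintype (G.neighborSet v)), G.degree v ≤ 29) ∧ (∀ x y, w' x y = w' y x) ∧
      (∀ x y, G.Adj x y → 1 ≤ w' x y ∧ w' x y ≤ 1 + 2/((n:ℝ)+9)) ∧
      (graphMixAvg G (fun _ _ => 1) : ℝ) ≤ 2/((n:ℝ)+9) * (graphMixAvg G w' : ℝ) := by
    intro n
    have hn : (0:ℝ) ≤ n := by positivity
    refine exists_one (1/((n:ℝ)+10)) _ (by positivity) ?_ ?_ (by positivity) n
    · apply one_div_le_one_div_of_le (by norm_num); linarith
    · have h1 : (1:ℝ) - 1/((n:ℝ)+10) = (n+9)/(n+10) := by field_simp; ring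
      have h2 : (1:ℝ) + 1/((n:ℝ)+10) = (n+11)/(n+10) := by field_simp; ring
      rw [h1, h2]
      apply le_of_eq
      field_simp
      ring
  choose m G w a b c d e f using h
  refine ⟨m, G, w, fun n => 2/((n:ℝ)+9), 29, tendsto_atTop_mono a tendsto_id, b, fun n v => c n v _,
    fun n => by positivity, ?_, d, e, f⟩
  exact tendsto_const_nhds.div_atTop (tendsto_atTop_add_const_right _ _ tendsto_natCast_atTop_atTop)
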